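/- Let γ be the standard Gaussian measure on ℝⁿ, let r > 0, and let K and L be origin-symmetric convex bodies in ℝⁿ with K ⊆ L and both containing r·B₂ⁿ. If p ∈ [0,1] satisfies p ≥ 1 − r/(√n + 1/4), then for every λ ∈ [0,1], γ(λ·K +_p (1−λ)·L) ≥ γ(K)^λ · γ(L)^{1−λ}. -/

import Mathlib

open MeasureTheory
open scoped RealInnerProductSpace ENNReal

noncomputable section

abbrev Euc (n : ℕ) : Type := EuclideanSpace ℝ (Fin n)

/-- A convex body: a compact convex set with nonempty interior. -/
def IsConvexBody {n : ℕ} (K : Set (Euc n)) : Prop :=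
  IsCompact K ∧ Convex ℝ K ∧ (interior K).Nonempty

/-- The support function `h_K(u) = sup_{y ∈ K} ⟨u, y⟩`. -/
def suppFn {n : ℕ} (K : Set (Euc n)) (u : Euc n) : ℝ :=
  sSup ((fun y => ⟪u, y⟫) '' K)

/-- `lpComb p lam K L` is the `L_p` combination `lam·K +_p (1−lam)·L`;
for `p = 0` it is the logarithmic combination. -/
def lpComb {n : ℕ} (p lam : ℝ) (K L : Set (Euc n)) : Set (Euc n) :=
  if p = 0 then
    {x | ∀ u : Euc n, ‖u‖ = 1 → ⟪x, u⟫ ≤ suppFn K u ^ lam * suppFn L u ^ (1 - lam)}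
  else
    {x | ∀ u : Euc n, ‖u‖ = 1 →
      ⟪x, u⟫ ≤ (lam * suppFn K u ^ p + (1 - lam) * suppFn L u ^ p) ^ (1 / p)}


/-- The standard Gaussian measure on `ℝⁿ`, with density `(2π)^{-n/2} e^{-|x|²/2}`. -/
def gaussianMeasure (n : ℕ) : Measure (Euc n) :=
  volume.withDensity fun x =>
    ENNReal.ofReal ((2 * Real.pi) ^ (-(n : ℝ) / 2) * Real.exp (-‖x‖ ^ 2 / 2))

open scoped ContDiff

/-- The `i`-th partial derivative. -/
def pd {n : ℕ} (i : Fin n) (f : Euc n → ℝ) (x : Euc n) : ℝ :=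
  fderiv ℝ f x (EuclideanSpace.single i 1)

section PartialDerivatives

variable {n : ℕ} {f g : Euc n → ℝ} {x : Euc n} (i j : Fin n)

lemma pd_add (hf : DifferentiableAt ℝ f x) (hg : DifferentiableAt ℝ g x) :
    pd i (fun y => f y + g y) x = pd i f x + pd i g x := by
  simp [pd, fderiv_fun_add hf hg]

lemma pd_sub (hf : DifferentiableAt ℝ f x) (hg : DifferentiableAt ℝ g x) :
    pd i (fun y => f y - g y) x = pd i f x - pd i g x := by
  simp [pd, fderiv_fun_sub hf hg]

lemma pd_mul (hf : DifferentiableAt ℝ f x) (hg : DifferentiableAt ℝ g x) :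
    pd i (fun y => f y * g y) x = pd i f x * g x + f x * pd i g x := by
  simp [pd, fderiv_fun_mul hf hg]; ring

lemma pd_const (c : ℝ) : pd i (fun _ : Euc n => c) x = 0 := by
  simp [pd]

lemma pd_const_mul (c : ℝ) (hf : DifferentiableAt ℝ f x) :
    pd i (fun y => c * f y) x = c * pd i f x := by
  simp [pd, fderiv_const_mul hf]

lemma pd_sum {ι : Type*} (s : Finset ι) {F : ι → Euc n → ℝ}
    (hF : ∀ k ∈ s, DifferentiableAt ℝ (F k) x) :
    pd i (fun y => ∑ k ∈ s, F k y) x = ∑ k ∈ s, pd i (F k) x := by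
  simp [pd, fderiv_fun_sum hF]

lemma pd_comp {φ : ℝ → ℝ} {φ' : ℝ} (hφ : HasDerivAt φ φ' (f x)) (hf : DifferentiableAt ℝ f x) :
    pd i (fun y => φ (f y)) x = φ' * pd i f x := by
  have := (hφ.comp_hasFDerivAt x hf.hasFDerivAt).fderiv
  simp only [Function.comp_def] at this
  simp [pd, this]

lemma pd_coord : pd i (fun y : Euc n => y j) x = if i = j then 1 else 0 := by
  have : HasFDerivAt (fun y : Euc n => y j) (EuclideanSpace.proj j : Euc n →L[ℝ] ℝ) x :=
    (EuclideanSpace.proj j : Euc n →L[ℝ] ℝ).hasFDerivAt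
  simp [pd, this.fderiv, PiLp.single_apply, eq_comm]

lemma pd_inner (u : Euc n) : pd i (fun y : Euc n => ⟪y, u⟫) x = u i := by
  have : HasFDerivAt (fun y : Euc n => ⟪y, u⟫) (innerSL ℝ u) x := by
    have := (innerSL ℝ u).hasFDerivAt (x := x)
    simpa [real_inner_comm] using this
  simp [pd, this.fderiv, EuclideanSpace.inner_single_right]

lemma contDiff_pd {m k : WithTop ℕ∞} (hf : ContDiff ℝ m f) (hk : k + 1 ≤ m) :
    ContDiff ℝ k (pd i f) :=
  (hf.fderiv_right hk).clm_apply contDiff_const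

lemma contDiff_infty_pd (hf : ContDiff ℝ ∞ f) : ContDiff ℝ ∞ (pd i f) :=
  contDiff_pd i hf (by rfl)

lemma continuous_pd (hf : ContDiff ℝ 1 f) : Continuous (pd i f) :=
  (contDiff_pd (k := 0) i hf (by simp)).continuous

lemma hasCompactSupport_pd (hf : HasCompactSupport f) : HasCompactSupport (pd i f) :=
  (hf.fderiv_apply (𝕜 := ℝ) (EuclideanSpace.single i 1))

lemma pd_comm (hf : ContDiff ℝ ∞ f) : pd i (pd j f) x = pd j (pd i f) x := by
  have h2 : ContDiffAt ℝ 2 f x := (contDiff_infty.1 hf 2).contDiffAt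
  have hs := (h2.isSymmSndFDerivAt (by simp)).eq (EuclideanSpace.single i 1)
    (EuclideanSpace.single j 1)
  have hd : DifferentiableAt ℝ (fderiv ℝ f) x :=
    ((hf.fderiv_right (m := ∞) (by rfl)).differentiable (by simp)) x
  have key : ∀ a b : Fin n, pd a (pd b f) x
      = fderiv ℝ (fderiv ℝ f) x (EuclideanSpace.single a 1) (EuclideanSpace.single b 1) := by
    intro a b
    have : HasFDerivAt (pd b f) _ x :=
      hd.hasFDerivAt.clm_apply (hasFDerivAt_const (EuclideanSpace.single b (1:ℝ)) x)
    rw [pd, this.fderiv]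
    simp
  rw [key, key, hs]

lemma pd_neg_arg (hf : DifferentiableAt ℝ f (-x)) :
    pd i (fun y => f (-y)) x = - pd i f (-x) := by
  have h1 : HasFDerivAt (fun y : Euc n => -y) (-ContinuousLinearMap.id ℝ (Euc n)) x :=
    (hasFDerivAt_id x).neg
  have := (hf.hasFDerivAt.comp x h1).fderiv
  simp only [Function.comp_def] at this
  simp [pd, this]

end PartialDerivatives

section WeightedMeasure

variable {n : ℕ}

/-- The measure with density `exp (-W)`. -/
def wMeasure (W : Euc n → ℝ) : Measure (Euc n) :=
  volume.withDensity fun x => ENNReal.ofReal (Real.exp (-W x))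

variable {W : Euc n → ℝ}

lemma integral_wMeasure (hW : Continuous W) (f : Euc n → ℝ) :
    ∫ x, f x ∂wMeasure W = ∫ x, Real.exp (-W x) * f x := by
  have hm : Measurable fun x => ENNReal.ofReal (Real.exp (-W x)) := by fun_prop
  rw [wMeasure, integral_withDensity_eq_integral_toReal_smul hm (by simp)]
  simp [ENNReal.toReal_ofReal (Real.exp_pos _).le]

lemma integrable_wMeasure (hW : Continuous W) (f : Euc n → ℝ) :
    Integrable f (wMeasure W) ↔ Integrable fun x => Real.exp (-W x) * f x := by
  have hm : Measurable fun x => ENNReal.ofReal (Real.exp (-W x)) := by fun_prop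
  rw [wMeasure, integrable_withDensity_iff_integrable_smul' hm (by simp)]
  simp [ENNReal.toReal_ofReal (Real.exp_pos _).le]

lemma ae_wMeasure (hW : Continuous W) {P : Euc n → Prop} :
    (∀ᵐ x ∂wMeasure W, P x) ↔ ∀ᵐ x, P x := by
  have hm : Measurable fun x => ENNReal.ofReal (Real.exp (-W x)) := by fun_prop
  rw [wMeasure, ae_withDensity_iff hm]
  simp [Real.exp_pos]

lemma integral_divergence (hW : ContDiff ℝ 1 W) {f : Euc n → ℝ} (hf : ContDiff ℝ 1 f) (i : Fin n)
    (h0 : Integrable f (wMeasure W)) (h1 : Integrable (pd i f) (wMeasure W))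
    (h2 : Integrable (fun x => f x * pd i W x) (wMeasure W)) :
    ∫ x, pd i f x ∂wMeasure W = ∫ x, f x * pd i W x ∂wMeasure W := by
  have hc := hW.continuous
  rw [integrable_wMeasure hc] at h0 h1 h2
  have hdW := hW.differentiable one_ne_zero
  have he : ∀ x, fderiv ℝ (fun y => Real.exp (-W y)) x (EuclideanSpace.single i 1)
      = - (Real.exp (-W x) * pd i W x) := by
    intro x
    have h : HasDerivAt (fun s : ℝ => Real.exp (-s)) (-Real.exp (-W x)) (W x) := by
      simpa using (hasDerivAt_neg (W x)).exp
    have := pd_comp i h (hdW x)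
    rw [pd] at this
    rw [this]; ring
  have hde : Differentiable ℝ fun y => Real.exp (-W y) := (hdW.neg).exp
  have key := integral_mul_fderiv_eq_neg_fderiv_mul_of_integrable (μ := volume)
    (f := fun y => Real.exp (-W y)) (g := f) (v := EuclideanSpace.single i 1)
    (by refine h2.neg.congr (Filter.Eventually.of_forall fun x => ?_)
        simp only [he, Pi.neg_apply]; ring)
    h1 h0 (fun x _ => hde x) (fun x _ => hf.differentiable one_ne_zero x)
  rw [integral_wMeasure hc, integral_wMeasure hc]
  simp only [pd] at key ⊢
  rw [key, ← integral_neg]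
  congr 1; ext x
  rw [he]; simp only [pd]; ring

/-- The weighted Laplacian `Δu - ⟨∇W, ∇u⟩`. -/
def wLap (W u : Euc n → ℝ) (x : Euc n) : ℝ :=
  ∑ i, (pd i (pd i u) x - pd i W x * pd i u x)

/-- Smooth compactly supported functions. -/
def IsTest (u : Euc n → ℝ) : Prop := ContDiff ℝ ∞ u ∧ HasCompactSupport u

lemma IsTest.pd {u : Euc n → ℝ} (hu : IsTest u) (i : Fin n) : IsTest (pd i u) :=
  ⟨contDiff_infty_pd i hu.1, hasCompactSupport_pd i hu.2⟩

lemma IsTest.contDiff_one {u : Euc n → ℝ} (hu : IsTest u) : ContDiff ℝ 1 u :=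
  hu.1.of_le (by exact_mod_cast le_top)

lemma IsTest.continuous {u : Euc n → ℝ} (hu : IsTest u) : Continuous u := hu.1.continuous

lemma IsTest.differentiable {u : Euc n → ℝ} (hu : IsTest u) : Differentiable ℝ u :=
  hu.contDiff_one.differentiable one_ne_zero

lemma contDiff_wLap (hW : ContDiff ℝ ∞ W) {u : Euc n → ℝ} (hu : ContDiff ℝ ∞ u) :
    ContDiff ℝ ∞ (wLap W u) :=
  ContDiff.sum fun i _ => (contDiff_infty_pd i (contDiff_infty_pd i hu)).sub
    ((contDiff_infty_pd i hW).mul (contDiff_infty_pd i hu))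

lemma IsTest.mul_left {u φ : Euc n → ℝ} (hu : IsTest u) (hφ : ContDiff ℝ ∞ φ) :
    IsTest (fun x => φ x * u x) := ⟨hφ.mul hu.1, hu.2.mul_left⟩

lemma IsTest.add {u v : Euc n → ℝ} (hu : IsTest u) (hv : IsTest v) :
    IsTest (fun x => u x + v x) := ⟨hu.1.add hv.1, hu.2.add hv.2⟩

lemma IsTest.sub {u v : Euc n → ℝ} (hu : IsTest u) (hv : IsTest v) :
    IsTest (fun x => u x - v x) := ⟨hu.1.sub hv.1, hu.2.sub hv.2⟩

lemma IsTest.sum {ι : Type*} {s : Finset ι} {F : ι → Euc n → ℝ} (hF : ∀ i ∈ s, IsTest (F i)) :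
    IsTest (fun x => ∑ i ∈ s, F i x) := by
  classical
  induction s using Finset.induction_on with
  | empty => exact ⟨by simpa using contDiff_const, by simpa using! HasCompactSupport.zero⟩
  | insert a s ha ih =>
    simp only [Finset.sum_insert ha]
    exact (hF a (by simp)).add (ih fun i hi => hF i (by simp [hi]))

lemma IsTest.wLap (hW : ContDiff ℝ ∞ W) {u : Euc n → ℝ} (hu : IsTest u) : IsTest (wLap W u) :=
  IsTest.sum fun i _ => ((hu.pd i).pd i).sub ((hu.pd i).mul_left (contDiff_infty_pd i hW))

lemma pd_wLap (hW : ContDiff ℝ ∞ W) {u : Euc n → ℝ} (hu : IsTest u) (j : Fin n) (x : Euc n) :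
    pd j (wLap W u) x = wLap W (pd j u) x - ∑ i, pd j (pd i W) x * pd i u x := by
  have hd : ∀ {f : Euc n → ℝ}, ContDiff ℝ ∞ f → DifferentiableAt ℝ f x :=
    fun hf => (hf.differentiable (by simp)) x
  have hWi := fun i => contDiff_infty_pd i hW
  have hui := fun i => contDiff_infty_pd i hu.1
  have huii := fun i => contDiff_infty_pd i (hui i)
  have e : _root_.wLap W u = fun y => ∑ i, (pd i (pd i u) y - pd i W y * pd i u y) := rfl
  rw [e, pd_sum j _ fun i _ => hd ((huii i).sub ((hWi i).mul (hui i))), _root_.wLap,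
    ← Finset.sum_sub_distrib]
  refine Finset.sum_congr rfl fun i _ => ?_
  have e2 : pd j (pd i u) = pd i (pd j u) := funext fun y => pd_comm j i hu.1
  rw [pd_sub j (hd (huii i)) (hd ((hWi i).mul (hui i))), pd_mul j (hd (hWi i)) (hd (hui i)),
    pd_comm j i (hui i), e2]
  ring

variable [IsFiniteMeasure (wMeasure W)]

lemma integrable_of_compact {f : Euc n → ℝ} (hf : Continuous f) (hs : HasCompactSupport f) :
    Integrable f (wMeasure W) := hf.integrable_of_hasCompactSupport hs

/-- Integration by parts for the weighted Laplacian, one coordinate at a time. -/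
lemma integral_mul_pd_compact (hW : ContDiff ℝ ∞ W) {φ v : Euc n → ℝ} (hφ : ContDiff ℝ 1 φ)
    (hv : ContDiff ℝ 1 v) (hs : HasCompactSupport (fun x => φ x * v x)) (i : Fin n) :
    ∫ x, (pd i φ x * v x + φ x * (pd i v x - pd i W x * v x)) ∂wMeasure W = 0 := by
  have hW1 : ContDiff ℝ 1 W := hW.of_le (by exact_mod_cast le_top)
  have hc : ContDiff ℝ 1 (fun x => φ x * v x) := hφ.mul hv
  have h1 : Integrable (pd i (fun x => φ x * v x)) (wMeasure W) :=
    integrable_of_compact (continuous_pd i hc) (hasCompactSupport_pd i hs)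
  have h2 : Integrable (fun x => (φ x * v x) * pd i W x) (wMeasure W) :=
    integrable_of_compact (hc.continuous.mul (continuous_pd i hW1)) hs.mul_right
  have h := integral_divergence hW1 hc i (integrable_of_compact hc.continuous hs) h1 h2
  rw [← sub_eq_zero, ← integral_sub h1 h2] at h
  rw [← h]
  congr 1; ext x
  rw [pd_mul i (hφ.differentiable one_ne_zero x) (hv.differentiable one_ne_zero x)]
  ring

lemma IsTest.integrable {u : Euc n → ℝ} (hu : IsTest u) : Integrable u (wMeasure W) :=
  integrable_of_compact hu.continuous hu.2

lemma IsTest.integrable_mul {u φ : Euc n → ℝ} (hu : IsTest u) (hφ : Continuous φ) :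
    Integrable (fun x => φ x * u x) (wMeasure W) :=
  integrable_of_compact (hφ.mul hu.continuous) hu.2.mul_left

lemma integral_mul_wLap (hW : ContDiff ℝ ∞ W) {φ u : Euc n → ℝ} (hφ : ContDiff ℝ 1 φ)
    (hu : IsTest u) :
    ∫ x, φ x * wLap W u x ∂wMeasure W = - ∫ x, ∑ i, pd i φ x * pd i u x ∂wMeasure W := by
  have h : ∀ i : Fin n, ∫ x, φ x * (pd i (pd i u) x - pd i W x * pd i u x) ∂wMeasure W
      = - ∫ x, pd i φ x * pd i u x ∂wMeasure W := by
    intro i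
    have h0 := integral_mul_pd_compact hW hφ (hu.pd i).contDiff_one (hu.pd i).2.mul_left i
    rw [integral_add ((hu.pd i).integrable_mul (continuous_pd i hφ)) ] at h0
    · linarith
    · exact (((hu.pd i).pd i).sub ((hu.pd i).mul_left (contDiff_infty_pd i hW))).integrable_mul
        hφ.continuous
  simp only [_root_.wLap, Finset.mul_sum]
  rw [integral_finsetSum, integral_finsetSum, ← Finset.sum_neg_distrib]
  · exact Finset.sum_congr rfl fun i _ => h i
  · exact fun i _ => (hu.pd i).integrable_mul (continuous_pd i hφ)
  · exact fun i _ => (((hu.pd i).pd i).sub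
      ((hu.pd i).mul_left (contDiff_infty_pd i hW))).integrable_mul hφ.continuous

/-- Bochner's formula. -/
lemma integral_wLap_sq (hW : ContDiff ℝ ∞ W) {u : Euc n → ℝ} (hu : IsTest u) :
    ∫ x, wLap W u x ^ 2 ∂wMeasure W
      = ∫ x, ∑ j, ∑ i, pd i (pd j u) x ^ 2 ∂wMeasure W
        + ∫ x, ∑ j, ∑ i, pd j (pd i W) x * pd i u x * pd j u x ∂wMeasure W := by
  have hL := hu.wLap hW
  simp only [pow_two]
  rw [integral_mul_wLap hW hL.contDiff_one hu]
  have e1 : ∀ x, ∑ j, pd j (_root_.wLap W u) x * pd j u x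
      = ∑ j, pd j u x * _root_.wLap W (pd j u) x
        - ∑ j, ∑ i, pd j (pd i W) x * pd i u x * pd j u x := by
    intro x
    rw [← Finset.sum_sub_distrib]
    refine Finset.sum_congr rfl fun j _ => ?_
    rw [pd_wLap hW hu, sub_mul, Finset.sum_mul]; ring
  have i1 : ∀ j : Fin n,
      Integrable (fun x => pd j u x * _root_.wLap W (pd j u) x) (wMeasure W) :=
    fun j => ((hu.pd j).wLap hW).integrable_mul (hu.pd j).continuous
  have i2 : ∀ j : Fin n, IsTest fun x => ∑ i, pd j (pd i W) x * pd i u x * pd j u x := by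
    intro j
    refine IsTest.sum fun i _ => (hu.pd j).mul_left ?_
    exact (contDiff_infty_pd j (contDiff_infty_pd i hW)).mul (hu.pd i).1
  simp only [e1]
  rw [integral_sub (integrable_finsetSum _ fun j _ => i1 j) (IsTest.sum fun j _ => i2 j).integrable,
    integral_finsetSum _ fun j _ => i1 j]
  have e3 : ∀ j : Fin n, ∫ x, pd j u x * _root_.wLap W (pd j u) x ∂wMeasure W
      = - ∫ x, ∑ i, pd i (pd j u) x * pd i (pd j u) x ∂wMeasure W :=
    fun j => integral_mul_wLap hW (hu.pd j).contDiff_one (hu.pd j)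
  simp only [e3]
  rw [integral_finsetSum (μ := wMeasure W) (f := fun j x => ∑ i, pd i (pd j u) x * pd i (pd j u) x)]
  · rw [Finset.sum_neg_distrib]; ring
  · intro j _
    exact (IsTest.sum fun i _ => ((hu.pd j).pd i).mul_left ((hu.pd j).pd i).1).integrable

end WeightedMeasure

section Mollification

open Filter Topology Convolution

variable {n : ℕ}

lemma sq_integral_mul_le {α : Type*} [MeasurableSpace α] {μ : Measure α} {f g : α → ℝ}
    (hf : MemLp f 2 μ) (hg : MemLp g 2 μ) :
    (∫ x, f x * g x ∂μ) ^ 2 ≤ (∫ x, f x ^ 2 ∂μ) * ∫ x, g x ^ 2 ∂μ := by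
  have hfg : Integrable (fun x => f x * g x) μ := hf.integrable_mul hg
  have hf2 := hf.integrable_sq
  have hg2 := hg.integrable_sq
  have key : ∀ t : ℝ, 0 ≤ (∫ x, g x ^ 2 ∂μ) * (t * t) + (2 * ∫ x, f x * g x ∂μ) * t
      + ∫ x, f x ^ 2 ∂μ := by
    intro t
    have : (∫ x, g x ^ 2 ∂μ) * (t * t) + (2 * ∫ x, f x * g x ∂μ) * t + ∫ x, f x ^ 2 ∂μ
        = ∫ x, (g x ^ 2 * (t * t) + f x * g x * (2 * t) + f x ^ 2) ∂μ := by
      rw [integral_add ((hg2.mul_const _).fun_add (hfg.mul_const _)) hf2,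
        integral_add (hg2.mul_const _) (hfg.mul_const _), integral_mul_const, integral_mul_const]
      ring
    rw [this]
    refine integral_nonneg fun x => ?_
    have : g x ^ 2 * (t * t) + f x * g x * (2 * t) + f x ^ 2 = (f x + t * g x) ^ 2 := by ring
    simp only [this]
    positivity
  have := discrim_le_zero key
  rw [discrim] at this
  nlinarith

/-- Convolution of `f` with the kernel `ρ`. -/
def mol (ρ f : Euc n → ℝ) (x : Euc n) : ℝ := ∫ t, ρ (x - t) * f t

lemma mol_eq_convolution (ρ f : Euc n → ℝ) :
    mol ρ f = f ⋆[ContinuousLinearMap.mul ℝ ℝ, volume] ρ := by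
  ext x
  rw [convolution_def, mol]
  congr 1; ext t
  simp [mul_comm]

variable {ρ f : Euc n → ℝ}

lemma integrable_mol_integrand (hρ : Continuous ρ) (hρs : HasCompactSupport ρ)
    (hf : LocallyIntegrable f) (x : Euc n) : Integrable fun t => ρ (x - t) * f t := by
  have := hρs.convolutionExists_right (ContinuousLinearMap.mul ℝ ℝ) hf hρ x
  simpa [ConvolutionExistsAt, mul_comm] using this

lemma contDiff_mol (hρ : IsTest ρ) (hf : LocallyIntegrable f) : ContDiff ℝ ∞ (mol ρ f) := by
  rw [mol_eq_convolution]
  exact hρ.2.contDiff_convolution_right _ hf hρ.1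

lemma pd_mol (hρ : IsTest ρ) (hf : LocallyIntegrable f) (i : Fin n) :
    pd i (mol ρ f) = mol (pd i ρ) f := by
  ext x
  have := hρ.2.hasFDerivAt_convolution_right (ContinuousLinearMap.mul ℝ ℝ) (μ := volume) hf
    hρ.contDiff_one x
  rw [pd, mol_eq_convolution, this.fderiv, convolution_precompR_apply _ hf (hρ.2.fderiv ℝ)
    (hρ.contDiff_one.continuous_fderiv one_ne_zero), mol_eq_convolution]
  rfl

lemma mol_sq_le (hρ : Continuous ρ) (hρs : HasCompactSupport ρ) (h0 : ∀ x, 0 ≤ ρ x)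
    (h1 : ∫ x, ρ x = 1) (hf : MemLp f 2 volume) (x : Euc n) :
    mol ρ f x ^ 2 ≤ mol ρ (fun t => f t ^ 2) x := by
  have hfl : LocallyIntegrable f := hf.locallyIntegrable (by norm_num)
  have hf2 : LocallyIntegrable fun t => f t ^ 2 := hf.integrable_sq.locallyIntegrable
  set c := mol ρ f x with hc
  have i1 := integrable_mol_integrand hρ hρs hfl x
  have i2 := integrable_mol_integrand hρ hρs hf2 x
  have i0 : Integrable fun t => ρ (x - t) :=
    (hρ.integrable_of_hasCompactSupport hρs).comp_sub_left x
  have e0 : ∫ t, ρ (x - t) = 1 := by rw [integral_sub_left_eq_self ρ volume x, h1]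
  have key : ∫ t, (ρ (x - t) * f t ^ 2 - (2 * c) * (ρ (x - t) * f t) + c ^ 2 * ρ (x - t))
      = mol ρ (fun t => f t ^ 2) x - c ^ 2 := by
    rw [integral_add (f := fun t => ρ (x - t) * f t ^ 2 - (2 * c) * (ρ (x - t) * f t))
      (i2.sub (i1.const_mul _)) (i0.const_mul _), integral_sub i2 (i1.const_mul _),
      integral_const_mul, integral_const_mul, e0]
    simp only [mol] at hc ⊢
    rw [← hc]; ring
  have pos : 0 ≤ ∫ t, (ρ (x - t) * f t ^ 2 - (2 * c) * (ρ (x - t) * f t) + c ^ 2 * ρ (x - t)) := by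
    refine integral_nonneg fun t => ?_
    have : ρ (x - t) * f t ^ 2 - (2 * c) * (ρ (x - t) * f t) + c ^ 2 * ρ (x - t)
        = ρ (x - t) * (f t - c) ^ 2 := by ring
    simp only [this]
    exact mul_nonneg (h0 _) (sq_nonneg _)
  linarith

lemma integral_mol_sq_le (hρ : Continuous ρ) (hρs : HasCompactSupport ρ) (h0 : ∀ x, 0 ≤ ρ x)
    (h1 : ∫ x, ρ x = 1) (hf : MemLp f 2 volume) :
    MemLp (mol ρ f) 2 volume ∧ ∫ x, mol ρ f x ^ 2 ≤ ∫ x, f x ^ 2 := by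
  have hfl : LocallyIntegrable f := hf.locallyIntegrable (by norm_num)
  have hρi := hρ.integrable_of_hasCompactSupport (μ := volume) hρs
  have i2 : Integrable (mol ρ (fun t => f t ^ 2)) := by
    rw [mol_eq_convolution]
    exact hf.integrable_sq.integrable_convolution _ hρi
  have hcont : Continuous (mol ρ f) := by
    rw [mol_eq_convolution]
    exact hρs.continuous_convolution_right _ hfl hρ
  have i1 : Integrable fun x => mol ρ f x ^ 2 := by
    refine i2.mono' (hcont.pow 2).aestronglyMeasurable (Eventually.of_forall fun x => ?_)
    rw [Real.norm_of_nonneg (sq_nonneg _)]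
    exact mol_sq_le hρ hρs h0 h1 hf x
  refine ⟨(memLp_two_iff_integrable_sq hcont.aestronglyMeasurable).2 i1, ?_⟩
  calc ∫ x, mol ρ f x ^ 2 ≤ ∫ x, mol ρ (fun t => f t ^ 2) x :=
        integral_mono i1 i2 fun x => mol_sq_le hρ hρs h0 h1 hf x
    _ = ∫ x, f x ^ 2 := by
        rw [mol_eq_convolution, integral_convolution (ContinuousLinearMap.mul ℝ ℝ)
          hf.integrable_sq hρi, h1]
        simp

/-- An approximate identity of smooth bumps. -/
def molBump (n : ℕ) (k : ℕ) : ContDiffBump (0 : Euc n) where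
  rIn := 1 / (2 * (k + 1))
  rOut := 1 / (k + 1)
  rIn_pos := by positivity
  rIn_lt_rOut := by
    apply one_div_lt_one_div_of_lt <;> [positivity; nlinarith [Nat.cast_nonneg (α := ℝ) k]]

/-- The kernel of the approximate identity. -/
def molKer (n : ℕ) (k : ℕ) : Euc n → ℝ := (molBump n k).normed volume

lemma isTest_molKer (k : ℕ) : IsTest (molKer n k) :=
  ⟨(molBump n k).contDiff_normed, (molBump n k).hasCompactSupport_normed⟩

lemma molKer_nonneg (k : ℕ) (x : Euc n) : 0 ≤ molKer n k x := (molBump n k).nonneg_normed x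

lemma integral_molKer (k : ℕ) : ∫ x, molKer n k x = 1 := (molBump n k).integral_normed

lemma molKer_eq_zero (k : ℕ) {x : Euc n} (hx : 1 < ‖x‖) : molKer n k x = 0 := by
  by_contra h
  have h2 : x ∈ tsupport (molKer n k) := subset_tsupport _ h
  rw [molKer, (molBump n k).tsupport_normed_eq, mem_closedBall_zero_iff] at h2
  have : (molBump n k).rOut ≤ 1 := by
    change 1 / ((k : ℝ) + 1) ≤ 1
    rw [div_le_one (by positivity)]; linarith [Nat.cast_nonneg (α := ℝ) k]
  linarith

lemma ae_tendsto_mol (hf : LocallyIntegrable f) :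
    ∀ᵐ x, Tendsto (fun k => mol (molKer n k) f x) atTop (𝓝 (f x)) := by
  have h := ContDiffBump.ae_convolution_tendsto_right_of_locallyIntegrable (μ := volume)
    (φ := molBump n) (l := atTop) (K := 2) (g := f) tendsto_one_div_add_atTop_nhds_zero_nat
    (Eventually.of_forall fun k => by
      change 1 / ((k : ℝ) + 1) ≤ 2 * (1 / (2 * (k + 1)))
      apply le_of_eq; field_simp) hf
  filter_upwards [h] with x hx
  refine hx.congr fun k => ?_
  rw [convolution_lsmul_swap]
  rfl

/-- Mollifications of a square integrable function converge in mean square. -/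
lemma tendsto_integral_mol_sub_sq (hf : MemLp f 2 volume) :
    Tendsto (fun k => ∫ x, (mol (molKer n k) f x - f x) ^ 2) atTop (𝓝 0) := by
  have hm := fun k => integral_mol_sq_le (isTest_molKer (n := n) k).continuous
    (isTest_molKer k).2 (molKer_nonneg k) (integral_molKer k) hf
  set A := ∫ x, f x ^ 2 with hA
  have i1 : ∀ k, Integrable fun x => (mol (molKer n k) f x + f x) ^ 2 :=
    fun k => ((hm k).1.add hf).integrable_sq
  have i2 : ∀ k, Integrable fun x => (mol (molKer n k) f x - f x) ^ 2 :=
    fun k => ((hm k).1.sub hf).integrable_sq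
  have par : ∀ k, (∫ x, (mol (molKer n k) f x + f x) ^ 2)
      + ∫ x, (mol (molKer n k) f x - f x) ^ 2 ≤ 4 * A := by
    intro k
    rw [← integral_add (i1 k) (i2 k)]
    calc ∫ x, ((mol (molKer n k) f x + f x) ^ 2 + (mol (molKer n k) f x - f x) ^ 2)
        = ∫ x, (2 * mol (molKer n k) f x ^ 2 + 2 * f x ^ 2) := by
          congr 1; ext x; ring
      _ = 2 * (∫ x, mol (molKer n k) f x ^ 2) + 2 * A := by
          rw [integral_add ((hm k).1.integrable_sq.const_mul 2) (hf.integrable_sq.const_mul 2),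
            integral_const_mul, integral_const_mul]
      _ ≤ 4 * A := by linarith [(hm k).2]
  have fatou : ENNReal.ofReal (4 * A)
      ≤ liminf (fun k => ENNReal.ofReal (∫ x, (mol (molKer n k) f x + f x) ^ 2)) atTop := by
    calc ENNReal.ofReal (4 * A)
        = ∫⁻ x, liminf (fun k => ENNReal.ofReal ((mol (molKer n k) f x + f x) ^ 2)) atTop := by
          rw [hA, ← integral_const_mul, ofReal_integral_eq_lintegral_ofReal
            (hf.integrable_sq.const_mul 4) (Eventually.of_forall fun x => by positivity)]
          refine lintegral_congr_ae ?_
          filter_upwards [ae_tendsto_mol (hf.locallyIntegrable (by norm_num))] with x hx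
          have := ENNReal.tendsto_ofReal ((hx.add_const (f x)).pow 2)
          rw [this.liminf_eq]
          congr 1; ring
      _ ≤ liminf (fun k => ∫⁻ x, ENNReal.ofReal ((mol (molKer n k) f x + f x) ^ 2)) atTop :=
          lintegral_liminf_le' fun k =>
            ((i1 k).aestronglyMeasurable.aemeasurable).ennreal_ofReal
      _ = _ := by
          congr 1; ext k
          rw [ofReal_integral_eq_lintegral_ofReal (i1 k)
            (Eventually.of_forall fun x => by positivity)]
  rw [Metric.tendsto_atTop]
  intro ε hε
  have hlt : ∀ᶠ k in atTop, 4 * A - ε < ∫ x, (mol (molKer n k) f x + f x) ^ 2 := by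
    by_cases h4 : 4 * A - ε < 0
    · exact Eventually.of_forall fun k => h4.trans_le (integral_nonneg fun x => by positivity)
    · push Not at h4
      have : ENNReal.ofReal (4 * A - ε) < ENNReal.ofReal (4 * A) :=
        (ENNReal.ofReal_lt_ofReal_iff (by linarith)).2 (by linarith)
      filter_upwards [eventually_lt_of_lt_liminf (this.trans_le fatou)] with k hk
      exact (ENNReal.ofReal_lt_ofReal_iff_of_nonneg h4).1 hk
  obtain ⟨N, hN⟩ := eventually_atTop.1 hlt
  refine ⟨N, fun k hk => ?_⟩
  rw [Real.dist_eq, sub_zero, abs_of_nonneg (integral_nonneg fun x => by positivity)]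
  linarith [par k, hN k hk]

end Mollification

section WeakSolutions

open Filter Topology

variable {n : ℕ} {W : Euc n → ℝ}

/-- The Laplacian. -/
def lapl (h : Euc n → ℝ) (x : Euc n) : ℝ := ∑ i, pd i (pd i h) x

/-- The potential of the Schrödinger operator conjugate to the weighted Laplacian. -/
def wPot (W : Euc n → ℝ) (x : Euc n) : ℝ :=
  ∑ i, (pd i W x ^ 2 / 4 - pd i (pd i W) x / 2)

lemma contDiff_wPot (hW : ContDiff ℝ ∞ W) : ContDiff ℝ ∞ (wPot W) :=
  ContDiff.sum fun i _ => (((contDiff_infty_pd i hW).pow 2).div_const 4).sub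
    ((contDiff_infty_pd i (contDiff_infty_pd i hW)).div_const 2)

lemma contDiff_lapl {h : Euc n → ℝ} (hh : ContDiff ℝ ∞ h) : ContDiff ℝ ∞ (lapl h) :=
  ContDiff.sum fun i _ => contDiff_infty_pd i (contDiff_infty_pd i hh)

lemma IsTest.lapl {h : Euc n → ℝ} (hh : IsTest h) : IsTest (lapl h) :=
  IsTest.sum fun i _ => (hh.pd i).pd i

lemma contDiff_exp_half (hW : ContDiff ℝ ∞ W) : ContDiff ℝ ∞ fun x => Real.exp (W x / 2) :=
  (hW.div_const 2).exp

lemma pd_exp_half_mul (hW : ContDiff ℝ ∞ W) {h : Euc n → ℝ} (hh : ContDiff ℝ ∞ h) (i : Fin n)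
    (x : Euc n) : pd i (fun y => Real.exp (W y / 2) * h y) x
      = Real.exp (W x / 2) * (pd i h x + pd i W x * h x / 2) := by
  have hd : ∀ {f : Euc n → ℝ}, ContDiff ℝ ∞ f → DifferentiableAt ℝ f x :=
    fun hf => (hf.differentiable (by simp)) x
  have he : HasDerivAt (fun s : ℝ => Real.exp (s / 2)) (Real.exp (W x / 2) * (1 / 2)) (W x) :=
    ((hasDerivAt_id (W x)).div_const 2).exp
  rw [pd_mul i (hd (contDiff_exp_half hW)) (hd hh), pd_comp i he (hd hW)]
  ring

lemma wLap_exp_half_mul (hW : ContDiff ℝ ∞ W) {h : Euc n → ℝ} (hh : ContDiff ℝ ∞ h)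
    (x : Euc n) : wLap W (fun y => Real.exp (W y / 2) * h y) x
      = Real.exp (W x / 2) * (lapl h x - wPot W x * h x) := by
  have hd : ∀ {f : Euc n → ℝ}, ContDiff ℝ ∞ f → DifferentiableAt ℝ f x :=
    fun hf => (hf.differentiable (by simp)) x
  rw [lapl, wPot, Finset.sum_mul, ← Finset.sum_sub_distrib, Finset.mul_sum, wLap]
  refine Finset.sum_congr rfl fun i _ => ?_
  have e1 : pd i (fun y => Real.exp (W y / 2) * h y)
      = fun y => Real.exp (W y / 2) * (pd i h y + pd i W y * h y * (1 / 2)) := by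
    ext y; rw [pd_exp_half_mul hW hh]; ring
  have hWi := contDiff_infty_pd i hW
  have hhi := contDiff_infty_pd i hh
  rw [e1, pd_exp_half_mul hW (hhi.add ((hWi.mul hh).mul contDiff_const)), pd_add i (hd hhi)
    (hd ((hWi.mul hh).mul contDiff_const)), pd_mul i (hd (hWi.mul hh)) (hd contDiff_const),
    pd_mul i (hd hWi) (hd hh), pd_const]
  ring

lemma pd_sub_arg {f : Euc n → ℝ} (hf : Differentiable ℝ f) (i : Fin n) (x : Euc n) :
    pd i (fun t => f (x - t)) = fun t => - pd i f (x - t) := by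
  ext t
  have h1 : HasFDerivAt (fun y : Euc n => x - y) (-ContinuousLinearMap.id ℝ (Euc n)) t :=
    (hasFDerivAt_id t).const_sub x
  have := ((hf (x - t)).hasFDerivAt.comp t h1).fderiv
  simp only [Function.comp_def] at this
  simp [pd, this]

lemma IsTest.sub_arg {f : Euc n → ℝ} (hf : IsTest f) (x : Euc n) : IsTest fun t => f (x - t) :=
  ⟨hf.1.comp (contDiff_const.sub contDiff_id), hf.2.comp_homeomorph (Homeomorph.subLeft x)⟩

lemma lapl_sub_arg {f : Euc n → ℝ} (hf : IsTest f) (x t : Euc n) :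
    lapl (fun t => f (x - t)) t = lapl f (x - t) := by
  refine Finset.sum_congr rfl fun i _ => ?_
  rw [pd_sub_arg hf.differentiable]
  have : (fun t => - pd i f (x - t)) = fun t => (-1) * pd i f (x - t) := by ext; ring
  rw [this, pd_const_mul _ _ (((hf.pd i).sub_arg x).differentiable t),
    pd_sub_arg (hf.pd i).differentiable]
  ring

lemma LocallyIntegrable.cont_mul {V f : Euc n → ℝ} (hV : Continuous V)
    (hf : LocallyIntegrable f) : LocallyIntegrable fun x => V x * f x := by
  rw [locallyIntegrable_iff] at hf ⊢
  exact fun k hk => (hf k hk).continuousOn_mul hV.continuousOn hk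

lemma IsTest.integrable_mul_locallyIntegrable {u f : Euc n → ℝ} (hu : IsTest u)
    (hf : LocallyIntegrable f) : Integrable fun x => f x * u x := by
  simpa [mul_comm] using hf.integrable_smul_left_of_hasCompactSupport hu.continuous hu.2

/-- If `f` is a weak solution of `Δf = V f`, its mollifications satisfy the mollified equation. -/
lemma lapl_mol {f V ρ : Euc n → ℝ} (hf : LocallyIntegrable f) (hV : Continuous V)
    (hρ : IsTest ρ)
    (hweak : ∀ h, IsTest h → ∫ x, f x * (lapl h x - V x * h x) = 0) (x : Euc n) :
    lapl (mol ρ f) x = mol ρ (fun t => V t * f t) x := by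
  have h1 : lapl (mol ρ f) x = mol (lapl ρ) f x := by
    have : ∀ i, pd i (pd i (mol ρ f)) x = ∫ t, pd i (pd i ρ) (x - t) * f t := by
      intro i
      rw [pd_mol hρ hf, pd_mol (hρ.pd i) hf, mol]
    rw [lapl, mol, Finset.sum_congr rfl fun i _ => this i, ← integral_finsetSum]
    · simp only [lapl, Finset.sum_mul]
    · exact fun i _ => integrable_mol_integrand ((hρ.pd i).pd i).continuous ((hρ.pd i).pd i).2 hf x
  have h2 := hweak _ (hρ.sub_arg x)
  simp only [lapl_sub_arg hρ] at h2
  have i1 := integrable_mol_integrand hρ.lapl.continuous hρ.lapl.2 hf x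
  have i2 := integrable_mol_integrand hρ.continuous hρ.2 (LocallyIntegrable.cont_mul hV hf) x
  rw [h1, mol, mol, ← sub_eq_zero, ← integral_sub i1 i2, ← h2]
  congr 1; ext t; ring

lemma IsTest.exists_bound {u : Euc n → ℝ} (hu : IsTest u) : ∃ C, 0 ≤ C ∧ ∀ x, |u x| ≤ C := by
  obtain ⟨C, hC⟩ := hu.2.exists_bound_of_continuous hu.continuous
  exact ⟨C, (norm_nonneg _).trans (hC 0), hC⟩

lemma IsTest.memLp {u : Euc n → ℝ} (hu : IsTest u) : MemLp u 2 volume :=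
  hu.continuous.memLp_of_hasCompactSupport hu.2

lemma IsTest.memLp_mul {u f : Euc n → ℝ} (hu : IsTest u) (hf : MemLp f 2 volume) :
    MemLp (fun x => u x * f x) 2 volume := by
  obtain ⟨C, -, hC⟩ := hu.exists_bound
  refine hf.of_le_mul (c := C) (hu.continuous.aestronglyMeasurable.mul hf.1)
    (Eventually.of_forall fun x => ?_)
  rw [norm_mul]
  exact mul_le_mul_of_nonneg_right (hC x) (norm_nonneg _)

/-- A Caccioppoli inequality. -/
lemma caccioppoli [IsFiniteMeasure (wMeasure W)] (hW : ContDiff ℝ ∞ W) {F ζ : Euc n → ℝ}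
    (hF : ContDiff ℝ ∞ F) (hζ : IsTest ζ) :
    ∫ x, ζ x ^ 2 * ∑ i, pd i (fun y => Real.exp (W y / 2) * F y) x ^ 2 ∂wMeasure W
      ≤ 4 * (∫ x, (∑ i, pd i ζ x ^ 2) * F x ^ 2)
        + 2 * ∫ x, |F x| * |ζ x ^ 2 * (lapl F x - wPot W x * F x)| := by
  set ψ : Euc n → ℝ := fun y => Real.exp (W y / 2) * F y with hψdef
  have hψ : ContDiff ℝ ∞ ψ := (contDiff_exp_half hW).mul hF
  have hψ1 : ContDiff ℝ 1 ψ := contDiff_infty.1 hψ 1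
  have hζψ : ContDiff ℝ ∞ fun x => ζ x ^ 2 * ψ x := (hζ.1.pow 2).mul hψ
  have hζ2 : IsTest fun x => ζ x ^ 2 := by
    simpa only [pow_two] using hζ.mul_left hζ.1
  have hζψt : IsTest fun x => ζ x ^ 2 * ψ x := by
    simpa only [mul_comm] using hζ2.mul_left hψ
  have hd := fun x => hψ1.differentiable one_ne_zero x
  have hL := contDiff_wLap hW hψ
  have hpψ := fun i => contDiff_infty_pd i hψ
  have hWc := hW.continuous
  have h0 : ∀ i : Fin n, IsTest fun x => pd i (fun y => ζ y ^ 2 * ψ y) x * pd i ψ x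
      + ζ x ^ 2 * ψ x * (pd i (pd i ψ) x - pd i W x * pd i ψ x) := by
    intro i
    refine IsTest.add ?_ ?_
    · simpa only [mul_comm] using (hζψt.pd i).mul_left (hpψ i)
    · simpa only [mul_comm] using hζψt.mul_left ((contDiff_infty_pd i (hpψ i)).sub
        ((contDiff_infty_pd i hW).mul (hpψ i)))
  have h1 : ∫ x, ∑ i, (pd i (fun y => ζ y ^ 2 * ψ y) x * pd i ψ x
      + ζ x ^ 2 * ψ x * (pd i (pd i ψ) x - pd i W x * pd i ψ x)) ∂wMeasure W = 0 := by
    rw [integral_finsetSum _ fun i _ => (h0 i).integrable]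
    refine Finset.sum_eq_zero fun i _ => ?_
    exact integral_mul_pd_compact hW (contDiff_infty.1 hζψ 1) (contDiff_infty.1 (hpψ i) 1)
      (by simpa only [mul_comm] using (hζψt.mul_left (hpψ i)).2) i
  have i1 : Integrable (fun x => ∑ i, (pd i (fun y => ζ y ^ 2 * ψ y) x * pd i ψ x
      + ζ x ^ 2 * ψ x * (pd i (pd i ψ) x - pd i W x * pd i ψ x))) (wMeasure W) :=
    integrable_finsetSum _ fun i _ => (h0 i).integrable
  have i2 : Integrable (fun x => ζ x ^ 2 * ∑ i, pd i ψ x ^ 2) (wMeasure W) := by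
    have : IsTest fun x => (∑ i, pd i ψ x ^ 2) * ζ x ^ 2 :=
      hζ2.mul_left (ContDiff.sum fun i _ => (hpψ i).pow 2)
    simpa only [mul_comm] using this.integrable
  have hcq : Continuous fun x => ζ x ^ 2 * (lapl F x - wPot W x * F x) :=
    (hζ.continuous.pow 2).mul ((contDiff_lapl hF).continuous.sub
      ((contDiff_wPot hW).continuous.mul hF.continuous))
  have i3 : Integrable fun x => |F x| * |ζ x ^ 2 * (lapl F x - wPot W x * F x)| := by
    refine (hF.continuous.abs.mul hcq.abs).integrable_of_hasCompactSupport ?_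
    refine hζ.2.mono fun x hx hz => hx ?_
    simp [hz]
  have i4 : Integrable fun x => (∑ i, pd i ζ x ^ 2) * F x ^ 2 := by
    have : IsTest fun x => F x ^ 2 * ∑ i, pd i ζ x ^ 2 := by
      refine IsTest.mul_left (IsTest.sum fun i _ => ?_) (hF.pow 2)
      simpa only [pow_two] using (hζ.pd i).mul_left (hζ.pd i).1
    have := this.continuous.integrable_of_hasCompactSupport (μ := volume) this.2
    simpa only [mul_comm] using this
  rw [integrable_wMeasure hWc] at i1 i2
  rw [integral_wMeasure hWc] at h1 ⊢
  have hpt : ∀ x, Real.exp (-W x) * (ζ x ^ 2 * ∑ i, pd i ψ x ^ 2)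
      ≤ 2 * (Real.exp (-W x) * ∑ i, (pd i (fun y => ζ y ^ 2 * ψ y) x * pd i ψ x
        + ζ x ^ 2 * ψ x * (pd i (pd i ψ) x - pd i W x * pd i ψ x)))
        + (4 * ((∑ i, pd i ζ x ^ 2) * F x ^ 2)
          + 2 * (|F x| * |ζ x ^ 2 * (lapl F x - wPot W x * F x)|)) := by
    intro x
    have e1 : Real.exp (-W x) * ψ x ^ 2 = F x ^ 2 := by
      have : Real.exp (-W x) * Real.exp (W x / 2) ^ 2 = 1 := by
        rw [← Real.exp_nat_mul, ← Real.exp_add]; norm_num; ring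
      simp only [hψdef]; linear_combination F x ^ 2 * this
    have e2 : Real.exp (-W x) * (ψ x * wLap W ψ x) = F x * (lapl F x - wPot W x * F x) := by
      have : Real.exp (-W x) * Real.exp (W x / 2) ^ 2 = 1 := by
        rw [← Real.exp_nat_mul, ← Real.exp_add]; norm_num; ring
      rw [hψdef, wLap_exp_half_mul hW hF]
      linear_combination F x * (lapl F x - wPot W x * F x) * this
    have e3 : ∑ i, (pd i (fun y => ζ y ^ 2 * ψ y) x * pd i ψ x
        + ζ x ^ 2 * ψ x * (pd i (pd i ψ) x - pd i W x * pd i ψ x))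
        = ∑ i, (ζ x ^ 2 * pd i ψ x ^ 2 + 2 * ζ x * ψ x * pd i ζ x * pd i ψ x)
          + ζ x ^ 2 * (ψ x * wLap W ψ x) := by
      rw [wLap, Finset.mul_sum, Finset.mul_sum, ← Finset.sum_add_distrib]
      refine Finset.sum_congr rfl fun i _ => ?_
      have hz := hζ.differentiable x
      have e4 : pd i (fun y => ζ y ^ 2) x = 2 * ζ x * pd i ζ x := by
        simp only [pow_two]; rw [pd_mul i hz hz]; ring
      rw [pd_mul i (hζ2.differentiable x) (hd x), e4]
      ring
    have e5 : ζ x ^ 2 * ∑ i, pd i ψ x ^ 2 ≤ 2 * ∑ i, (ζ x ^ 2 * pd i ψ x ^ 2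
        + 2 * ζ x * ψ x * pd i ζ x * pd i ψ x) + 4 * ((∑ i, pd i ζ x ^ 2) * ψ x ^ 2) := by
      rw [Finset.mul_sum, Finset.mul_sum, Finset.sum_mul, Finset.mul_sum, ← Finset.sum_add_distrib]
      refine Finset.sum_le_sum fun i _ => ?_
      nlinarith [sq_nonneg (ζ x * pd i ψ x + 2 * ψ x * pd i ζ x)]
    have e6 : -(|F x| * |ζ x ^ 2 * (lapl F x - wPot W x * F x)|)
        ≤ ζ x ^ 2 * (F x * (lapl F x - wPot W x * F x)) := by
      rw [← abs_mul]
      refine (neg_abs_le _).trans (le_of_eq (by ring))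
    have hexp := (Real.exp_pos (-W x)).le
    have e7 := mul_le_mul_of_nonneg_left e5 hexp
    rw [e3]
    calc _ ≤ _ := e7
      _ = 2 * (Real.exp (-W x) * ∑ i, (ζ x ^ 2 * pd i ψ x ^ 2
          + 2 * ζ x * ψ x * pd i ζ x * pd i ψ x)) + 4 * ((∑ i, pd i ζ x ^ 2) * F x ^ 2) := by
          rw [← e1]; ring
      _ ≤ _ := by
          have e8 : Real.exp (-W x) * (ζ x ^ 2 * (ψ x * wLap W ψ x))
              = ζ x ^ 2 * (F x * (lapl F x - wPot W x * F x)) := by rw [← e2]; ring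
          rw [mul_add (Real.exp (-W x)), e8]
          linarith
  calc _ ≤ _ := integral_mono i2 ((i1.const_mul 2).fun_add ((i4.const_mul 4).fun_add (i3.const_mul 2))) hpt
    _ = _ := by
      rw [integral_add (i1.const_mul 2) ((i4.const_mul 4).fun_add (i3.const_mul 2)),
        integral_add (i4.const_mul 4) (i3.const_mul 2), integral_const_mul, integral_const_mul,
        integral_const_mul, h1]
      ring

end WeakSolutions

section Density

open Filter Topology

variable {n : ℕ} {W : Euc n → ℝ}

/-- A smooth cutoff equal to one on the unit ball. -/
def unitCutoff (n : ℕ) : ContDiffBump (0 : Euc n) where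
  rIn := 1
  rOut := 2
  rIn_pos := one_pos
  rIn_lt_rOut := one_lt_two

/-- The rescaled cutoff, equal to one on the ball of radius `R`. -/
def cutoff (n : ℕ) (R : ℝ) (x : Euc n) : ℝ := unitCutoff n (R⁻¹ • x)

lemma isTest_unitCutoff : IsTest (unitCutoff n : Euc n → ℝ) :=
  ⟨(unitCutoff n).contDiff, (unitCutoff n).hasCompactSupport⟩

lemma isTest_cutoff {R : ℝ} (hR : 0 < R) : IsTest (cutoff n R) :=
  ⟨isTest_unitCutoff.1.comp (contDiff_const_smul R⁻¹),
    isTest_unitCutoff.2.comp_homeomorph (Homeomorph.smulOfNeZero R⁻¹ (inv_ne_zero hR.ne'))⟩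

lemma cutoff_eq_one {R : ℝ} (hR : 0 < R) {x : Euc n} (hx : ‖x‖ ≤ R) : cutoff n R x = 1 := by
  apply (unitCutoff n).one_of_mem_closedBall
  rw [mem_closedBall_zero_iff, norm_smul, norm_inv, Real.norm_of_nonneg hR.le]
  change R⁻¹ * ‖x‖ ≤ 1
  rw [inv_mul_le_iff₀ hR]; linarith

lemma pd_cutoff (R : ℝ) (i : Fin n) (x : Euc n) :
    pd i (cutoff n R) x = R⁻¹ * pd i (unitCutoff n) (R⁻¹ • x) := by
  have h1 : HasFDerivAt (fun y : Euc n => R⁻¹ • y) (R⁻¹ • ContinuousLinearMap.id ℝ (Euc n)) x :=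
    (hasFDerivAt_id x).const_smul R⁻¹
  have := ((isTest_unitCutoff.differentiable (R⁻¹ • x)).hasFDerivAt.comp x h1).fderiv
  have e : cutoff n R = (unitCutoff n : Euc n → ℝ) ∘ fun y => R⁻¹ • y := rfl
  simp [pd, e, this]

lemma exists_cutoff_grad_bound (n : ℕ) :
    ∃ M, 0 ≤ M ∧ ∀ R (x : Euc n), ∑ i, pd i (cutoff n R) x ^ 2 ≤ M / R ^ 2 := by
  have h : IsTest fun x : Euc n => ∑ i, pd i (unitCutoff n) x ^ 2 := by
    refine IsTest.sum fun i _ => ?_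
    simpa only [pow_two] using (isTest_unitCutoff.pd i).mul_left (isTest_unitCutoff.pd i).1
  obtain ⟨M, hM0, hM⟩ := h.exists_bound
  refine ⟨M, hM0, fun R x => ?_⟩
  have e : ∑ i, pd i (cutoff n R) x ^ 2
      = (∑ i, pd i (unitCutoff n) (R⁻¹ • x) ^ 2) / R ^ 2 := by
    rw [Finset.sum_div]
    refine Finset.sum_congr rfl fun i _ => ?_
    rw [pd_cutoff]; ring
  rw [e]
  exact div_le_div_of_nonneg_right ((le_abs_self _).trans (hM _)) (sq_nonneg R)

lemma exists_norm_le_of_hasCompactSupport {u : Euc n → ℝ} (hu : HasCompactSupport u) :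
    ∃ R, 0 < R ∧ ∀ x, u x ≠ 0 → ‖x‖ ≤ R := by
  obtain ⟨R, hR⟩ := hu.isBounded.exists_norm_le
  exact ⟨max R 1, by positivity, fun x hx => (hR x (subset_tsupport u hx)).trans (le_max_left _ _)⟩

/-- The commutator of mollification and multiplication by a continuous function tends to zero
locally in mean square. -/
lemma tendsto_commutator {f V ζ : Euc n → ℝ} (hf : MemLp f 2 volume) (hV : ContDiff ℝ ∞ V)
    (hζ : IsTest ζ) :
    Tendsto (fun k => ∫ x, (ζ x * (mol (molKer n k) (fun t => V t * f t) x
      - V x * mol (molKer n k) f x)) ^ 2) atTop (𝓝 0) := by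
  obtain ⟨R, hR, hRζ⟩ := exists_norm_le_of_hasCompactSupport hζ.2
  set V' : Euc n → ℝ := fun x => V x * cutoff n (R + 1) x with hV'
  have hV't : IsTest V' := (isTest_cutoff (by linarith)).mul_left hV
  obtain ⟨Cζ, hCζ0, hCζ⟩ := hζ.exists_bound
  obtain ⟨CV, hCV0, hCV⟩ := hV't.exists_bound
  have hVf : MemLp (fun x => V' x * f x) 2 volume := hV't.memLp_mul hf
  have t1 := tendsto_integral_mol_sub_sq hVf
  have t2 := tendsto_integral_mol_sub_sq hf
  have hm := fun k => (integral_mol_sq_le (isTest_molKer (n := n) k).continuous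
    (isTest_molKer k).2 (molKer_nonneg k) (integral_molKer k) hf).1
  have hm' := fun k => (integral_mol_sq_le (isTest_molKer (n := n) k).continuous
    (isTest_molKer k).2 (molKer_nonneg k) (integral_molKer k) hVf).1
  have key : ∀ k x, ζ x * (mol (molKer n k) (fun t => V t * f t) x - V x * mol (molKer n k) f x)
      = ζ x * ((mol (molKer n k) (fun t => V' t * f t) x - V' x * f x)
        - V' x * (mol (molKer n k) f x - f x)) := by
    intro k x
    by_cases hx : ζ x = 0
    · simp [hx]
    have hxR := hRζ x hx
    have e1 : V' x = V x := by rw [hV']; simp [cutoff_eq_one (by linarith : 0 < R + 1)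
      (by linarith : ‖x‖ ≤ R + 1)]
    have e2 : mol (molKer n k) (fun t => V t * f t) x = mol (molKer n k) (fun t => V' t * f t) x := by
      rw [mol, mol]
      congr 1; ext t
      by_cases ht : ‖x - t‖ ≤ 1
      · have : ‖t‖ ≤ R + 1 := by
          calc ‖t‖ = ‖x - (x - t)‖ := by simp
            _ ≤ ‖x‖ + ‖x - t‖ := norm_sub_le _ _
            _ ≤ R + 1 := by linarith
        simp [hV', cutoff_eq_one (by linarith : 0 < R + 1) this]
      · rw [molKer_eq_zero k (not_le.1 ht)]; simp
    rw [e1, e2]; ring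
  have hbd : ∀ k x, (ζ x * (mol (molKer n k) (fun t => V t * f t) x
      - V x * mol (molKer n k) f x)) ^ 2
      ≤ Cζ ^ 2 * 2 * (mol (molKer n k) (fun t => V' t * f t) x - V' x * f x) ^ 2
        + Cζ ^ 2 * 2 * CV ^ 2 * (mol (molKer n k) f x - f x) ^ 2 := by
    intro k x
    rw [key]
    set a := mol (molKer n k) (fun t => V' t * f t) x - V' x * f x
    set b := mol (molKer n k) f x - f x
    have h1 : ζ x ^ 2 ≤ Cζ ^ 2 := sq_le_sq.2 (by rw [abs_of_nonneg hCζ0]; exact hCζ x)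
    have h2 : V' x ^ 2 ≤ CV ^ 2 := sq_le_sq.2 (by rw [abs_of_nonneg hCV0]; exact hCV x)
    have h3 : (a - V' x * b) ^ 2 ≤ 2 * a ^ 2 + 2 * CV ^ 2 * b ^ 2 := by
      nlinarith [sq_nonneg (a + V' x * b), mul_le_mul_of_nonneg_right h2 (sq_nonneg b)]
    calc (ζ x * (a - V' x * b)) ^ 2 = ζ x ^ 2 * (a - V' x * b) ^ 2 := by ring
      _ ≤ Cζ ^ 2 * (2 * a ^ 2 + 2 * CV ^ 2 * b ^ 2) :=
          mul_le_mul h1 h3 (sq_nonneg _) (sq_nonneg _)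
      _ = _ := by ring
  have i1 : ∀ k, Integrable fun x => (mol (molKer n k) (fun t => V' t * f t) x - V' x * f x) ^ 2 :=
    fun k => ((hm' k).sub hVf).integrable_sq
  have i2 : ∀ k, Integrable fun x => (mol (molKer n k) f x - f x) ^ 2 :=
    fun k => ((hm k).sub hf).integrable_sq
  have t3 : Tendsto (fun k => Cζ ^ 2 * 2 *
      (∫ x, (mol (molKer n k) (fun t => V' t * f t) x - V' x * f x) ^ 2)
      + Cζ ^ 2 * 2 * CV ^ 2 * ∫ x, (mol (molKer n k) f x - f x) ^ 2) atTop (𝓝 0) := by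
    simpa using (t1.const_mul (Cζ ^ 2 * 2)).add (t2.const_mul (Cζ ^ 2 * 2 * CV ^ 2))
  refine squeeze_zero (fun k => integral_nonneg fun x => sq_nonneg _) (fun k => ?_) t3
  rw [← integral_const_mul, ← integral_const_mul,
    ← integral_add ((i1 k).const_mul _) ((i2 k).const_mul _)]
  exact integral_mono_of_nonneg (Eventually.of_forall fun x => sq_nonneg _)
    (((i1 k).const_mul _).add ((i2 k).const_mul _)) (Eventually.of_forall (hbd k))

lemma volume_absolutelyContinuous_wMeasure (hW : Continuous W) :
    (volume : Measure (Euc n)) ≪ wMeasure W := by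
  intro s hs
  rw [measure_eq_zero_iff_ae_notMem] at hs ⊢
  exact (ae_wMeasure hW).1 hs

lemma memLp_wMeasure_iff (hW : Continuous W) {ψ : Euc n → ℝ} :
    MemLp ψ 2 (wMeasure W) ↔ MemLp (fun x => Real.exp (-W x / 2) * ψ x) 2 volume := by
  have hc : Continuous fun x => Real.exp (-W x / 2) := by fun_prop
  have hsq : ∀ x, (Real.exp (-W x / 2) * ψ x) ^ 2 = Real.exp (-W x) * ψ x ^ 2 := by
    intro x
    rw [mul_pow, ← Real.exp_nat_mul]; congr 2; push_cast; ring
  constructor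
  · intro h
    have hm := h.1.mono_ac (volume_absolutelyContinuous_wMeasure hW)
    refine (memLp_two_iff_integrable_sq (f := fun x => Real.exp (-W x / 2) * ψ x)
      (hc.aestronglyMeasurable.mul hm)).2 ?_
    simp only [hsq]
    exact (integrable_wMeasure hW _).1 h.integrable_sq
  · intro h
    have hm : AEStronglyMeasurable ψ volume := by
      have hc' : Continuous fun x => Real.exp (W x / 2) := by fun_prop
      refine (hc'.aestronglyMeasurable.mul h.1).congr (Eventually.of_forall fun x => ?_)
      simp only [Pi.mul_apply, ← mul_assoc, ← Real.exp_add]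
      rw [← add_div]; simp
    refine (memLp_two_iff_integrable_sq (μ := wMeasure W)
      (hm.mono_ac (withDensity_absolutelyContinuous _ _))).2 ?_
    rw [integrable_wMeasure hW]
    simpa only [hsq] using h.integrable_sq

lemma integral_mul_pd_eq (F χ : Euc n → ℝ) (hF : ContDiff ℝ 1 F) (hχ : IsTest χ) (i : Fin n) :
    ∫ x, F x * pd i χ x = - ∫ x, pd i F x * χ x := by
  have hc := hF.continuous
  have i1 := (hc.mul (hχ.pd i).continuous).integrable_of_hasCompactSupport (μ := volume)
    (hχ.pd i).2.mul_left
  have i2 := ((continuous_pd i hF).mul hχ.continuous).integrable_of_hasCompactSupport (μ := volume)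
    hχ.2.mul_left
  have i3 := (hc.mul hχ.continuous).integrable_of_hasCompactSupport (μ := volume) hχ.2.mul_left
  exact integral_mul_fderiv_eq_neg_fderiv_mul_of_integrable i2 i1 i3
    (fun x _ => hF.differentiable one_ne_zero x) (fun x _ => hχ.differentiable x)

variable [IsFiniteMeasure (wMeasure W)]

/-- A square integrable weak solution of `Lψ = 0` has vanishing weak gradient. -/
lemma integral_weak_gradient (hW : ContDiff ℝ ∞ W) {ψ : Euc n → ℝ}
    (hψ : MemLp ψ 2 (wMeasure W))
    (hweak : ∀ u, IsTest u → ∫ x, ψ x * wLap W u x ∂wMeasure W = 0)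
    {χ : Euc n → ℝ} (hχ : IsTest χ) (i : Fin n) : ∫ x, ψ x * pd i χ x = 0 := by
  have hWc := hW.continuous
  set f : Euc n → ℝ := fun x => Real.exp (-W x / 2) * ψ x with hfdef
  have hf : MemLp f 2 volume := (memLp_wMeasure_iff hWc).1 hψ
  have hfl : LocallyIntegrable f := hf.locallyIntegrable (by norm_num)
  have hψf : ∀ x, ψ x = Real.exp (W x / 2) * f x := by
    intro x
    rw [hfdef]; simp only [← mul_assoc, ← Real.exp_add]
    rw [← add_div]; simp
  have hV := contDiff_wPot hW
  have hweak' : ∀ h, IsTest h → ∫ x, f x * (lapl h x - wPot W x * h x) = 0 := by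
    intro h hh
    have := hweak _ (hh.mul_left (contDiff_exp_half hW))
    rw [integral_wMeasure hWc] at this
    rw [← this]
    congr 1; ext x
    rw [wLap_exp_half_mul hW hh.1, hψf]
    have : Real.exp (-W x) * Real.exp (W x / 2) ^ 2 = 1 := by
      rw [← Real.exp_nat_mul, ← Real.exp_add]; norm_num; ring
    linear_combination (-f x * (lapl h x - wPot W x * h x)) * this
  set F : ℕ → Euc n → ℝ := fun k => mol (molKer n k) f with hF
  have hFs : ∀ k, ContDiff ℝ ∞ (F k) := fun k => contDiff_mol (isTest_molKer k) hfl
  have hFm := fun k => integral_mol_sq_le (isTest_molKer (n := n) k).continuous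
    (isTest_molKer k).2 (molKer_nonneg k) (integral_molKer k) hf
  set A := ∫ x, f x ^ 2 with hA
  have hA0 : 0 ≤ A := integral_nonneg fun x => sq_nonneg _
  -- convergence of the pairing
  have hη : IsTest fun x => Real.exp (W x / 2) * pd i χ x := (hχ.pd i).mul_left (contDiff_exp_half hW)
  set a := ∫ x, ψ x * pd i χ x with ha
  set ak : ℕ → ℝ := fun k => ∫ x, (Real.exp (W x / 2) * F k x) * pd i χ x with hak
  have hak_lim : Tendsto ak atTop (𝓝 a) := by
    set D := ∫ x, (Real.exp (W x / 2) * pd i χ x) ^ 2 with hD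
    have hb : ∀ k, (ak k - a) ^ 2 ≤ D * ∫ x, (F k x - f x) ^ 2 := by
      intro k
      have e : ak k - a = ∫ x, (Real.exp (W x / 2) * pd i χ x) * (F k x - f x) := by
        rw [hak, ha]; simp only
        rw [← integral_sub]
        · congr 1; ext x; rw [hψf]; ring
        · refine (((contDiff_exp_half hW).continuous.mul (hFs k).continuous).mul
            (hχ.pd i).continuous).integrable_of_hasCompactSupport (hχ.pd i).2.mul_left
        · refine (hη.integrable_mul_locallyIntegrable hfl).congr (Eventually.of_forall fun x => ?_)
          simp only [hψf]; ring
      rw [e]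
      exact sq_integral_mul_le hη.memLp ((hFm k).1.sub hf)
    have t0 : Tendsto (fun k => (ak k - a) ^ 2) atTop (𝓝 0) :=
      squeeze_zero (fun k => sq_nonneg _) hb
        (by simpa using (tendsto_integral_mol_sub_sq hf).const_mul D)
    rw [tendsto_iff_dist_tendsto_zero]
    have := t0.sqrt
    simpa [Real.sqrt_sq_eq_abs, Real.dist_eq] using this
  obtain ⟨M, hM0, hM⟩ := exists_cutoff_grad_bound n
  obtain ⟨R₀, hR₀, hRχ⟩ := exists_norm_le_of_hasCompactSupport hχ.2
  set Cχ := ∫ x, (Real.exp (W x / 2) * χ x) ^ 2 with hCχ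
  have hCχ0 : 0 ≤ Cχ := integral_nonneg fun x => sq_nonneg _
  have hR : ∀ R, R₀ ≤ R → a ^ 2 ≤ Cχ * (4 * (M / R ^ 2 * A)) := by
    intro R hRR
    have hRpos : 0 < R := hR₀.trans_le hRR
    have hζ := isTest_cutoff (n := n) hRpos
    set ζ := cutoff n R with hζdef
    have hζ2 : IsTest fun x => ζ x ^ 2 := by
      simpa only [pow_two] using hζ.mul_left hζ.1
    set q : ℕ → Euc n → ℝ := fun k x => ζ x ^ 2 * (lapl (F k) x - wPot W x * F k x) with hq
    have hqc : ∀ k, IsTest (q k) := fun k => by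
      simpa only [mul_comm] using hζ2.mul_left ((contDiff_lapl (hFs k)).sub (hV.mul (hFs k)))
    have hq_lim : Tendsto (fun k => ∫ x, q k x ^ 2) atTop (𝓝 0) := by
      refine (tendsto_commutator hf hV hζ2).congr fun k => ?_
      congr 1; ext x
      rw [hq]; simp only
      rw [hF, lapl_mol hfl hV.continuous (isTest_molKer k) hweak']
    set B : ℕ → ℝ := fun k => ∫ x, |F k x| * |q k x| with hB
    have hB0 : ∀ k, 0 ≤ B k := fun k => integral_nonneg fun x => by positivity
    have hB_lim : Tendsto B atTop (𝓝 0) := by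
      have hb : ∀ k, B k ^ 2 ≤ A * ∫ x, q k x ^ 2 := by
        intro k
        have h1 := sq_integral_mul_le (hFm k).1.abs (hqc k).memLp.abs
        simp only [Pi.abs_apply, sq_abs] at h1
        refine h1.trans (mul_le_mul_of_nonneg_right (hFm k).2 (integral_nonneg fun x => sq_nonneg _))
      have t0 : Tendsto (fun k => B k ^ 2) atTop (𝓝 0) :=
        squeeze_zero (fun k => sq_nonneg _) hb (by simpa using hq_lim.const_mul A)
      have := t0.sqrt
      simpa [Real.sqrt_sq (hB0 _)] using this
    have hmain : ∀ k, ak k ^ 2 ≤ Cχ * (4 * (M / R ^ 2 * A) + 2 * B k) := by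
      intro k
      set G : Euc n → ℝ := fun y => Real.exp (W y / 2) * F k y with hG
      have hGs : ContDiff ℝ ∞ G := (contDiff_exp_half hW).mul (hFs k)
      have e1 : ak k = - ∫ x, (Real.exp (W x / 2) * χ x) * (ζ x * Real.exp (-W x / 2) * pd i G x) := by
        rw [hak]; simp only
        rw [integral_mul_pd_eq G χ (contDiff_infty.1 hGs 1) hχ i]
        congr 2; ext x
        by_cases hx : χ x = 0
        · simp [hx]
        have hz : ζ x = 1 := cutoff_eq_one hRpos ((hRχ x hx).trans hRR)
        have : Real.exp (W x / 2) * Real.exp (-W x / 2) = 1 := by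
          rw [← Real.exp_add, ← add_div]; simp
        rw [hz]; linear_combination (-χ x * pd i G x) * this
      have ht : IsTest fun x => ζ x * Real.exp (-W x / 2) * pd i G x := by
        have := hζ.mul_left ((contDiff_infty_pd i hGs).mul (hW.neg.div_const 2).exp)
        convert this using 2 with x
        ring
      have h2 := sq_integral_mul_le (hχ.mul_left (contDiff_exp_half hW)).memLp ht.memLp
      rw [e1, neg_sq]
      refine h2.trans (mul_le_mul_of_nonneg_left ?_ hCχ0)
      have h3 := caccioppoli hW (hFs k) hζ
      rw [integral_wMeasure hWc] at h3
      have h4 : ∫ x, (∑ j, pd j ζ x ^ 2) * F k x ^ 2 ≤ M / R ^ 2 * A := by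
        calc ∫ x, (∑ j, pd j ζ x ^ 2) * F k x ^ 2 ≤ ∫ x, M / R ^ 2 * F k x ^ 2 :=
              integral_mono_of_nonneg (Eventually.of_forall fun x => by positivity)
                ((hFm k).1.integrable_sq.const_mul _)
                (Eventually.of_forall fun x => mul_le_mul_of_nonneg_right (hM R x) (sq_nonneg _))
          _ ≤ M / R ^ 2 * A := by
              rw [integral_const_mul]
              exact mul_le_mul_of_nonneg_left (hFm k).2 (by positivity)
      have h5 : ∫ x, (ζ x * Real.exp (-W x / 2) * pd i G x) ^ 2
          ≤ ∫ x, Real.exp (-W x) * (ζ x ^ 2 * ∑ j, pd j G x ^ 2) := by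
        refine integral_mono_of_nonneg (Eventually.of_forall fun x => sq_nonneg _) ?_
          (Eventually.of_forall fun x => ?_)
        · have h6 : IsTest fun x => (Real.exp (-W x) * ∑ j, pd j G x ^ 2) * ζ x ^ 2 :=
            hζ2.mul_left (hW.neg.exp.mul (ContDiff.sum fun j _ => (contDiff_infty_pd j hGs).pow 2))
          refine (h6.continuous.integrable_of_hasCompactSupport h6.2).congr
            (Eventually.of_forall fun x => ?_)
          simp only; ring
        · have e7 : Real.exp (-W x / 2) ^ 2 = Real.exp (-W x) := by
            rw [← Real.exp_nat_mul]; congr 1; push_cast; ring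
          have h8 : pd i G x ^ 2 ≤ ∑ j, pd j G x ^ 2 :=
            Finset.single_le_sum (f := fun j => pd j G x ^ 2) (fun j _ => sq_nonneg _)
              (Finset.mem_univ i)
          calc (ζ x * Real.exp (-W x / 2) * pd i G x) ^ 2
              = Real.exp (-W x) * (ζ x ^ 2 * pd i G x ^ 2) := by rw [← e7]; ring
            _ ≤ _ := mul_le_mul_of_nonneg_left (mul_le_mul_of_nonneg_left h8 (sq_nonneg _))
                (Real.exp_pos _).le
      calc _ ≤ _ := h5
        _ ≤ _ := h3
        _ ≤ 4 * (M / R ^ 2 * A) + 2 * B k := by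
          have : B k = ∫ x, |F k x| * |ζ x ^ 2 * (lapl (F k) x - wPot W x * F k x)| := rfl
          rw [this]; linarith
    refine le_of_tendsto_of_tendsto' (hak_lim.pow 2) ?_ hmain
    simpa using ((hB_lim.const_mul 2).const_add (4 * (M / R ^ 2 * A))).const_mul Cχ
  have hlim : Tendsto (fun R : ℝ => Cχ * (4 * (M / R ^ 2 * A))) atTop (𝓝 0) := by
    have : Tendsto (fun R : ℝ => M / R ^ 2) atTop (𝓝 0) :=
      tendsto_const_nhds.div_atTop (tendsto_pow_atTop (by norm_num))
    simpa using ((this.mul_const A).const_mul 4).const_mul Cχ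
  have : a ^ 2 ≤ 0 := ge_of_tendsto hlim (eventually_atTop.2 ⟨R₀, fun R h => hR R h⟩)
  exact pow_eq_zero_iff (two_ne_zero) |>.1 (le_antisymm this (sq_nonneg a))

lemma ae_const_of_weak_gradient {ψ : Euc n → ℝ} (hψ : LocallyIntegrable ψ)
    (h : ∀ χ, IsTest χ → ∀ i, ∫ x, ψ x * pd i χ x = 0) : ∃ c, ∀ᵐ x, ψ x = c := by
  have hc : ∀ k x, mol (molKer n k) ψ x = mol (molKer n k) ψ 0 := by
    intro k x
    have hs := contDiff_mol (isTest_molKer (n := n) k) hψ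
    refine is_const_of_fderiv_eq_zero (𝕜 := ℝ) (hs.differentiable (by simp)) (fun y => ?_) x 0
    have hp : ∀ i, pd i (mol (molKer n k) ψ) y = 0 := by
      intro i
      rw [pd_mol (isTest_molKer k) hψ, mol]
      have := h _ ((isTest_molKer (n := n) k).sub_arg y) i
      rw [pd_sub_arg (isTest_molKer k).differentiable] at this
      rw [← neg_eq_zero, ← integral_neg, ← this]
      congr 1; ext t; ring
    refine ContinuousLinearMap.coe_injective ?_
    refine (EuclideanSpace.basisFun (Fin n) ℝ).toBasis.ext fun i => ?_
    simpa [pd] using hp i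
  obtain ⟨x₀, hx₀⟩ := (ae_tendsto_mol hψ).exists
  refine ⟨ψ x₀, ?_⟩
  filter_upwards [ae_tendsto_mol hψ] with x hx
  refine tendsto_nhds_unique hx (hx₀.congr fun k => ?_)
  rw [hc k x, hc k x₀]

end Density

section DenseRange

open Filter Topology

variable {n : ℕ} {W : Euc n → ℝ}

lemma wLap_add {u v : Euc n → ℝ} (hu : ContDiff ℝ ∞ u) (hv : ContDiff ℝ ∞ v) (x : Euc n) :
    wLap W (fun y => u y + v y) x = wLap W u x + wLap W v x := by
  have hd : ∀ {f : Euc n → ℝ}, ContDiff ℝ ∞ f → Differentiable ℝ f :=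
    fun hf => hf.differentiable (by simp)
  simp only [wLap, ← Finset.sum_add_distrib]
  refine Finset.sum_congr rfl fun i _ => ?_
  have e : pd i (fun y => u y + v y) = fun y => pd i u y + pd i v y :=
    funext fun y => pd_add i (hd hu y) (hd hv y)
  rw [e, pd_add i (hd (contDiff_infty_pd i hu) x) (hd (contDiff_infty_pd i hv) x)]
  ring

lemma wLap_const_mul {u : Euc n → ℝ} (c : ℝ) (hu : ContDiff ℝ ∞ u) (x : Euc n) :
    wLap W (fun y => c * u y) x = c * wLap W u x := by
  have hd : ∀ {f : Euc n → ℝ}, ContDiff ℝ ∞ f → Differentiable ℝ f :=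
    fun hf => hf.differentiable (by simp)
  simp only [wLap, Finset.mul_sum]
  refine Finset.sum_congr rfl fun i _ => ?_
  have e : pd i (fun y => c * u y) = fun y => c * pd i u y :=
    funext fun y => pd_const_mul i c (hd hu y)
  rw [e, pd_const_mul i c (hd (contDiff_infty_pd i hu) x)]
  ring

lemma pd_of_even {f : Euc n → ℝ} (hf : Differentiable ℝ f) (he : ∀ x, f (-x) = f x) (i : Fin n)
    (x : Euc n) : pd i f (-x) = - pd i f x := by
  have h := pd_neg_arg i (x := x) (hf (-x))
  rw [show (fun y => f (-y)) = f from funext he] at h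
  linarith

lemma wLap_neg_arg (hW : ContDiff ℝ ∞ W) (hWe : ∀ x, W (-x) = W x) {u : Euc n → ℝ}
    (hu : ContDiff ℝ ∞ u) (x : Euc n) : wLap W (fun y => u (-y)) x = wLap W u (-x) := by
  have hd : ∀ {f : Euc n → ℝ}, ContDiff ℝ ∞ f → Differentiable ℝ f :=
    fun hf => hf.differentiable (by simp)
  simp only [wLap]
  refine Finset.sum_congr rfl fun i _ => ?_
  have e : pd i (fun y => u (-y)) = fun y => (-1) * pd i u (-y) :=
    funext fun y => by rw [pd_neg_arg i (hd hu (-y))]; ring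
  have hs : Differentiable ℝ fun y => pd i u (-y) := 
    (hd ((contDiff_infty_pd i hu).comp contDiff_neg))
  rw [e, pd_const_mul i _ (hs x), pd_neg_arg i (hd (contDiff_infty_pd i hu) (-x)),
    pd_of_even (hd hW) hWe]
  ring

lemma integral_wMeasure_neg (hW : Continuous W) (hWe : ∀ x, W (-x) = W x) (f : Euc n → ℝ) :
    ∫ x, f (-x) ∂wMeasure W = ∫ x, f x ∂wMeasure W := by
  rw [integral_wMeasure hW, integral_wMeasure hW,
    ← integral_neg_eq_self (fun x => Real.exp (-W x) * f x)]
  simp only [hWe]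

lemma integrable_wMeasure_neg (hW : Continuous W) (hWe : ∀ x, W (-x) = W x) {f : Euc n → ℝ}
    (hf : Integrable f (wMeasure W)) : Integrable (fun x => f (-x)) (wMeasure W) := by
  rw [integrable_wMeasure hW] at hf ⊢
  simpa only [hWe] using hf.comp_neg

lemma IsTest.neg_arg {u : Euc n → ℝ} (hu : IsTest u) : IsTest fun x => u (-x) :=
  ⟨hu.1.comp contDiff_neg, hu.2.comp_homeomorph (Homeomorph.neg _)⟩

lemma IsTest.const_mul {u : Euc n → ℝ} (hu : IsTest u) (c : ℝ) : IsTest fun x => c * u x :=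
  hu.mul_left (φ := fun _ => c) contDiff_const

variable [IsFiniteMeasure (wMeasure W)]

lemma IsTest.memLp_wMeasure {u : Euc n → ℝ} (hu : IsTest u) : MemLp u 2 (wMeasure W) :=
  hu.continuous.memLp_of_hasCompactSupport hu.2

/-- The range of the weighted Laplacian on test functions, as a subspace of `L²`. -/
def wLapRange (W : Euc n → ℝ) : Submodule ℝ (Lp ℝ 2 (wMeasure W)) where
  carrier := {f | ∃ u, IsTest u ∧ f =ᵐ[wMeasure W] wLap W u}
  add_mem' := by
    rintro f g ⟨u, hu, hf⟩ ⟨v, hv, hg⟩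
    refine ⟨_, hu.add hv, ?_⟩
    filter_upwards [hf, hg, Lp.coeFn_add f g] with x h1 h2 h3
    rw [h3, Pi.add_apply, h1, h2, wLap_add hu.1 hv.1]
  zero_mem' := by
    refine ⟨fun _ => 0, ⟨contDiff_const, HasCompactSupport.zero⟩, ?_⟩
    filter_upwards [Lp.coeFn_zero ℝ 2 (wMeasure W)] with x h
    have h0 : ∀ i : Fin n, pd i (fun _ : Euc n => (0 : ℝ)) = fun _ => 0 :=
      fun i => funext fun y => pd_const i 0
    rw [h]
    simp [wLap, h0]
  smul_mem' := by
    rintro c f ⟨u, hu, hf⟩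
    refine ⟨_, hu.const_mul c, ?_⟩
    filter_upwards [hf, Lp.coeFn_smul c f] with x h1 h2
    rw [h2, Pi.smul_apply, h1, wLap_const_mul c hu.1, smul_eq_mul]

/-- Mean-zero square integrable functions are approximated by weighted Laplacians of test
functions. -/
lemma exists_wLap_approx (hW : ContDiff ℝ ∞ W) {g : Euc n → ℝ} (hg : MemLp g 2 (wMeasure W))
    (hg0 : ∫ x, g x ∂wMeasure W = 0) {ε : ℝ} (hε : 0 < ε) :
    ∃ u, IsTest u ∧ ∫ x, (wLap W u x - g x) ^ 2 ∂wMeasure W < ε := by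
  have hmem : hg.toLp ∈ closure (wLapRange W : Set (Lp ℝ 2 (wMeasure W))) := by
    have : hg.toLp ∈ (wLapRange W)ᗮᗮ := by
      rw [Submodule.mem_orthogonal]
      intro ψ hψ
      rw [Submodule.mem_orthogonal] at hψ
      have hψ2 : MemLp (ψ : Euc n → ℝ) 2 (wMeasure W) := Lp.memLp ψ
      have hweak : ∀ u, IsTest u → ∫ x, ψ x * wLap W u x ∂wMeasure W = 0 := by
        intro u hu
        have h := hψ _ ⟨u, hu, (hu.wLap hW).memLp_wMeasure.coeFn_toLp⟩
        rw [L2.inner_def] at h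
        rw [← h]
        refine integral_congr_ae ?_
        filter_upwards [(hu.wLap hW).memLp_wMeasure.coeFn_toLp] with x hx
        rw [hx]; simp [mul_comm]
      have hloc : LocallyIntegrable (ψ : Euc n → ℝ) := by
        have h1 := ((memLp_wMeasure_iff hW.continuous).1 hψ2).locallyIntegrable (by norm_num)
        have h2 := LocallyIntegrable.cont_mul (contDiff_exp_half hW).continuous h1
        refine h2.congr (Eventually.of_forall fun x => ?_)
        simp only [← mul_assoc, ← Real.exp_add]
        rw [← add_div]; simp
      obtain ⟨c, hc⟩ := ae_const_of_weak_gradient hloc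
        fun χ hχ i => integral_weak_gradient hW hψ2 hweak hχ i
      rw [L2.inner_def]
      have : ∫ x, c * g x ∂wMeasure W = 0 := by rw [integral_const_mul, hg0, mul_zero]
      rw [← this]
      refine integral_congr_ae ?_
      filter_upwards [hg.coeFn_toLp, (ae_wMeasure hW.continuous).2 hc] with x hx hcx
      rw [hx, hcx]; simp [mul_comm]
    rw [Submodule.orthogonal_orthogonal_eq_closure] at this
    exact this
  obtain ⟨f, ⟨u, hu, hf⟩, hd⟩ := Metric.mem_closure_iff.1 hmem (Real.sqrt ε) (Real.sqrt_pos.2 hε)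
  refine ⟨u, hu, ?_⟩
  rw [dist_comm, dist_eq_norm, Real.lt_sqrt (norm_nonneg _), ← real_inner_self_eq_norm_sq,
    L2.inner_def] at hd
  refine lt_of_eq_of_lt (integral_congr_ae ?_) hd
  filter_upwards [hg.coeFn_toLp, hf, Lp.coeFn_sub f hg.toLp] with x h1 h2 h3
  rw [h3, Pi.sub_apply, h1, h2]
  simp [pow_two]

/-- If the weight and the target are even, the approximating potential can be chosen even. -/
lemma exists_even_wLap_approx (hW : ContDiff ℝ ∞ W) (hWe : ∀ x, W (-x) = W x) {g : Euc n → ℝ}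
    (hg : MemLp g 2 (wMeasure W)) (hg0 : ∫ x, g x ∂wMeasure W = 0) (hge : ∀ x, g (-x) = g x)
    {ε : ℝ} (hε : 0 < ε) :
    ∃ u, IsTest u ∧ (∀ x, u (-x) = u x) ∧ ∫ x, (wLap W u x - g x) ^ 2 ∂wMeasure W < ε := by
  obtain ⟨u, hu, hlt⟩ := exists_wLap_approx hW hg hg0 hε
  have hs := (hu.const_mul (1 / 2)).add (hu.neg_arg.const_mul (1 / 2))
  refine ⟨_, hs, fun x => by simp only [neg_neg]; ring, lt_of_le_of_lt ?_ hlt⟩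
  have e : ∀ x, wLap W (fun x => 1 / 2 * u x + 1 / 2 * u (-x)) x - g x
      = 1 / 2 * (wLap W u x - g x) + 1 / 2 * (wLap W u (-x) - g (-x)) := by
    intro x
    rw [wLap_add (hu.const_mul _).1 (hu.neg_arg.const_mul _).1, wLap_const_mul _ hu.1,
      wLap_const_mul _ hu.neg_arg.1, wLap_neg_arg hW hWe hu.1, hge]
    ring
  have i1 : Integrable (fun x => (wLap W u x - g x) ^ 2) (wMeasure W) :=
    ((hu.wLap hW).memLp_wMeasure.sub hg).integrable_sq
  have i2 := integrable_wMeasure_neg hW.continuous hWe i1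
  have e2 := integral_wMeasure_neg hW.continuous hWe fun x => (wLap W u x - g x) ^ 2
  calc _ ≤ ∫ x, (1 / 2 * (wLap W u x - g x) ^ 2 + 1 / 2 * (wLap W u (-x) - g (-x)) ^ 2)
        ∂wMeasure W := by
        refine integral_mono_of_nonneg (Eventually.of_forall fun x => sq_nonneg _)
          ((i1.const_mul _).add (i2.const_mul _)) (Eventually.of_forall fun x => ?_)
        simp only [e]
        nlinarith [sq_nonneg ((wLap W u x - g x) - (wLap W u (-x) - g (-x)))]
    _ = _ := by
        rw [integral_add (i1.const_mul _) (i2.const_mul _), integral_const_mul, integral_const_mul,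
          e2]
        ring

end DenseRange

section Poincare

open Filter Topology

variable {n : ℕ} {W : Euc n → ℝ}

lemma integral_odd (hW : Continuous W) (hWe : ∀ x, W (-x) = W x) {f : Euc n → ℝ}
    (hf : ∀ x, f (-x) = - f x) : ∫ x, f x ∂wMeasure W = 0 := by
  have := integral_wMeasure_neg hW hWe f
  simp only [hf, integral_neg] at this
  linarith

lemma contDiff_coord {k : WithTop ℕ∞} (i : Fin n) : ContDiff ℝ k fun x : Euc n => x i :=
  (EuclideanSpace.proj i : Euc n →L[ℝ] ℝ).contDiff

variable [IsProbabilityMeasure (wMeasure W)]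

/-- The Poincaré inequality for a uniformly log-concave probability measure. -/
lemma poincare (hW : ContDiff ℝ ∞ W)
    (hconv : ∀ (x : Euc n) (ξ : Fin n → ℝ),
      ∑ i, ξ i ^ 2 ≤ ∑ j, ∑ i, pd j (pd i W) x * ξ i * ξ j)
    {φ : Euc n → ℝ} (hφ : ContDiff ℝ 1 φ) (hφ2 : MemLp φ 2 (wMeasure W))
    (hdφ : ∀ i, MemLp (pd i φ) 2 (wMeasure W)) (h0 : ∫ x, φ x ∂wMeasure W = 0) :
    ∫ x, φ x ^ 2 ∂wMeasure W ≤ ∫ x, ∑ i, pd i φ x ^ 2 ∂wMeasure W := by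
  refine le_of_forall_pos_le_add fun δ hδ => ?_
  obtain ⟨u, hu, hlt⟩ := exists_wLap_approx hW hφ2 h0 hδ
  have hL := hu.wLap hW
  have iL : Integrable (fun x => wLap W u x ^ 2) (wMeasure W) := hL.memLp_wMeasure.integrable_sq
  have iφL : Integrable (fun x => φ x * wLap W u x) (wMeasure W) := hL.integrable_mul hφ.continuous
  have iφ : Integrable (fun x => φ x ^ 2) (wMeasure W) := hφ2.integrable_sq
  have e1 : ∫ x, (wLap W u x - φ x) ^ 2 ∂wMeasure W
      = (∫ x, wLap W u x ^ 2 ∂wMeasure W) - 2 * (∫ x, φ x * wLap W u x ∂wMeasure W)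
        + ∫ x, φ x ^ 2 ∂wMeasure W := by
    rw [← integral_const_mul, ← integral_sub iL (iφL.const_mul 2),
      ← integral_add (iL.sub' (iφL.const_mul 2)) iφ]
    congr 1; ext x; ring
  have idu : ∀ i, Integrable (fun x => pd i u x ^ 2) (wMeasure W) := fun i =>
    (hu.pd i).memLp_wMeasure.integrable_sq
  have isu : Integrable (fun x => ∑ i, pd i u x ^ 2) (wMeasure W) :=
    integrable_finsetSum _ fun i _ => idu i
  have isφ : Integrable (fun x => ∑ i, pd i φ x ^ 2) (wMeasure W) :=
    integrable_finsetSum _ fun i _ => (hdφ i).integrable_sq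
  have iH : Integrable (fun x => ∑ j, ∑ i, pd j (pd i W) x * pd i u x * pd j u x) (wMeasure W) :=
    integrable_finsetSum _ fun j _ => integrable_finsetSum _ fun i _ =>
      (hu.pd j).integrable_mul
        ((contDiff_infty_pd j (contDiff_infty_pd i hW)).continuous.mul (hu.pd i).continuous)
  have e2 := integral_wLap_sq hW hu
  have e3 : ∫ x, ∑ i, pd i u x ^ 2 ∂wMeasure W
      ≤ ∫ x, ∑ j, ∑ i, pd j (pd i W) x * pd i u x * pd j u x ∂wMeasure W :=
    integral_mono isu iH fun x => hconv x fun i => pd i u x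
  have e4 : 0 ≤ ∫ x, ∑ j, ∑ i, pd i (pd j u) x ^ 2 ∂wMeasure W :=
    integral_nonneg fun x => by positivity
  have e5 := integral_mul_wLap hW hφ hu
  have e6 : -∫ x, ∑ i, pd i φ x * pd i u x ∂wMeasure W
      ≤ 1 / 2 * (∫ x, ∑ i, pd i φ x ^ 2 ∂wMeasure W)
        + 1 / 2 * ∫ x, ∑ i, pd i u x ^ 2 ∂wMeasure W := by
    rw [← integral_const_mul, ← integral_const_mul, ← integral_neg,
      ← integral_add (isφ.const_mul _) (isu.const_mul _)]
    refine integral_mono (Integrable.neg (integrable_finsetSum _ fun i _ =>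
      (hdφ i).integrable_mul (hu.pd i).memLp_wMeasure))
      ((isφ.const_mul _).add (isu.const_mul _)) fun x => ?_
    simp only [Finset.mul_sum, ← Finset.sum_add_distrib, ← Finset.sum_neg_distrib]
    exact Finset.sum_le_sum fun i _ => by nlinarith [sq_nonneg (pd i φ x + pd i u x)]
  linarith

/-- The Gaussian divergence of an odd test field in one coordinate. -/
lemma sq_integral_gaussDiv_le (hW : ContDiff ℝ ∞ W) (hWe : ∀ x, W (-x) = W x)
    (hconv : ∀ (x : Euc n) (ξ : Fin n → ℝ),
      ∑ i, ξ i ^ 2 ≤ ∑ j, ∑ i, pd j (pd i W) x * ξ i * ξ j)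
    (i : Fin n) (hx : MemLp (fun x : Euc n => x i) 2 (wMeasure W))
    {v : Euc n → ℝ} (hv : IsTest v) (hvo : ∀ x, v (-x) = - v x) :
    (∫ x, (pd i v x - x i * v x) ∂wMeasure W) ^ 2 ≤ ∫ x, ∑ j, pd j v x ^ 2 ∂wMeasure W := by
  have hpc : ∀ j, pd j (fun x : Euc n => x i) = fun _ => if j = i then (1 : ℝ) else 0 :=
    fun j => funext fun x => pd_coord j i
  set β := ∫ x, pd i v x ∂wMeasure W with hβ
  set X := ∫ x : Euc n, x i ^ 2 ∂wMeasure W with hX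
  have hX0 : 0 ≤ X := integral_nonneg fun x => sq_nonneg _
  have hX1 : X ≤ 1 := by
    refine (poincare hW hconv (contDiff_coord i) hx (fun j => ?_)
      (integral_odd hW.continuous hWe fun x => by simp)).trans (le_of_eq ?_)
    · rw [hpc]; exact memLp_const _
    · simp [hpc]
  have hvL := hv.memLp_wMeasure (W := W)
  have hw : MemLp (fun x => v x - β * x i) 2 (wMeasure W) := hvL.sub (hx.const_mul β)
  have hpw : ∀ j, pd j (fun x => v x - β * x i) = fun x => pd j v x - β * if j = i then 1 else 0 := by
    intro j; ext x
    rw [pd_sub j (hv.differentiable x)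
      (((contDiff_coord (k := 1) i).differentiable one_ne_zero x).const_mul β),
      pd_const_mul j _ ((contDiff_coord (k := 1) i).differentiable one_ne_zero x), pd_coord]
  have isv : Integrable (fun x => ∑ j, pd j v x ^ 2) (wMeasure W) :=
    integrable_finsetSum _ fun j _ => (hv.pd j).memLp_wMeasure.integrable_sq
  have hP := poincare hW hconv (φ := fun x => v x - β * x i)
    (hv.contDiff_one.sub (contDiff_const.mul (contDiff_coord i))) hw (fun j => by
      rw [hpw]; exact (hv.pd j).memLp_wMeasure.sub (memLp_const _))
    (integral_odd hW.continuous hWe fun x => by simp [hvo]; ring)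
  have e1 : ∫ x, ∑ j, pd j (fun x => v x - β * x i) x ^ 2 ∂wMeasure W
      = (∫ x, ∑ j, pd j v x ^ 2 ∂wMeasure W) - β ^ 2 := by
    have : ∀ x, ∑ j, pd j (fun x => v x - β * x i) x ^ 2
        = (∑ j, pd j v x ^ 2) - (2 * β * pd i v x - β ^ 2) := by
      intro x
      have : ∀ j, pd j (fun x => v x - β * x i) x ^ 2
          = pd j v x ^ 2 - if j = i then 2 * β * pd j v x - β ^ 2 else 0 := by
        intro j; rw [hpw]; simp only; split_ifs <;> ring
      simp only [this, Finset.sum_sub_distrib, Finset.sum_ite_eq', Finset.mem_univ, if_true]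
    simp only [this]
    rw [integral_sub isv (((hv.pd i).integrable.const_mul _).sub' (integrable_const _)),
      integral_sub ((hv.pd i).integrable.const_mul _) (integrable_const _), integral_const_mul]
    simp [← hβ]; ring
  have ixw : Integrable (fun x => x i * (v x - β * x i)) (wMeasure W) := hx.integrable_mul hw
  have e2 : ∫ x, (pd i v x - x i * v x) ∂wMeasure W
      = β * (1 - X) - ∫ x, x i * (v x - β * x i) ∂wMeasure W := by
    have : ∀ x : Euc n, pd i v x - x i * v x = pd i v x - β * x i ^ 2 - x i * (v x - β * x i) := by
      intro x; ring
    simp only [this]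
    rw [integral_sub ((hv.pd i).integrable.sub' (hx.integrable_sq.const_mul β)) ixw,
      integral_sub (hv.pd i).integrable (hx.integrable_sq.const_mul β), integral_const_mul]
    ring
  have e3 := sq_integral_mul_le hx hw
  rw [← hX] at e3
  rw [e2]
  set Y := ∫ x, x i * (v x - β * x i) ∂wMeasure W
  set w2 := ∫ x, (v x - β * x i) ^ 2 ∂wMeasure W with hw2
  have hw20 : 0 ≤ w2 := integral_nonneg fun x => sq_nonneg _
  have key : (β * (1 - X) - Y) ^ 2 ≤ β ^ 2 + w2 := by
    -- Cauchy–Schwarz in the plane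
    rcases hX0.eq_or_lt with h | h
    · have : Y ^ 2 ≤ 0 := by simpa [← h] using e3
      have hY : Y = 0 := pow_eq_zero_iff two_ne_zero |>.1 (le_antisymm this (sq_nonneg _))
      rw [hY, ← h]; nlinarith
    · have h1 : Y ^ 2 / X ≤ w2 := by rw [div_le_iff₀ h]; linarith
      have h2 : (β * (1 - X) - Y) ^ 2 ≤ (β ^ 2 + Y ^ 2 / X) * ((1 - X) ^ 2 + X) := by
        have : (β ^ 2 + Y ^ 2 / X) * ((1 - X) ^ 2 + X) - (β * (1 - X) - Y) ^ 2
            = (β * X + Y * (1 - X)) ^ 2 / X := by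
          field_simp; ring
        have h3 : 0 ≤ (β * X + Y * (1 - X)) ^ 2 / X := by positivity
        linarith
      have h3 : 0 ≤ β ^ 2 + Y ^ 2 / X := by positivity
      have h4 : (1 - X) ^ 2 + X ≤ 1 := by nlinarith
      linarith [mul_le_mul_of_nonneg_left h4 h3]
  linarith

end Poincare

section BarrierPotential

open Filter Topology

variable {n : ℕ} {ι : Type*} [Fintype ι]

/-- A smooth barrier `exp (N (⟨x, u⟩ - h))` for the halfspace `⟨x, u⟩ ≤ h`. -/
def expTerm (N : ℝ) (u : Euc n) (h : ℝ) (x : Euc n) : ℝ := Real.exp (N * (⟪x, u⟫ - h))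

/-- The barrier of a finite family of halfspaces. -/
def barrier (N : ℝ) (u : ι → Euc n) (h : ι → ℝ) (x : Euc n) : ℝ := ∑ k, expTerm N (u k) (h k) x

/-- The Gaussian potential perturbed by a barrier, with a normalizing constant. -/
def barrierPot (N : ℝ) (u : ι → Euc n) (h : ι → ℝ) (C : ℝ) (x : Euc n) : ℝ :=
  ‖x‖ ^ 2 / 2 + barrier N u h x + C

variable {N : ℝ} {u : ι → Euc n} {h : ι → ℝ} {C : ℝ}

lemma expTerm_pos (N : ℝ) (w : Euc n) (a : ℝ) (x : Euc n) : 0 < expTerm N w a x := Real.exp_pos _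

lemma contDiff_expTerm (N : ℝ) (w : Euc n) (a : ℝ) : ContDiff ℝ ∞ (expTerm N w a) := by
  exact (contDiff_const.mul ((contDiff_id.inner ℝ contDiff_const).sub contDiff_const)).exp

lemma contDiff_barrierPot : ContDiff ℝ ∞ (barrierPot N u h C) := by
  have : ContDiff ℝ ∞ (barrier N u h) := ContDiff.sum fun k _ => contDiff_expTerm _ _ _
  exact (((contDiff_norm_sq ℝ).div_const 2).add this).add contDiff_const

lemma pd_expTerm (w : Euc n) (a : ℝ) (i : Fin n) (x : Euc n) :
    pd i (expTerm N w a) x = N * w i * expTerm N w a x := by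
  have hd : DifferentiableAt ℝ (fun y : Euc n => ⟪y, w⟫) x :=
    differentiableAt_id.inner ℝ (differentiableAt_const _)
  have h1 : HasDerivAt (fun t => Real.exp (N * (t - a))) (Real.exp (N * (⟪x, w⟫ - a)) * N) ⟪x, w⟫ := by
    have := (((hasDerivAt_id (⟪x, w⟫ : ℝ)).sub_const a).const_mul N).exp
    simpa using this
  have := pd_comp (f := fun y : Euc n => ⟪y, w⟫) i h1 hd
  rw [pd_inner] at this
  unfold expTerm
  rw [this]; ring

lemma barrierPot_eq (x : Euc n) :
    barrierPot N u h C x = ∑ i, (1 / 2 * (x i * x i)) + (∑ k, expTerm N (u k) (h k) x) + C := by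
  rw [barrierPot, barrier, EuclideanSpace.real_norm_sq_eq, Finset.sum_div]
  congr 3; ext i; ring

lemma pd_barrierPot (i : Fin n) :
    pd i (barrierPot N u h C) = fun x => x i + ∑ k, N * u k i * expTerm N (u k) (h k) x := by
  ext x
  have hc : ∀ j : Fin n, DifferentiableAt ℝ (fun y : Euc n => y j) x :=
    fun j => (contDiff_coord (k := 1) j).differentiable one_ne_zero x
  have he : ∀ k, DifferentiableAt ℝ (expTerm N (u k) (h k)) x :=
    fun k => (contDiff_expTerm _ _ _).differentiable (by simp) x
  have hq : ∀ j : Fin n, DifferentiableAt ℝ (fun y : Euc n => 1 / 2 * (y j * y j)) x :=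
    fun j => ((hc j).mul (hc j)).const_mul _
  have e : barrierPot N u h C = fun y =>
      ∑ i, (1 / 2 * (y i * y i)) + (∑ k, expTerm N (u k) (h k) y) + C :=
    funext barrierPot_eq
  rw [e, pd_add, pd_add, pd_sum _ _ fun j _ => hq j, pd_sum _ _ fun k _ => he k, pd_const]
  · have : ∀ j : Fin n, pd i (fun y : Euc n => 1 / 2 * (y j * y j)) x = if i = j then x j else 0 := by
      intro j
      rw [pd_const_mul i _ ((hc j).fun_mul (hc j)), pd_mul i (hc j) (hc j), pd_coord]
      split_ifs <;> ring
    simp only [this, pd_expTerm, Finset.sum_ite_eq, Finset.mem_univ, if_true, add_zero]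
  · exact DifferentiableAt.fun_sum fun j _ => hq j
  · exact DifferentiableAt.fun_sum fun k _ => he k
  · exact (DifferentiableAt.fun_sum fun j _ => hq j).add (DifferentiableAt.fun_sum fun k _ => he k)
  · exact differentiableAt_const _

lemma pd_pd_barrierPot (i j : Fin n) (x : Euc n) :
    pd j (pd i (barrierPot N u h C)) x
      = (if j = i then 1 else 0) + ∑ k, N ^ 2 * (u k i * u k j * expTerm N (u k) (h k) x) := by
  have he : ∀ k, DifferentiableAt ℝ (expTerm N (u k) (h k)) x :=
    fun k => (contDiff_expTerm _ _ _).differentiable (by simp) x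
  rw [pd_barrierPot, pd_add j ((contDiff_coord (k := 1) i).differentiable one_ne_zero x)
    (DifferentiableAt.fun_sum fun k _ => (he k).const_mul _), pd_coord,
    pd_sum _ _ fun k _ => (he k).const_mul _]
  congr 1
  refine Finset.sum_congr rfl fun k _ => ?_
  rw [pd_const_mul j _ (he k), pd_expTerm]; ring

lemma hessian_barrierPot (x : Euc n) (ξ : Fin n → ℝ) :
    ∑ j, ∑ i, pd j (pd i (barrierPot N u h C)) x * ξ i * ξ j
      = (∑ i, ξ i ^ 2) + N ^ 2 * ∑ k, expTerm N (u k) (h k) x * (∑ i, ξ i * u k i) ^ 2 := by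
  have h1 : ∀ i j, pd j (pd i (barrierPot N u h C)) x * ξ i * ξ j
      = (if j = i then ξ i * ξ j else 0)
        + ∑ k, N ^ 2 * (expTerm N (u k) (h k) x * ((ξ i * u k i) * (ξ j * u k j))) := by
    intro i j
    rw [pd_pd_barrierPot, add_mul, add_mul, Finset.sum_mul, Finset.sum_mul]
    congr 1
    · split_ifs <;> ring
    · exact Finset.sum_congr rfl fun k _ => by ring
  simp only [h1, Finset.sum_add_distrib, Finset.sum_ite_eq, Finset.mem_univ, if_true]
  congr 1
  · exact Finset.sum_congr rfl fun i _ => by ring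
  · simp_rw [Finset.sum_comm (s := (Finset.univ : Finset (Fin n))) (t := (Finset.univ : Finset ι))]
    rw [Finset.mul_sum]
    refine Finset.sum_congr rfl fun k _ => ?_
    rw [pow_two (∑ i, ξ i * u k i), Finset.sum_mul_sum, Finset.mul_sum, Finset.mul_sum, Finset.sum_comm]
    refine Finset.sum_congr rfl fun i _ => ?_
    rw [Finset.mul_sum, Finset.mul_sum]

lemma convex_barrierPot (x : Euc n) (ξ : Fin n → ℝ) :
    ∑ i, ξ i ^ 2 ≤ ∑ j, ∑ i, pd j (pd i (barrierPot N u h C)) x * ξ i * ξ j := by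
  rw [hessian_barrierPot]
  have : 0 ≤ ∑ k, expTerm N (u k) (h k) x * (∑ i, ξ i * u k i) ^ 2 :=
    Finset.sum_nonneg fun k _ => mul_nonneg (expTerm_pos _ _ _ _).le (sq_nonneg _)
  nlinarith [mul_nonneg (sq_nonneg N) this]

lemma expTerm_neg (w : Euc n) (a : ℝ) (x : Euc n) : expTerm N w a (-x) = expTerm N (-w) a x := by
  simp [expTerm]

lemma sum_expTerm_even (σ : Equiv.Perm ι) (hu : ∀ k, u (σ k) = -u k) (hh : ∀ k, h (σ k) = h k)
    {z : ι → ℝ} (hz : ∀ k, z (σ k) = z k) (x : Euc n) :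
    ∑ k, z k * expTerm N (u k) (h k) (-x) = ∑ k, z k * expTerm N (u k) (h k) x := by
  rw [← Equiv.sum_comp σ fun k => z k * expTerm N (u k) (h k) x]
  exact Finset.sum_congr rfl fun k _ => by rw [expTerm_neg, hu, hh, hz]

lemma barrierPot_even (σ : Equiv.Perm ι) (hu : ∀ k, u (σ k) = -u k) (hh : ∀ k, h (σ k) = h k)
    (x : Euc n) : barrierPot N u h C (-x) = barrierPot N u h C x := by
  have := sum_expTerm_even (N := N) σ hu hh (z := fun _ => 1) (fun _ => rfl) x
  simp only [one_mul] at this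
  rw [barrierPot, barrierPot, barrier, barrier, norm_neg, this]

lemma integrable_exp_neg_norm_sq {b : ℝ} (hb : 0 < b) :
    Integrable fun x : Euc n => Real.exp (-b * ‖x‖ ^ 2) := by
  have := (GaussianFourier.integrable_cexp_neg_mul_sq_norm_add (V := Euc n) (b := (b : ℂ))
    (by simpa using hb) 0 0).norm
  refine this.congr (Eventually.of_forall fun x => ?_)
  simp only [Complex.norm_exp]
  congr 1
  simp [← Complex.ofReal_pow]

lemma continuous_barrierPot : Continuous (barrierPot N u h C) := contDiff_barrierPot.continuous

lemma barrier_nonneg (x : Euc n) : 0 ≤ barrier N u h x :=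
  Finset.sum_nonneg fun _ _ => (expTerm_pos _ _ _ _).le

lemma exp_neg_barrierPot (x : Euc n) : Real.exp (-barrierPot N u h C x)
    = Real.exp (-C) * (Real.exp (-(1 / 2) * ‖x‖ ^ 2) * Real.exp (-barrier N u h x)) := by
  rw [barrierPot, ← Real.exp_add, ← Real.exp_add]; congr 1; ring

lemma memLp_coord (i : Fin n) :
    MemLp (fun x : Euc n => x i) 2 (wMeasure (barrierPot N u h C)) := by
  have hc : Continuous fun x : Euc n => x i := (contDiff_coord (k := 0) i).continuous
  rw [memLp_two_iff_integrable_sq hc.aestronglyMeasurable, integrable_wMeasure continuous_barrierPot]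
  refine ((integrable_exp_neg_norm_sq (n := n) (b := 1 / 4) (by norm_num)).const_mul
    (4 * Real.exp (-C))).mono' (((continuous_barrierPot.neg.rexp).mul
      (hc.pow 2)).aestronglyMeasurable) (Eventually.of_forall fun x => ?_)
  rw [Real.norm_of_nonneg (by positivity), exp_neg_barrierPot]
  have h1 : Real.exp (-barrier N u h x) ≤ 1 := Real.exp_le_one_iff.2 (by linarith [barrier_nonneg (N := N) (u := u) (h := h) x])
  have h2 : x i ^ 2 ≤ ‖x‖ ^ 2 := by
    rw [EuclideanSpace.real_norm_sq_eq]
    exact Finset.single_le_sum (f := fun j => x j ^ 2) (fun j _ => sq_nonneg _) (Finset.mem_univ i)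
  have h3 : ‖x‖ ^ 2 ≤ 4 * Real.exp (1 / 4 * ‖x‖ ^ 2) := by
    linarith [Real.add_one_le_exp (1 / 4 * ‖x‖ ^ 2)]
  have h4 : Real.exp (-(1 / 2) * ‖x‖ ^ 2) * Real.exp (1 / 4 * ‖x‖ ^ 2)
      = Real.exp (-(1 / 4) * ‖x‖ ^ 2) := by rw [← Real.exp_add]; congr 1; ring
  calc Real.exp (-C) * (Real.exp (-(1 / 2) * ‖x‖ ^ 2) * Real.exp (-barrier N u h x)) * x i ^ 2
      ≤ Real.exp (-C) * (Real.exp (-(1 / 2) * ‖x‖ ^ 2) * 1) * (4 * Real.exp (1 / 4 * ‖x‖ ^ 2)) := by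
        have := h2.trans h3
        gcongr
    _ = 4 * Real.exp (-C) * (Real.exp (-(1 / 2) * ‖x‖ ^ 2) * Real.exp (1 / 4 * ‖x‖ ^ 2)) := by ring
    _ = _ := by rw [h4]

lemma memLp_expTerm (k : ι) :
    MemLp (expTerm N (u k) (h k)) 2 (wMeasure (barrierPot N u h C)) := by
  have hc : Continuous (expTerm N (u k) (h k)) := (contDiff_expTerm _ _ _).continuous
  rw [memLp_two_iff_integrable_sq hc.aestronglyMeasurable, integrable_wMeasure continuous_barrierPot]
  refine ((integrable_exp_neg_norm_sq (n := n) (b := 1 / 2) (by norm_num)).const_mul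
    (2 * Real.exp (-C))).mono' (((continuous_barrierPot.neg.rexp).mul
      (hc.pow 2)).aestronglyMeasurable) (Eventually.of_forall fun x => ?_)
  rw [Real.norm_of_nonneg (by positivity), exp_neg_barrierPot]
  have h0 := (expTerm_pos N (u k) (h k) x).le
  have h1 : expTerm N (u k) (h k) x ≤ barrier N u h x :=
    Finset.single_le_sum (f := fun k => expTerm N (u k) (h k) x)
      (fun j _ => (expTerm_pos _ _ _ _).le) (Finset.mem_univ k)
  have h2 : expTerm N (u k) (h k) x ^ 2 ≤ 2 * Real.exp (barrier N u h x) := by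
    have := Real.quadratic_le_exp_of_nonneg (barrier_nonneg (N := N) (u := u) (h := h) x)
    have := barrier_nonneg (N := N) (u := u) (h := h) x
    nlinarith
  have h4 : Real.exp (-barrier N u h x) * Real.exp (barrier N u h x) = 1 := by
    rw [← Real.exp_add]; simp
  calc Real.exp (-C) * (Real.exp (-(1 / 2) * ‖x‖ ^ 2) * Real.exp (-barrier N u h x))
        * expTerm N (u k) (h k) x ^ 2
      ≤ Real.exp (-C) * (Real.exp (-(1 / 2) * ‖x‖ ^ 2) * Real.exp (-barrier N u h x))
        * (2 * Real.exp (barrier N u h x)) := by gcongr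
    _ = 2 * Real.exp (-C) * Real.exp (-(1 / 2) * ‖x‖ ^ 2)
        * (Real.exp (-barrier N u h x) * Real.exp (barrier N u h x)) := by ring
    _ = _ := by rw [h4]; ring

lemma integral_barrier_le [IsProbabilityMeasure (wMeasure (barrierPot N u h C))] (hN : 0 < N)
    {r : ℝ} (hr : ∀ k, r ≤ h k) :
    N * r * ∫ x, barrier N u h x ∂wMeasure (barrierPot N u h C) ≤ n + Fintype.card ι := by
  set μ := wMeasure (barrierPot N u h C)
  have hx := fun i => memLp_coord (N := N) (u := u) (h := h) (C := C) i
  have hρ := fun k => memLp_expTerm (N := N) (u := u) (h := h) (C := C) k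
  have iρ : ∀ k, Integrable (expTerm N (u k) (h k)) μ := fun k => (hρ k).integrable (by norm_num)
  have ixρ : ∀ i k, Integrable (fun x : Euc n => x i * expTerm N (u k) (h k) x) μ :=
    fun i k => (hx i).integrable_mul (hρ k)
  have h1 : ∀ i : Fin n, 1 = ∫ x, (x i ^ 2 + ∑ k, N * u k i * (x i * expTerm N (u k) (h k) x)) ∂μ := by
    intro i
    have hpc : pd i (fun x : Euc n => x i) = fun _ => 1 := funext fun x => by rw [pd_coord]; simp
    have e : (fun x : Euc n => x i * pd i (barrierPot N u h C) x)
        = fun x => x i ^ 2 + ∑ k, N * u k i * (x i * expTerm N (u k) (h k) x) := by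
      ext x
      rw [pd_barrierPot, mul_add, Finset.mul_sum]
      congr 1
      · ring
      · exact Finset.sum_congr rfl fun k _ => by ring
    have := integral_divergence (W := barrierPot N u h C) (contDiff_infty.1 contDiff_barrierPot 1)
      (contDiff_coord (k := 1) i) i ((hx i).integrable (by norm_num))
      (by rw [hpc]; exact integrable_const _) (by
        rw [e]
        exact (hx i).integrable_sq.add (integrable_finsetSum _ fun k _ => (ixρ i k).const_mul _))
    rw [hpc, e] at this
    rw [← this]; simp
  have h2 : (n : ℝ) = ∑ i : Fin n, ∫ x, (x i ^ 2 + ∑ k, N * u k i * (x i * expTerm N (u k) (h k) x)) ∂μ := by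
    rw [← Finset.sum_congr rfl fun i _ => h1 i]; simp
  have i3 : ∀ i : Fin n, Integrable
      (fun x : Euc n => x i ^ 2 + ∑ k, N * u k i * (x i * expTerm N (u k) (h k) x)) μ := fun i =>
    (hx i).integrable_sq.add (integrable_finsetSum _ fun k _ => (ixρ i k).const_mul _)
  rw [← integral_finsetSum _ fun i _ => i3 i] at h2
  have ib : Integrable (barrier N u h) μ := integrable_finsetSum _ fun k _ => iρ k
  have h4 : ∫ x, (N * r * barrier N u h x - Fintype.card ι) ∂μ
      ≤ ∫ x : Euc n, ∑ i, (x i ^ 2 + ∑ k, N * u k i * (x i * expTerm N (u k) (h k) x)) ∂μ := by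
    refine integral_mono ((ib.const_mul _).sub (integrable_const _))
      (integrable_finsetSum _ fun i _ => i3 i) fun x => ?_
    have e : ∑ i, (x i ^ 2 + ∑ k, N * u k i * (x i * expTerm N (u k) (h k) x))
        = (∑ i, x i ^ 2) + ∑ k, N * ⟪x, u k⟫ * expTerm N (u k) (h k) x := by
      rw [Finset.sum_add_distrib, Finset.sum_comm]
      congr 1
      refine Finset.sum_congr rfl fun k _ => ?_
      rw [PiLp.inner_apply, Finset.mul_sum, Finset.sum_mul]
      refine Finset.sum_congr rfl fun i _ => ?_
      simp; ring
    simp only [e]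
    have h5 : ∀ k, N * r * expTerm N (u k) (h k) x - 1 ≤ N * ⟪x, u k⟫ * expTerm N (u k) (h k) x := by
      intro k
      have hy : -1 ≤ N * (⟪x, u k⟫ - h k) * expTerm N (u k) (h k) x := by
        rw [expTerm]
        set y := N * (⟪x, u k⟫ - h k)
        have a1 := Real.add_one_le_exp (-y)
        have a2 : Real.exp (-y) * Real.exp y = 1 := by rw [← Real.exp_add]; simp
        nlinarith [Real.exp_pos y]
      have : N * r * expTerm N (u k) (h k) x ≤ N * h k * expTerm N (u k) (h k) x := by
        have := hr k
        have := (expTerm_pos N (u k) (h k) x).le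
        gcongr
      linarith
    have h6 := Finset.sum_le_sum fun k (_ : k ∈ Finset.univ) => h5 k
    rw [Finset.sum_sub_distrib, ← Finset.mul_sum] at h6
    have h7 : 0 ≤ ∑ i, x i ^ 2 := by positivity
    simp only [Finset.sum_const, Finset.card_univ, nsmul_eq_mul, mul_one] at h6
    rw [barrier]
    linarith
  rw [integral_sub (ib.const_mul _) (integrable_const _), integral_const_mul, ← h2] at h4
  simp at h4
  linarith

end BarrierPotential

section SecondVariation

open Filter Topology

lemma barrier_term_le {m c z s α A Z : ℝ} (hm : 0 ≤ m) (hc : 0 ≤ c) (hz : 0 ≤ z) (hzZ : z ≤ Z)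
    (hα : s ≤ α) :
    c * A * (m * z - m * c * s) - 1 / 2 * (c ^ 2 * A ^ 2 + Z ^ 2)
      ≤ m * (m - 1) * z ^ 2 - 2 * (m * (c * m) * (z * s)) + (c * m) ^ 2 * s ^ 2
        + c * (m * (α * z)) := by
  have h1 : 0 ≤ m * (c * z * (α - s)) :=
    mul_nonneg hm (mul_nonneg (mul_nonneg hc hz) (sub_nonneg.2 hα))
  have h2 : 0 ≤ (m * (z - c * s) - c * A) ^ 2 := sq_nonneg _
  have h3 : 0 ≤ (m * (z - c * s) - z) ^ 2 := sq_nonneg _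
  have h4 : z ^ 2 ≤ Z ^ 2 := by nlinarith
  nlinarith

lemma stability_budget {c s a b A ε E m C Z : ℝ} (hc : 0 < c)
    (hcs : c * (s + 1) ≤ 8 / 5) (hb : 0 ≤ b) (hA0 : 0 ≤ A)
    (hA : A ^ 2 = a ^ 2 + ε ^ 2) (hE : E ≤ C / m) (hm : 0 < m) (hmC : 5 * c ^ 2 * C ≤ m) :
    -b ^ 2 - a ^ 2 + ε ^ 2 + c * (a * b + A * ε) + c * A * (s * b)
        + 1 / 2 * (c ^ 2 * A ^ 2 + Z ^ 2) * E
      ≤ (2 + 5 / 2 * c ^ 2) * ε ^ 2 + 1 / 2 * Z ^ 2 * (C / m) := by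
  have haA : a ≤ A := by nlinarith
  have h1 : c * (a * b) + c * A * (s * b) ≤ 8 / 5 * (A * b) := by
    have h11 : c * (a * b) ≤ c * (A * b) := by gcongr
    have h12 : c * (s + 1) * (A * b) ≤ 8 / 5 * (A * b) := by gcongr
    nlinarith
  have h2 : 8 / 5 * (A * b) ≤ 4 / 5 * A ^ 2 + 4 / 5 * b ^ 2 := by nlinarith [sq_nonneg (A - b)]
  have h3 : c * (A * ε) ≤ 1 / 10 * A ^ 2 + 5 / 2 * c ^ 2 * ε ^ 2 := by
    nlinarith [sq_nonneg (A - 5 * (c * ε))]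
  have h4 : 1 / 2 * (c ^ 2 * A ^ 2) * E ≤ 1 / 10 * A ^ 2 := by
    have h41 : c ^ 2 * (C / m) ≤ 1 / 5 := by
      rw [← mul_div_assoc, div_le_iff₀ hm]; linarith
    have h42 : c ^ 2 * E ≤ 1 / 5 := le_trans (by gcongr) h41
    nlinarith [mul_le_mul_of_nonneg_left h42 (sq_nonneg A)]
  have h5 : 1 / 2 * Z ^ 2 * E ≤ 1 / 2 * Z ^ 2 * (C / m) := by gcongr
  nlinarith [sq_nonneg b]

lemma sq_sum_sum_mul_le {n : ℕ} (v : Fin n → ℝ) (H : Fin n → Fin n → ℝ) :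
    (∑ i, (∑ j, H i j * v j) * v i) ^ 2 ≤ (∑ i, ∑ j, H i j ^ 2) * (∑ i, v i ^ 2) ^ 2 := by
  calc (∑ i, (∑ j, H i j * v j) * v i) ^ 2
      ≤ (∑ i, (∑ j, H i j * v j) ^ 2) * ∑ i, v i ^ 2 := Finset.sum_mul_sq_le_sq_mul_sq _ _ _
    _ ≤ (∑ i, (∑ j, H i j ^ 2) * ∑ j, v j ^ 2) * ∑ i, v i ^ 2 := by
        gcongr with i
        exact Finset.sum_mul_sq_le_sq_mul_sq _ _ _
    _ = _ := by rw [← Finset.sum_mul]; ring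

/-- The regularized length of a gradient. -/
def regNorm {n : ℕ} (w : Euc n → ℝ) (ε : ℝ) (x : Euc n) : ℝ :=
  Real.sqrt ((∑ i, pd i w x ^ 2) + ε ^ 2)

variable {n : ℕ} {w : Euc n → ℝ} {ε : ℝ}

lemma regNorm_sq (x : Euc n) : regNorm w ε x ^ 2 = (∑ i, pd i w x ^ 2) + ε ^ 2 :=
  Real.sq_sqrt (by positivity)

lemma regNorm_pos (hε : 0 < ε) (x : Euc n) : 0 < regNorm w ε x :=
  Real.sqrt_pos.2 (by positivity)

lemma contDiff_regNorm (hε : 0 < ε) (hw : IsTest w) : ContDiff ℝ ∞ (regNorm w ε) := by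
  refine ContDiff.sqrt ?_ fun x => by positivity
  exact (ContDiff.sum fun i _ => (hw.pd i).1.pow 2).add contDiff_const

lemma pd_regNorm (hε : 0 < ε) (hw : IsTest w) (i : Fin n) (x : Euc n) :
    pd i (regNorm w ε) x = (∑ j, pd i (pd j w) x * pd j w x) / regNorm w ε x := by
  have hd : ∀ j, DifferentiableAt ℝ (pd j w) x := fun j => (hw.pd j).differentiable x
  have hsq : ∀ j, DifferentiableAt ℝ (fun y => pd j w y * pd j w y) x :=
    fun j => (hd j).mul (hd j)
  have e : regNorm w ε = fun y => Real.sqrt ((∑ j, pd j w y * pd j w y) + ε ^ 2) := by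
    ext y; rw [regNorm]; congr 2
    exact Finset.sum_congr rfl fun j _ => by ring
  have hpos : (∑ j, pd j w x * pd j w x) + ε ^ 2 ≠ 0 := by
    have : 0 ≤ ∑ j, pd j w x * pd j w x := Finset.sum_nonneg fun j _ => mul_self_nonneg _
    positivity
  have h1 := pd_comp (f := fun y => (∑ j, pd j w y * pd j w y) + ε ^ 2) i
    (Real.hasDerivAt_sqrt hpos)
    ((DifferentiableAt.fun_sum fun j _ => hsq j).add_const _)
  rw [pd_add i (DifferentiableAt.fun_sum fun j _ => hsq j) (differentiableAt_const _), pd_const,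
    pd_sum _ _ fun j _ => hsq j] at h1
  rw [e, h1]
  simp only [pd_mul i (hd _) (hd _), add_zero]
  rw [Finset.sum_add_distrib, div_mul_eq_mul_div, one_mul,
    show ∑ j, pd j w x * pd i (pd j w) x = ∑ j, pd i (pd j w) x * pd j w x from
      Finset.sum_congr rfl fun j _ => mul_comm _ _]
  rw [← two_mul, mul_div_mul_left _ _ two_ne_zero]

lemma regNorm_memLp (hε : 0 < ε) (hw : IsTest w) {W : Euc n → ℝ} [IsProbabilityMeasure (wMeasure W)] :
    MemLp (regNorm w ε) 2 (wMeasure W) := by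
  have hc := (contDiff_regNorm hε hw).continuous
  rw [memLp_two_iff_integrable_sq hc.aestronglyMeasurable]
  simp only [regNorm_sq]
  exact (integrable_finsetSum _ fun i _ => (hw.pd i).memLp_wMeasure.integrable_sq).add
    (integrable_const _)

/-- The derivative of the regularized gradient length along the gradient flow. -/
lemma integral_pd_regNorm_le (hε : 0 < ε) (hw : IsTest w) {W : Euc n → ℝ}
    [IsProbabilityMeasure (wMeasure W)] :
    ∫ x, ∑ i, pd i (regNorm w ε) x * pd i w x ∂wMeasure W
      ≤ Real.sqrt (∫ x, ∑ i, pd i w x ^ 2 ∂wMeasure W)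
        * Real.sqrt (∫ x, ∑ j, ∑ i, pd i (pd j w) x ^ 2 ∂wMeasure W) := by
  set f : Euc n → ℝ := fun x => Real.sqrt (∑ i, pd i w x ^ 2) with hf
  set g : Euc n → ℝ := fun x => Real.sqrt (∑ j, ∑ i, pd i (pd j w) x ^ 2) with hg
  have hfc : Continuous f := (continuous_finsetSum _ fun i _ => (hw.pd i).continuous.pow 2).sqrt
  have hgc : Continuous g := (continuous_finsetSum _ fun j _ => continuous_finsetSum _ fun i _ =>
    ((hw.pd j).pd i).continuous.pow 2).sqrt
  have hf2 : ∀ x, f x ^ 2 = ∑ i, pd i w x ^ 2 := fun x => Real.sq_sqrt (by positivity)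
  have hg2 : ∀ x, g x ^ 2 = ∑ j, ∑ i, pd i (pd j w) x ^ 2 := fun x => Real.sq_sqrt (by positivity)
  have hfm : MemLp f 2 (wMeasure W) := by
    rw [memLp_two_iff_integrable_sq hfc.aestronglyMeasurable]
    simp only [hf2]
    exact integrable_finsetSum _ fun i _ => (hw.pd i).memLp_wMeasure.integrable_sq
  have hgm : MemLp g 2 (wMeasure W) := by
    rw [memLp_two_iff_integrable_sq hgc.aestronglyMeasurable]
    simp only [hg2]
    exact integrable_finsetSum _ fun j _ => integrable_finsetSum _ fun i _ =>
      ((hw.pd j).pd i).memLp_wMeasure.integrable_sq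
  have h1 := sq_integral_mul_le hfm hgm
  simp only [hf2, hg2] at h1
  have h2 : ∫ x, f x * g x ∂wMeasure W ≤ Real.sqrt (∫ x, ∑ i, pd i w x ^ 2 ∂wMeasure W)
        * Real.sqrt (∫ x, ∑ j, ∑ i, pd i (pd j w) x ^ 2 ∂wMeasure W) := by
    rw [← Real.sqrt_mul (integral_nonneg fun x => by positivity)]
    exact Real.le_sqrt_of_sq_le h1
  refine le_trans ?_ h2
  refine integral_mono (integrable_finsetSum _ fun i _ =>
    (hw.pd i).integrable_mul (continuous_pd i (contDiff_infty.1 (contDiff_regNorm hε hw) 1)))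
    (hfm.integrable_mul hgm) fun x => ?_
  have hα := regNorm_pos (w := w) hε x
  have e : ∑ i, pd i (regNorm w ε) x * pd i w x
      = (∑ i, (∑ j, pd i (pd j w) x * pd j w x) * pd i w x) / regNorm w ε x := by
    rw [Finset.sum_div]
    refine Finset.sum_congr rfl fun i _ => ?_
    rw [pd_regNorm hε hw]; ring
  simp only [e]
  rw [div_le_iff₀ hα]
  have h3 := sq_sum_sum_mul_le (fun i => pd i w x) fun i j => pd i (pd j w) x
  rw [Finset.sum_comm (f := fun i j => pd i (pd j w) x ^ 2), ← hf2, ← hg2] at h3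
  have hf0 : 0 ≤ f x := Real.sqrt_nonneg _
  have hg0 : 0 ≤ g x := Real.sqrt_nonneg _
  have h4 : ∑ i, (∑ j, pd i (pd j w) x * pd j w x) * pd i w x ≤ g x * f x ^ 2 := by
    refine (abs_le_of_sq_le_sq' ?_ (by positivity)).2
    calc _ ≤ _ := h3
      _ = _ := by ring
  have h5 : f x ≤ regNorm w ε x := Real.sqrt_le_sqrt (by nlinarith)
  calc _ ≤ g x * f x ^ 2 := h4
    _ = f x * g x * f x := by ring
    _ ≤ f x * g x * regNorm w ε x := by gcongr

end SecondVariation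

section SecondVariationMain

open Filter Topology

variable {n : ℕ} {ι : Type*} [Fintype ι] {u : ι → Euc n} {h z : ι → ℝ} {c m C₀ : ℝ}

/-- The flux of an even test potential through the barrier is controlled by its Hessian. -/
lemma integral_barrier_flux_le {N : ℝ} [IsProbabilityMeasure (wMeasure (barrierPot N u h C₀))]
    (hWe : ∀ x, barrierPot N u h C₀ (-x) = barrierPot N u h C₀ x)
    {w : Euc n → ℝ} (hw : IsTest w) (hwe : ∀ x, w (-x) = w x) :
    ∫ x, N * ∑ k, expTerm N (u k) (h k) x * (∑ i, pd i w x * u k i)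
        ∂wMeasure (barrierPot N u h C₀)
      ≤ Real.sqrt n * Real.sqrt
        (∫ x, ∑ j, ∑ i, pd i (pd j w) x ^ 2 ∂wMeasure (barrierPot N u h C₀)) := by
  set W := barrierPot N u h C₀ with hWdef
  have hW : ContDiff ℝ ∞ W := contDiff_barrierPot
  set κ : Fin n → ℝ := fun i => ∫ x, (pd i (pd i w) x - x i * pd i w x) ∂wMeasure W with hκ
  set B : Fin n → ℝ := fun i => ∫ x, ∑ j, pd j (pd i w) x ^ 2 ∂wMeasure W with hB
  have hx := fun i => memLp_coord (N := N) (u := u) (h := h) (C := C₀) i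
  have hκB : ∀ i, κ i ^ 2 ≤ B i := fun i =>
    sq_integral_gaussDiv_le hW hWe convex_barrierPot i (hx i) (hw.pd i)
      (fun x => pd_of_even hw.differentiable hwe i x)
  have ixv : ∀ i, Integrable (fun x : Euc n => x i * pd i w x) (wMeasure W) := fun i =>
    (hw.pd i).integrable_mul (contDiff_coord (k := 0) i).continuous
  have e1 : ∫ x, N * ∑ k, expTerm N (u k) (h k) x * (∑ i, pd i w x * u k i) ∂wMeasure W
      = ∑ i, κ i := by
    have h1 : ∀ i, κ i = ∫ x, (pd i w x * pd i W x - x i * pd i w x) ∂wMeasure W := by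
      intro i
      have i2 : Integrable (fun x => pd i w x * pd i W x) (wMeasure W) := by
        simpa only [mul_comm] using (hw.pd i).integrable_mul (contDiff_infty_pd i hW).continuous
      rw [hκ]; simp only
      rw [integral_sub ((hw.pd i).pd i).integrable (ixv i), integral_sub i2 (ixv i),
        integral_divergence (contDiff_infty.1 hW 1) (hw.pd i).contDiff_one i (hw.pd i).integrable
          ((hw.pd i).pd i).integrable i2]
    have i3 : ∀ i, Integrable (fun x => pd i w x * pd i W x - x i * pd i w x) (wMeasure W) := by
      intro i
      refine Integrable.sub' ?_ (ixv i)
      simpa only [mul_comm] using (hw.pd i).integrable_mul (contDiff_infty_pd i hW).continuous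
    simp only [h1]
    rw [← integral_finsetSum _ fun i _ => i3 i]
    congr 1; ext x
    simp only [hWdef, pd_barrierPot, Finset.mul_sum]
    rw [Finset.sum_comm]
    refine Finset.sum_congr rfl fun i _ => ?_
    rw [mul_add, Finset.mul_sum]
    rw [show pd i w x * x i = x i * pd i w x from mul_comm _ _, add_sub_cancel_left]
    exact Finset.sum_congr rfl fun k _ => by ring
  have e2 : ∫ x, ∑ j, ∑ i, pd i (pd j w) x ^ 2 ∂wMeasure W = ∑ i, B i := by
    rw [hB, integral_finsetSum]
    exact fun j _ => integrable_finsetSum _ fun i _ =>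
      ((hw.pd j).pd i).memLp_wMeasure.integrable_sq
  rw [e1, e2, ← Real.sqrt_mul (Nat.cast_nonneg n)]
  refine Real.le_sqrt_of_sq_le ?_
  calc (∑ i, κ i) ^ 2 ≤ n * ∑ i, κ i ^ 2 := by
        simpa using sq_sum_le_card_mul_sum_sq (s := (Finset.univ : Finset (Fin n))) (f := κ)
    _ ≤ n * ∑ i, B i := by
        gcongr with i
        exact hκB i

lemma sum_mul_le_regNorm {w : Euc n → ℝ} {v : Euc n} (hv : ‖v‖ = 1) (ε : ℝ) (x : Euc n) :
    ∑ i, pd i w x * v i ≤ regNorm w ε x := by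
  refine Real.le_sqrt_of_sq_le ?_
  have h1 := Finset.sum_mul_sq_le_sq_mul_sq Finset.univ (fun i => pd i w x) fun i => v i
  have h2 : ∑ i, v i ^ 2 = 1 := by rw [← EuclideanSpace.real_norm_sq_eq, hv, one_pow]
  rw [h2, mul_one] at h1
  nlinarith

/-- Second variation of the logarithm of the Gaussian mass of a softened polytope. -/
theorem second_variation_le (σ : Equiv.Perm ι) (husym : ∀ k, u (σ k) = -u k)
    (hhsym : ∀ k, h (σ k) = h k) (hzsym : ∀ k, z (σ k) = z k) (hu1 : ∀ k, ‖u k‖ = 1)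
    {r Z : ℝ} (hr : 0 < r) (hrh : ∀ k, r ≤ h k) (hz : ∀ k, 0 ≤ z k) (hzZ : ∀ k, z k ≤ Z)
    (hc : 0 < c) (hcs : c * (Real.sqrt n + 1) ≤ 8 / 5) (hm : 0 < m)
    (hmC : 5 * c ^ 2 * ((n + Fintype.card ι) / (c * r)) ≤ m)
    [IsProbabilityMeasure (wMeasure (barrierPot (c * m) u h C₀))] :
    (∫ x, (m * ∑ k, z k * expTerm (c * m) (u k) (h k) x) ^ 2
        ∂wMeasure (barrierPot (c * m) u h C₀))
      - (∫ x, m * ∑ k, z k * expTerm (c * m) (u k) (h k) x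
        ∂wMeasure (barrierPot (c * m) u h C₀)) ^ 2
      - (∫ x, m * (m - 1) * ∑ k, z k ^ 2 * expTerm (c * m) (u k) (h k) x
        ∂wMeasure (barrierPot (c * m) u h C₀))
      ≤ 1 / 2 * Z ^ 2 * ((n + Fintype.card ι) / (c * r) / m) := by
  set N := c * m with hN
  have hN0 : 0 < N := mul_pos hc hm
  set W := barrierPot N u h C₀ with hWdef
  have hW : ContDiff ℝ ∞ W := contDiff_barrierPot
  have hWe : ∀ x, W (-x) = W x := barrierPot_even σ husym hhsym
  set ρ : ι → Euc n → ℝ := fun k => expTerm N (u k) (h k) with hρdef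
  have hρ0 : ∀ k x, 0 < ρ k x := fun k x => expTerm_pos _ _ _ _
  have hρc : ∀ k, ContDiff ℝ ∞ (ρ k) := fun k => contDiff_expTerm _ _ _
  have hρ : ∀ k, MemLp (ρ k) 2 (wMeasure W) := fun k => memLp_expTerm k
  have iρ : ∀ k, Integrable (ρ k) (wMeasure W) := fun k => (hρ k).integrable (by norm_num)
  set S : Euc n → ℝ := fun x => m * ∑ k, z k * ρ k x with hS
  have hSc : ContDiff ℝ ∞ S := contDiff_const.mul (ContDiff.sum fun k _ => contDiff_const.mul (hρc k))
  have hSm : MemLp S 2 (wMeasure W) :=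
    (memLp_finsetSum _ fun k _ => (hρ k).const_mul (z k)).const_mul m
  have iS : Integrable S (wMeasure W) := hSm.integrable (by norm_num)
  set k₀ := ∫ x, S x ∂wMeasure W with hk₀
  have hk₀0 : 0 ≤ k₀ := integral_nonneg fun x => mul_nonneg hm.le
    (Finset.sum_nonneg fun k _ => mul_nonneg (hz k) (hρ0 k x).le)
  set ψ : Euc n → ℝ := fun x => k₀ - S x with hψ
  have hψm : MemLp ψ 2 (wMeasure W) := (memLp_const k₀).sub hSm
  have hψc : ContDiff ℝ ∞ ψ := contDiff_const.sub hSc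
  have hψ0 : ∫ x, ψ x ∂wMeasure W = 0 := by
    rw [hψ, integral_sub (integrable_const _) iS]; simp [← hk₀]
  have hψe : ∀ x, ψ (-x) = ψ x := fun x => by
    simp only [hψ, hS, hρdef, sum_expTerm_even σ husym hhsym hzsym]
  have hpψ : ∀ i x, pd i ψ x = -(m * N * ∑ k, z k * u k i * ρ k x) := by
    intro i x
    have hd : ∀ k, DifferentiableAt ℝ (ρ k) x := fun k => (hρc k).differentiable (by simp) x
    have hds : DifferentiableAt ℝ (fun x => ∑ k, z k * ρ k x) x :=
      DifferentiableAt.fun_sum fun k _ => (hd k).const_mul _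
    rw [hψ, pd_sub i (differentiableAt_const _) (hds.const_mul m), pd_const,
      pd_const_mul i m hds, pd_sum _ _ fun k _ => (hd k).const_mul _, zero_sub, mul_assoc,
      Finset.mul_sum _ _ N]
    refine congrArg (fun y => -(m * y)) ?_
    refine Finset.sum_congr rfl fun k _ => ?_
    rw [pd_const_mul i _ (hd k), hρdef]; simp only [pd_expTerm]; ring
  set E := ∫ x, barrier N u h x ∂wMeasure W with hE
  have ib : Integrable (barrier N u h) (wMeasure W) := integrable_finsetSum _ fun k _ => iρ k
  have hE_le : E ≤ (n + Fintype.card ι) / (c * r) / m := by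
    have := integral_barrier_le (C := C₀) (u := u) hN0 hrh
    rw [div_div, le_div_iff₀ (by positivity)]
    calc E * (c * r * m) = N * r * E := by rw [hN]; ring
      _ ≤ _ := this
  have hvar : (∫ x, S x ^ 2 ∂wMeasure W) - k₀ ^ 2 = ∫ x, ψ x ^ 2 ∂wMeasure W := by
    have e : ∀ x, ψ x ^ 2 = S x ^ 2 - (2 * k₀ * S x - k₀ ^ 2) := fun x => by
      simp only [hψ]; ring
    simp only [e]
    rw [integral_sub hSm.integrable_sq ((iS.const_mul _).sub' (integrable_const _)),
      integral_sub (iS.const_mul _) (integrable_const _), integral_const_mul]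
    simp [← hk₀]; ring
  set P := ∫ x, m * (m - 1) * ∑ k, z k ^ 2 * ρ k x ∂wMeasure W with hP
  have iP : Integrable (fun x => m * (m - 1) * ∑ k, z k ^ 2 * ρ k x) (wMeasure W) :=
    (integrable_finsetSum _ fun k _ => (iρ k).const_mul _).const_mul _
  rw [hvar]
  have main : ∀ ε : ℝ, 0 < ε → (∫ x, ψ x ^ 2 ∂wMeasure W) - P
      ≤ (2 + 5 / 2 * c ^ 2) * ε ^ 2
        + 1 / 2 * Z ^ 2 * ((n + Fintype.card ι) / (c * r) / m) := by
    intro ε hε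
    obtain ⟨w, hw, hwe, hlt⟩ := exists_even_wLap_approx hW hWe hψm hψ0 hψe (pow_pos hε 2)
    have hL := hw.wLap hW
    have hLm : MemLp (wLap W w) 2 (wMeasure W) := hL.memLp_wMeasure
    set s : ι → Euc n → ℝ := fun k x => ∑ i, pd i w x * u k i with hs
    have hst : ∀ k, IsTest (s k) := fun k => IsTest.sum fun i _ => by
      simpa only [mul_comm] using (hw.pd i).const_mul (u k i)
    set a2 := ∫ x, ∑ i, pd i w x ^ 2 ∂wMeasure W with ha2
    set b2 := ∫ x, ∑ j, ∑ i, pd i (pd j w) x ^ 2 ∂wMeasure W with hb2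
    have ha20 : 0 ≤ a2 := integral_nonneg fun x => by positivity
    have hb20 : 0 ≤ b2 := integral_nonneg fun x => by positivity
    have ia : Integrable (fun x => ∑ i, pd i w x ^ 2) (wMeasure W) :=
      integrable_finsetSum _ fun i _ => (hw.pd i).memLp_wMeasure.integrable_sq
    set α := regNorm w ε with hα
    have hαm : MemLp α 2 (wMeasure W) := regNorm_memLp hε hw
    have hαc := contDiff_regNorm hε hw
    set A := Real.sqrt (a2 + ε ^ 2) with hA
    have hA2 : A ^ 2 = a2 + ε ^ 2 := Real.sq_sqrt (by positivity)
    have hα2 : ∫ x, α x ^ 2 ∂wMeasure W = A ^ 2 := by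
      simp only [hα, regNorm_sq]
      rw [integral_add ia (integrable_const _), hA2]; simp [ha2]
    -- the quadratic form of the barrier
    have iQk : ∀ k, Integrable (fun x => ρ k x * s k x ^ 2) (wMeasure W) := fun k => by
      have := (hst k).integrable_mul (W := W) ((hρc k).continuous.mul (hst k).continuous)
      refine this.congr (Eventually.of_forall fun x => ?_)
      simp only [Pi.mul_apply]; ring
    have iGk : ∀ k, Integrable (fun x => ρ k x * s k x) (wMeasure W) := fun k =>
      (hst k).integrable_mul (hρc k).continuous
    set Q := ∫ x, N ^ 2 * ∑ k, ρ k x * s k x ^ 2 ∂wMeasure W with hQ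
    have iQ : Integrable (fun x => N ^ 2 * ∑ k, ρ k x * s k x ^ 2) (wMeasure W) :=
      (integrable_finsetSum _ fun k _ => iQk k).const_mul _
    have hL2 : ∫ x, wLap W w x ^ 2 ∂wMeasure W = b2 + (a2 + Q) := by
      rw [integral_wLap_sq hW hw, ← hb2, ha2, hQ, ← integral_add ia iQ]
      congr 2; ext x
      exact hessian_barrierPot x fun i => pd i w x
    set G := ∫ x, m * N * ∑ k, z k * (ρ k x * s k x) ∂wMeasure W with hG
    have iG : Integrable (fun x => m * N * ∑ k, z k * (ρ k x * s k x)) (wMeasure W) :=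
      (integrable_finsetSum _ fun k _ => (iGk k).const_mul _).const_mul _
    have hψL : ∫ x, ψ x * wLap W w x ∂wMeasure W = G := by
      rw [integral_mul_wLap hW (contDiff_infty.1 hψc 1) hw, ← integral_neg, hG]
      congr 1; ext x
      simp only [hpψ, hs, Finset.mul_sum, Finset.sum_mul, ← Finset.sum_neg_distrib, neg_mul]
      rw [Finset.sum_comm]
      simp only [neg_neg]
      exact Finset.sum_congr rfl fun k _ => Finset.sum_congr rfl fun i _ => by ring
    have hδ : ∫ x, (wLap W w x - ψ x) ^ 2 ∂wMeasure W
        = b2 + (a2 + Q) - 2 * G + ∫ x, ψ x ^ 2 ∂wMeasure W := by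
      have iψL : Integrable (fun x => ψ x * wLap W w x) (wMeasure W) := hψm.integrable_mul hLm
      rw [← hL2, ← hψL, ← integral_const_mul, ← integral_sub hLm.integrable_sq (iψL.const_mul 2),
        ← integral_add (hLm.integrable_sq.sub' (iψL.const_mul 2)) hψm.integrable_sq]
      congr 1; ext x; ring
    set κ := ∫ x, N * ∑ k, ρ k x * s k x ∂wMeasure W with hκ
    have iκ : Integrable (fun x => N * ∑ k, ρ k x * s k x) (wMeasure W) :=
      (integrable_finsetSum _ fun k _ => iGk k).const_mul _
    have hκ_le : κ ≤ Real.sqrt n * Real.sqrt b2 := integral_barrier_flux_le hWe hw hwe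
    -- the weighted mass of the velocity
    have iαS : Integrable (fun x => α x * S x) (wMeasure W) := hαm.integrable_mul hSm
    have hαS : ∫ x, α x * S x ∂wMeasure W
        ≤ k₀ * A + Real.sqrt a2 * Real.sqrt b2 + A * ε := by
      have i1 : Integrable (fun x => α x * wLap W w x) (wMeasure W) := hαm.integrable_mul hLm
      have hdm : MemLp (fun x => wLap W w x - ψ x) 2 (wMeasure W) := hLm.sub hψm
      have i2 : Integrable (fun x => α x * (wLap W w x - ψ x)) (wMeasure W) :=
        hαm.integrable_mul hdm
      have i3 : Integrable α (wMeasure W) := hαm.integrable (by norm_num)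
      have e : ∫ x, α x * S x ∂wMeasure W = k₀ * (∫ x, α x ∂wMeasure W)
          - (∫ x, α x * wLap W w x ∂wMeasure W) + ∫ x, α x * (wLap W w x - ψ x) ∂wMeasure W := by
        rw [← integral_const_mul, ← integral_sub (i3.const_mul _) i1,
          ← integral_add ((i3.const_mul _).sub' i1) i2]
        congr 1; ext x; simp only [hψ]; ring
      have t1 : ∫ x, α x ∂wMeasure W ≤ A := by
        have := sq_integral_mul_le hαm (memLp_const (1 : ℝ))
        simp only [mul_one, hα2, one_pow, integral_const, probReal_univ, smul_eq_mul] at this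
        exact (abs_le_of_sq_le_sq' this (Real.sqrt_nonneg _)).2
      have t2 : -(∫ x, α x * wLap W w x ∂wMeasure W) ≤ Real.sqrt a2 * Real.sqrt b2 := by
        rw [integral_mul_wLap hW (contDiff_infty.1 hαc 1) hw, neg_neg]
        exact integral_pd_regNorm_le hε hw
      have t3 : ∫ x, α x * (wLap W w x - ψ x) ∂wMeasure W ≤ A * ε := by
        have := sq_integral_mul_le hαm hdm
        rw [hα2] at this
        refine (abs_le_of_sq_le_sq' (this.trans ?_) (by positivity)).2
        rw [mul_pow]; gcongr
      have t4 : k₀ * (∫ x, α x ∂wMeasure W) ≤ k₀ * A := by gcongr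
      linarith
    have hpt : c * A * (k₀ - κ) - 1 / 2 * (c ^ 2 * A ^ 2 + Z ^ 2) * E
        ≤ P - 2 * G + Q + c * ∫ x, α x * S x ∂wMeasure W := by
      rw [hk₀, hκ, hE, hP, hG, hQ, ← integral_sub iS iκ, ← integral_const_mul, ← integral_const_mul,
        ← integral_const_mul, ← integral_const_mul, ← integral_sub ((iS.sub' iκ).const_mul _)
          (ib.const_mul _), ← integral_sub iP (iG.const_mul 2),
        ← integral_add (iP.sub' (iG.const_mul 2)) iQ,
        ← integral_add ((iP.sub' (iG.const_mul 2)).fun_add iQ) (iαS.const_mul c)]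
      refine integral_mono (((iS.sub' iκ).const_mul _).sub (ib.const_mul _))
        (((iP.sub' (iG.const_mul 2)).fun_add iQ).fun_add (iαS.const_mul c)) fun x => ?_
      simp only [hS, barrier, Finset.mul_sum, ← Finset.sum_sub_distrib, ← Finset.sum_add_distrib]
      refine Finset.sum_le_sum fun k _ => ?_
      have h1 := mul_le_mul_of_nonneg_right (barrier_term_le (A := A) hm.le hc.le (hz k) (hzZ k)
        (sum_mul_le_regNorm (w := w) (hu1 k) ε x)) (hρ0 k x).le
      have e1 : s k x = ∑ i, pd i w x * u k i := rfl
      rw [← e1] at h1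
      refine le_trans (le_of_eq ?_) (h1.trans (le_of_eq ?_))
      · rw [hN]; simp only [hρdef]; ring
      · rw [hN]; ring
    have hbud := stability_budget (c := c) (s := Real.sqrt n) (a := Real.sqrt a2)
      (b := Real.sqrt b2) (A := A) (ε := ε) (Z := Z) hc hcs (Real.sqrt_nonneg _)
      (Real.sqrt_nonneg _) (by rw [Real.sq_sqrt ha20, hA2]) hE_le hm hmC
    rw [Real.sq_sqrt ha20, Real.sq_sqrt hb20] at hbud
    have hA0 : 0 ≤ A := Real.sqrt_nonneg _
    have t5 : c * A * κ ≤ c * A * (Real.sqrt n * Real.sqrt b2) := by gcongr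
    have t6 : c * ∫ x, α x * S x ∂wMeasure W
        ≤ c * (k₀ * A + Real.sqrt a2 * Real.sqrt b2 + A * ε) := by gcongr
    nlinarith
  refine le_of_forall_pos_le_add fun δ hδ => ?_
  have hK : 0 < 2 + 5 / 2 * c ^ 2 := by positivity
  have := main (Real.sqrt (δ / (2 + 5 / 2 * c ^ 2))) (Real.sqrt_pos.2 (by positivity))
  rw [Real.sq_sqrt (by positivity), mul_div_cancel₀ _ hK.ne'] at this
  linarith

end SecondVariationMain

section ExpSumIntegral

open Filter Topology

variable {ι Ω : Type*} [Fintype ι] [MeasurableSpace Ω] {γ : Measure Ω} [IsFiniteMeasure γ]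
  {E : ι → Ω → ℝ} {g g' g'' : ι → ℝ → ℝ} {b : ι → ℝ} {M : ℝ} {s : Set ℝ}

lemma sq_mul_exp_neg_le {y : ℝ} (hy : 0 ≤ y) : y ^ 2 * Real.exp (-y) ≤ 2 := by
  rw [Real.exp_neg, mul_inv_le_iff₀ (Real.exp_pos _)]
  nlinarith [Real.quadratic_le_exp_of_nonneg hy]

lemma self_mul_exp_neg_le (y : ℝ) : y * Real.exp (-y) ≤ 1 := by
  rw [Real.exp_neg, mul_inv_le_iff₀ (Real.exp_pos _)]
  linarith [Real.add_one_le_exp y]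

lemma abs_sum_mul_le {y e : ι → ℝ} (hy : ∀ k, 0 ≤ y k) (he : ∀ k, |e k| ≤ M * b k) :
    |∑ k, e k * y k| ≤ M * ∑ k, b k * y k := by
  rw [Finset.mul_sum]
  refine (Finset.abs_sum_le_sum_abs _ _).trans (Finset.sum_le_sum fun k _ => ?_)
  rw [abs_mul, abs_of_nonneg (hy k), ← mul_assoc]
  exact mul_le_mul_of_nonneg_right (he k) (hy k)

lemma hasDerivAt_integral_exp_neg_sum (hE : ∀ k, Measurable (E k)) (hE0 : ∀ k x, 0 ≤ E k x)
    (hs : IsOpen s) (hg : ∀ k, ∀ t ∈ s, HasDerivAt (g k) (g' k t) t) (hb : ∀ k, 0 ≤ b k)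
    (hbg : ∀ k, ∀ t ∈ s, b k ≤ g k t) (hM : 0 ≤ M) (hg' : ∀ k, ∀ t ∈ s, |g' k t| ≤ M * b k)
    {t : ℝ} (ht : t ∈ s) :
    HasDerivAt (fun t => ∫ x, Real.exp (-∑ k, g k t * E k x) ∂γ)
      (∫ x, -(∑ k, g' k t * E k x) * Real.exp (-∑ k, g k t * E k x) ∂γ) t := by
  have hmeas : ∀ f : ι → ℝ, Measurable fun x => ∑ k, f k * E k x := fun f =>
    Finset.measurable_fun_sum _ fun k _ => (hE k).const_mul _
  refine (hasDerivAt_integral_of_dominated_loc_of_deriv_le (μ := γ) (bound := fun _ => M)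
    (F' := fun t x => -(∑ k, g' k t * E k x) * Real.exp (-∑ k, g k t * E k x))
    (hs.mem_nhds ht) (Eventually.of_forall fun τ => ?_) ?_ ?_ ?_ (integrable_const _) ?_).2
  · exact (hmeas _).neg.exp.aestronglyMeasurable
  · refine Integrable.of_bound (hmeas _).neg.exp.aestronglyMeasurable 1
      (Eventually.of_forall fun x => ?_)
    rw [Real.norm_of_nonneg (Real.exp_pos _).le, Real.exp_le_one_iff, neg_nonpos]
    exact Finset.sum_nonneg fun k _ => mul_nonneg ((hb k).trans (hbg k t ht)) (hE0 k x)
  · exact ((hmeas _).neg.mul (hmeas _).neg.exp).aestronglyMeasurable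
  · refine Eventually.of_forall fun x τ hτ => ?_
    have hB : 0 ≤ ∑ k, b k * E k x := Finset.sum_nonneg fun k _ => mul_nonneg (hb k) (hE0 k x)
    rw [norm_mul, Real.norm_eq_abs, Real.norm_of_nonneg (Real.exp_pos _).le, abs_neg]
    calc _ ≤ (M * ∑ k, b k * E k x) * Real.exp (-∑ k, b k * E k x) := by
          gcongr with k
          · exact abs_sum_mul_le (fun k => hE0 k x) (fun k => hg' k τ hτ)
          · exact hE0 k x
          · exact hbg k τ hτ
      _ = M * ((∑ k, b k * E k x) * Real.exp (-∑ k, b k * E k x)) := by ring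
      _ ≤ M * 1 := by gcongr; exact self_mul_exp_neg_le _
      _ = M := mul_one M
  · refine Eventually.of_forall fun x τ hτ => ?_
    have h1 : HasDerivAt (fun t => ∑ k, g k t * E k x) (∑ k, g' k τ * E k x) τ :=
      HasDerivAt.fun_sum fun k _ => (hg k τ hτ).mul_const _
    exact h1.fun_neg.exp.congr_deriv (by ring)

lemma hasDerivAt_integral_mul_exp_neg_sum (hE : ∀ k, Measurable (E k)) (hE0 : ∀ k x, 0 ≤ E k x)
    (hs : IsOpen s) (hg : ∀ k, ∀ t ∈ s, HasDerivAt (g k) (g' k t) t)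
    (hg2 : ∀ k, ∀ t ∈ s, HasDerivAt (g' k) (g'' k t) t) (hb : ∀ k, 0 ≤ b k)
    (hbg : ∀ k, ∀ t ∈ s, b k ≤ g k t) (hM : 0 ≤ M) (hg' : ∀ k, ∀ t ∈ s, |g' k t| ≤ M * b k)
    (hg'' : ∀ k, ∀ t ∈ s, |g'' k t| ≤ M * b k) {t : ℝ} (ht : t ∈ s) :
    HasDerivAt (fun t => ∫ x, -(∑ k, g' k t * E k x) * Real.exp (-∑ k, g k t * E k x) ∂γ)
      (∫ x, ((∑ k, g' k t * E k x) ^ 2 - ∑ k, g'' k t * E k x) *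
        Real.exp (-∑ k, g k t * E k x) ∂γ) t := by
  have hmeas : ∀ f : ι → ℝ, Measurable fun x => ∑ k, f k * E k x := fun f =>
    Finset.measurable_fun_sum _ fun k _ => (hE k).const_mul _
  have hexp : ∀ x, ∀ τ ∈ s, Real.exp (-∑ k, g k τ * E k x) ≤ Real.exp (-∑ k, b k * E k x) := by
    intro x τ hτ
    gcongr with k
    · exact hE0 k x
    · exact hbg k τ hτ
  refine (hasDerivAt_integral_of_dominated_loc_of_deriv_le (μ := γ)
    (bound := fun _ => 2 * M ^ 2 + M)
    (F' := fun t x => ((∑ k, g' k t * E k x) ^ 2 - ∑ k, g'' k t * E k x) *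
        Real.exp (-∑ k, g k t * E k x))
    (hs.mem_nhds ht) (Eventually.of_forall fun τ => ?_) ?_ ?_ ?_ (integrable_const _) ?_).2
  · exact ((hmeas _).neg.mul (hmeas _).neg.exp).aestronglyMeasurable
  · refine Integrable.of_bound ((hmeas _).neg.mul (hmeas _).neg.exp).aestronglyMeasurable M
      (Eventually.of_forall fun x => ?_)
    rw [norm_mul, Real.norm_eq_abs, Real.norm_of_nonneg (Real.exp_pos _).le, abs_neg]
    have hB : 0 ≤ ∑ k, b k * E k x := Finset.sum_nonneg fun k _ => mul_nonneg (hb k) (hE0 k x)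
    calc _ ≤ (M * ∑ k, b k * E k x) * Real.exp (-∑ k, b k * E k x) :=
          mul_le_mul (abs_sum_mul_le (fun k => hE0 k x) (fun k => hg' k t ht)) (hexp x t ht)
            (Real.exp_pos _).le (by positivity)
      _ = M * ((∑ k, b k * E k x) * Real.exp (-∑ k, b k * E k x)) := by ring
      _ ≤ M * 1 := by gcongr; exact self_mul_exp_neg_le _
      _ = M := mul_one M
  · exact ((((hmeas _).pow_const 2).sub (hmeas _)).mul (hmeas _).neg.exp).aestronglyMeasurable
  · refine Eventually.of_forall fun x τ hτ => ?_
    set B := ∑ k, b k * E k x with hBdef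
    have hB : 0 ≤ B := Finset.sum_nonneg fun k _ => mul_nonneg (hb k) (hE0 k x)
    have h1 := abs_sum_mul_le (fun k => hE0 k x) (fun k => hg' k τ hτ)
    have h2 := abs_sum_mul_le (fun k => hE0 k x) (fun k => hg'' k τ hτ)
    rw [norm_mul, Real.norm_eq_abs, Real.norm_of_nonneg (Real.exp_pos _).le]
    have h3 : |(∑ k, g' k τ * E k x) ^ 2 - ∑ k, g'' k τ * E k x| ≤ (M * B) ^ 2 + M * B := by
      refine (abs_sub _ _).trans (add_le_add ?_ h2)
      rw [abs_pow]; gcongr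
    calc _ ≤ ((M * B) ^ 2 + M * B) * Real.exp (-B) :=
          mul_le_mul h3 (hexp x τ hτ) (Real.exp_pos _).le (by positivity)
      _ = M ^ 2 * (B ^ 2 * Real.exp (-B)) + M * (B * Real.exp (-B)) := by ring
      _ ≤ M ^ 2 * 2 + M * 1 := by
          gcongr
          · exact sq_mul_exp_neg_le hB
          · exact self_mul_exp_neg_le _
      _ = 2 * M ^ 2 + M := by ring
  · refine Eventually.of_forall fun x τ hτ => ?_
    have h1 : HasDerivAt (fun t => ∑ k, g k t * E k x) (∑ k, g' k τ * E k x) τ :=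
      HasDerivAt.fun_sum fun k _ => (hg k τ hτ).mul_const _
    have h2 : HasDerivAt (fun t => ∑ k, g' k t * E k x) (∑ k, g'' k τ * E k x) τ :=
      HasDerivAt.fun_sum fun k _ => (hg2 k τ hτ).mul_const _
    exact (h2.fun_neg.fun_mul h1.fun_neg.exp).congr_deriv (by ring)

end ExpSumIntegral

section BarrierLogConcave

open Filter Topology

lemma integral_wMeasure_tilt {n : ℕ} {W B W' : Euc n → ℝ} (hW : Continuous W)
    (hW' : Continuous W') {F : ℝ} (hF : 0 < F) (h : ∀ x, W' x = W x + B x + Real.log F)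
    (f : Euc n → ℝ) :
    ∫ x, f x ∂wMeasure W' = (∫ x, f x * Real.exp (-B x) ∂wMeasure W) / F := by
  rw [integral_wMeasure hW', integral_wMeasure hW, ← integral_div]
  congr 1; ext x
  rw [h x, neg_add, neg_add, Real.exp_add, Real.exp_add, Real.exp_neg (Real.log F),
    Real.exp_log hF]
  field_simp

lemma isProbabilityMeasure_wMeasure_tilt {n : ℕ} {W B W' : Euc n → ℝ} (hW : Continuous W)
    (hW' : Continuous W') (hF : 0 < ∫ x, Real.exp (-B x) ∂wMeasure W)
    (h : ∀ x, W' x = W x + B x + Real.log (∫ x, Real.exp (-B x) ∂wMeasure W)) :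
    IsProbabilityMeasure (wMeasure W') := by
  have h1 := integral_wMeasure_tilt hW hW' hF h fun _ => 1
  simp only [integral_const, smul_eq_mul, mul_one, one_mul, div_self hF.ne'] at h1
  exact isProbabilityMeasure_iff_real.2 h1

/-- The Gaussian potential, up to an additive normalization. -/
def gaussPot (n : ℕ) (D : ℝ) (x : Euc n) : ℝ := ‖x‖ ^ 2 / 2 + D

lemma continuous_gaussPot {n : ℕ} {D : ℝ} : Continuous (gaussPot n D) := by
  unfold gaussPot; fun_prop

instance isFiniteMeasure_gaussPot {n : ℕ} {D : ℝ} : IsFiniteMeasure (wMeasure (gaussPot n D)) := by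
  have h : Integrable (fun _ : Euc n => (1 : ℝ)) (wMeasure (gaussPot n D)) := by
    rw [integrable_wMeasure continuous_gaussPot]
    refine ((integrable_exp_neg_norm_sq (n := n) (b := 1 / 2) (by norm_num)).const_mul
      (Real.exp (-D))).congr (Eventually.of_forall fun x => ?_)
    simp only [gaussPot, mul_one]
    rw [← Real.exp_add]; congr 1; ring
  exact (integrable_const_iff.1 h).resolve_left one_ne_zero

/-- Interpolation between `exp (-c b)` at `t = 0` and `exp (-c a)` at `t = 1`. -/
def expInterp (c a b t : ℝ) : ℝ :=
  Real.exp (-(c * b)) + t * (Real.exp (-(c * a)) - Real.exp (-(c * b)))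

lemma hasDerivAt_expInterp (c a b t : ℝ) : HasDerivAt (expInterp c a b)
    (Real.exp (-(c * a)) - Real.exp (-(c * b))) t := by
  have h := ((hasDerivAt_id t).mul_const
    (Real.exp (-(c * a)) - Real.exp (-(c * b)))).const_add (Real.exp (-(c * b)))
  exact h.congr_deriv (one_mul _)

variable {n : ℕ} {ι : Type*} [Fintype ι] {u : ι → Euc n} {a b : ι → ℝ} {c D : ℝ}

/-- The softened indicator of the interpolated polytope, integrated against the Gaussian. -/
def softMass (m : ℕ) (c D : ℝ) (u : ι → Euc n) (ℓ : ι → ℝ) : ℝ :=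
  ∫ x, Real.exp (-∑ k, ℓ k ^ m * Real.exp (c * ⟪x, u k⟫) ^ m) ∂wMeasure (gaussPot n D)

lemma measurable_exp_inner_pow (m : ℕ) (w : Euc n) :
    Measurable fun x : Euc n => Real.exp (c * ⟪x, w⟫) ^ m :=
  (((continuous_const.mul (continuous_id.inner continuous_const)).rexp).pow m).measurable

lemma integrable_exp_neg_sum (m : ℕ) {ℓ : ι → ℝ} (hℓ : ∀ k, 0 ≤ ℓ k) :
    Integrable (fun x => Real.exp (-∑ k, ℓ k ^ m * Real.exp (c * ⟪x, u k⟫) ^ m))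
      (wMeasure (gaussPot n D)) := by
  refine Integrable.of_bound (Measurable.aestronglyMeasurable ?_) 1 (Eventually.of_forall fun x => ?_)
  · exact (Finset.measurable_fun_sum _ fun k _ =>
      (measurable_exp_inner_pow m (u k)).const_mul _).neg.exp
  · rw [Real.norm_of_nonneg (Real.exp_pos _).le, Real.exp_le_one_iff, neg_nonpos]
    exact Finset.sum_nonneg fun k _ => mul_nonneg (pow_nonneg (hℓ k) m) (by positivity)

lemma softMass_pos (m : ℕ) {ℓ : ι → ℝ} (hℓ : ∀ k, 0 ≤ ℓ k) : 0 < softMass m c D u ℓ := by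
  unfold softMass
  have hi := integrable_exp_neg_sum (n := n) (u := u) (c := c) (D := D) m hℓ
  rw [integral_wMeasure continuous_gaussPot]
  rw [integrable_wMeasure continuous_gaussPot] at hi
  have := integral_pos_iff_support_of_nonneg (f := fun x => Real.exp (-gaussPot n D x) *
    Real.exp (-∑ k, ℓ k ^ m * Real.exp (c * ⟪x, u k⟫) ^ m)) (fun x => by positivity) hi
  refine this.2 ?_
  have hs : Function.support (fun x => Real.exp (-gaussPot n D x) *
    Real.exp (-∑ k, ℓ k ^ m * Real.exp (c * ⟪x, u k⟫) ^ m)) = Set.univ :=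
    Set.eq_univ_of_forall fun x => by simp [Real.exp_ne_zero]
  rw [hs]
  exact isOpen_univ.measure_pos _ Set.univ_nonempty

lemma expTerm_neg_log_div {c ℓ : ℝ} (hc : 0 < c) (hℓ : 0 < ℓ) (m : ℕ) (w x : Euc n) :
    expTerm (c * m) w (-(Real.log ℓ / c)) x = ℓ ^ m * Real.exp (c * ⟪x, w⟫) ^ m := by
  rw [expTerm, ← mul_pow]
  nth_rewrite 2 [← Real.exp_log hℓ]
  rw [← Real.exp_add, ← Real.exp_nat_mul]
  congr 1; field_simp; ring

lemma continuousOn_softMass (m : ℕ) {ℓ : ι → ℝ → ℝ} {s : Set ℝ}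
    (hℓ : ∀ k, ContinuousOn (ℓ k) s) (hℓ0 : ∀ k, ∀ t ∈ s, 0 ≤ ℓ k t) :
    ContinuousOn (fun t => softMass m c D u fun k => ℓ k t) s := by
  unfold softMass
  refine continuousOn_of_dominated (bound := fun _ => 1) (fun t ht =>
    (integrable_exp_neg_sum m fun k => hℓ0 k t ht).aestronglyMeasurable)
    (fun t ht => Eventually.of_forall fun x => ?_) (integrable_const _)
    (Eventually.of_forall fun x => ?_)
  · rw [Real.norm_of_nonneg (Real.exp_pos _).le, Real.exp_le_one_iff, neg_nonpos]
    exact Finset.sum_nonneg fun k _ => mul_nonneg (pow_nonneg (hℓ0 k t ht) m) (by positivity)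
  · exact (continuousOn_finsetSum _ fun k _ =>
      ((hℓ k).pow m).mul continuousOn_const).neg.rexp

/-- The logarithm of the softened mass is concave along the interpolation, up to an error of
order `1 / m`. -/
theorem concaveOn_log_softMass (σ : Equiv.Perm ι) (husym : ∀ k, u (σ k) = -u k)
    (hasym : ∀ k, a (σ k) = a k) (hbsym : ∀ k, b (σ k) = b k) (hu1 : ∀ k, ‖u k‖ = 1)
    {r Z : ℝ} (hr : 0 < r) (hra : ∀ k, r ≤ a k) (hab : ∀ k, a k ≤ b k)
    (hZ : ∀ k, Real.exp (-(c * a k)) - Real.exp (-(c * b k)) ≤ Z * Real.exp (-(c * b k)))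
    (hc : 0 < c) (hcs : c * (Real.sqrt n + 1) ≤ 8 / 5) {m : ℕ} (hm : 2 ≤ m)
    (hmC : 5 * c ^ 2 * ((n + Fintype.card ι) / (c * r)) ≤ m) :
    ConcaveOn ℝ (Set.Icc 0 1) fun t =>
      Real.log (softMass m c D u fun k => expInterp c (a k) (b k) t)
        - 1 / 2 * Z ^ 2 * ((n + Fintype.card ι) / (c * r) / m) / 2 * t ^ 2 := by
  set K := 1 / 2 * Z ^ 2 * ((n + Fintype.card ι) / (c * r) / m) with hK
  set β : ι → ℝ := fun k => Real.exp (-(c * b k)) with hβ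
  set δ : ι → ℝ := fun k => Real.exp (-(c * a k)) - Real.exp (-(c * b k)) with hδ
  set ℓ : ι → ℝ → ℝ := fun k => expInterp c (a k) (b k) with hℓ
  have hβ0 : ∀ k, 0 < β k := fun k => Real.exp_pos _
  have hδ0 : ∀ k, 0 ≤ δ k := fun k => by
    simp only [hδ, sub_nonneg, Real.exp_le_exp, neg_le_neg_iff]
    exact mul_le_mul_of_nonneg_left (hab k) hc.le
  have hℓe : ∀ k t, ℓ k t = β k + t * δ k := fun k t => rfl
  have hβℓ : ∀ k, ∀ t ∈ Set.Icc (0 : ℝ) 1, β k ≤ ℓ k t := fun k t ht => by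
    rw [hℓe]; nlinarith [hδ0 k, ht.1]
  have hℓu : ∀ k, ∀ t ∈ Set.Icc (0 : ℝ) 1, ℓ k t ≤ β k + δ k := fun k t ht => by
    rw [hℓe]; nlinarith [hδ0 k, ht.2]
  have hℓ0 : ∀ k, ∀ t ∈ Set.Icc (0 : ℝ) 1, 0 < ℓ k t := fun k t ht => (hβ0 k).trans_le (hβℓ k t ht)
  have hℓd : ∀ k t, HasDerivAt (ℓ k) (δ k) t := fun k t => hasDerivAt_expInterp _ _ _ _
  set g : ι → ℝ → ℝ := fun k t => ℓ k t ^ m with hg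
  set g' : ι → ℝ → ℝ := fun k t => m * ℓ k t ^ (m - 1) * δ k with hg'
  set g'' : ι → ℝ → ℝ := fun k t => m * ((m - 1 : ℕ) * ℓ k t ^ (m - 1 - 1) * δ k) * δ k with hg''
  have hgd : ∀ k, ∀ t ∈ Set.Ioo (0 : ℝ) 1, HasDerivAt (g k) (g' k t) t := fun k t _ =>
    (hℓd k t).fun_pow m
  have hgd' : ∀ k, ∀ t ∈ Set.Ioo (0 : ℝ) 1, HasDerivAt (g' k) (g'' k t) t := fun k t _ =>
    (((hℓd k t).fun_pow (m - 1)).const_mul (m : ℝ)).mul_const (δ k)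
  obtain ⟨M, hM0, hM⟩ : ∃ M : ℝ, 0 ≤ M ∧ ∀ k,
      m * (β k + δ k) ^ (m - 1) * δ k ≤ M * β k ^ m ∧
      m * ((m - 1 : ℕ) * (β k + δ k) ^ (m - 1 - 1) * δ k) * δ k ≤ M * β k ^ m := by
    have hnn : ∀ k, 0 ≤ (m * (β k + δ k) ^ (m - 1) * δ k
      + m * ((m - 1 : ℕ) * (β k + δ k) ^ (m - 1 - 1) * δ k) * δ k) / β k ^ m := fun k => by
      have := hβ0 k; have := hδ0 k; positivity
    refine ⟨∑ k, (m * (β k + δ k) ^ (m - 1) * δ k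
      + m * ((m - 1 : ℕ) * (β k + δ k) ^ (m - 1 - 1) * δ k) * δ k) / β k ^ m,
      Finset.sum_nonneg fun k _ => hnn k, fun k => ?_⟩
    have h1 := Finset.single_le_sum (fun k _ => hnn k) (Finset.mem_univ k)
    rw [div_le_iff₀ (pow_pos (hβ0 k) m)] at h1
    have := hβ0 k; have := hδ0 k
    constructor
    · refine le_trans (le_add_of_nonneg_right ?_) h1
      positivity
    · refine le_trans (le_add_of_nonneg_left ?_) h1
      positivity
  have hbg : ∀ k, ∀ t ∈ Set.Ioo (0 : ℝ) 1, β k ^ m ≤ g k t := fun k t ht =>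
    pow_le_pow_left₀ (hβ0 k).le (hβℓ k t (Set.Ioo_subset_Icc_self ht)) m
  have hgb' : ∀ k, ∀ t ∈ Set.Ioo (0 : ℝ) 1, |g' k t| ≤ M * β k ^ m := fun k t ht => by
    have h0 := hℓ0 k t (Set.Ioo_subset_Icc_self ht)
    have h1 := hℓu k t (Set.Ioo_subset_Icc_self ht)
    have := hδ0 k
    rw [abs_of_nonneg (by positivity)]
    refine le_trans ?_ (hM k).1
    simp only [hg']
    gcongr
  have hgb'' : ∀ k, ∀ t ∈ Set.Ioo (0 : ℝ) 1, |g'' k t| ≤ M * β k ^ m := fun k t ht => by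
    have h0 := hℓ0 k t (Set.Ioo_subset_Icc_self ht)
    have h1 := hℓu k t (Set.Ioo_subset_Icc_self ht)
    have := hδ0 k
    rw [abs_of_nonneg (by positivity)]
    refine le_trans ?_ (hM k).2
    simp only [hg'']
    gcongr
  set γ := wMeasure (gaussPot n D) with hγ
  set E : ι → Euc n → ℝ := fun k x => Real.exp (c * ⟪x, u k⟫) ^ m with hE
  have hE0 : ∀ k x, 0 ≤ E k x := fun k x => by positivity
  have hEm : ∀ k, Measurable (E k) := fun k => measurable_exp_inner_pow m (u k)
  set F : ℝ → ℝ := fun t => softMass m c D u fun k => ℓ k t with hF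
  have hF0 : ∀ t ∈ Set.Icc (0 : ℝ) 1, 0 < F t := fun t ht => softMass_pos m fun k => (hℓ0 k t ht).le
  set F' : ℝ → ℝ := fun t => ∫ x, -(∑ k, g' k t * E k x) * Real.exp (-∑ k, g k t * E k x) ∂γ with hF'
  set F'' : ℝ → ℝ := fun t => ∫ x, ((∑ k, g' k t * E k x) ^ 2 - ∑ k, g'' k t * E k x) *
        Real.exp (-∑ k, g k t * E k x) ∂γ with hF''
  have hFd : ∀ t ∈ Set.Ioo (0 : ℝ) 1, HasDerivAt F (F' t) t := fun t ht =>
    hasDerivAt_integral_exp_neg_sum hEm hE0 isOpen_Ioo hgd (fun k => (pow_pos (hβ0 k) m).le) hbg hM0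
      hgb' ht
  have hFd' : ∀ t ∈ Set.Ioo (0 : ℝ) 1, HasDerivAt F' (F'' t) t := fun t ht =>
    hasDerivAt_integral_mul_exp_neg_sum hEm hE0 isOpen_Ioo hgd hgd' (fun k => (pow_pos (hβ0 k) m).le)
      hbg hM0 hgb' hgb'' ht
  have key : ∀ t ∈ Set.Ioo (0 : ℝ) 1, F'' t / F t - (F' t / F t) ^ 2 ≤ K := by
    intro t ht
    have htI := Set.Ioo_subset_Icc_self ht
    set h : ι → ℝ := fun k => -(Real.log (ℓ k t) / c) with hh
    set z : ι → ℝ := fun k => δ k / ℓ k t with hz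
    have hρ : ∀ k x, expTerm (c * m) (u k) (h k) x = g k t * E k x := fun k x =>
      expTerm_neg_log_div hc (hℓ0 k t htI) m (u k) x
    have hWt : ∀ x, barrierPot (c * m) u h (D + Real.log (F t)) x
        = gaussPot n D x + (∑ k, g k t * E k x) + Real.log (F t) := fun x => by
      simp only [barrierPot, barrier, gaussPot, hρ]; ring
    have hprob : IsProbabilityMeasure (wMeasure (barrierPot (c * m) u h (D + Real.log (F t)))) :=
      isProbabilityMeasure_wMeasure_tilt continuous_gaussPot continuous_barrierPot (hF0 t htI) hWt
    have htilt := integral_wMeasure_tilt continuous_gaussPot continuous_barrierPot (hF0 t htI) hWt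
    have hmR : (0 : ℝ) < m := by positivity
    have hsv := second_variation_le (n := n) (u := u) (h := h) (z := z) (c := c) (m := m)
      (C₀ := D + Real.log (F t)) (r := r) (Z := Z) σ husym
      (fun k => by simp only [hh, hℓ, hasym, hbsym])
      (fun k => by simp only [hz, hδ, hℓ, hasym, hbsym]) hu1 hr ?_
      (fun k => div_nonneg (hδ0 k) (hℓ0 k t htI).le) ?_ hc hcs hmR hmC
    · have e1 : ∀ x, (m : ℝ) * ∑ k, z k * expTerm (c * m) (u k) (h k) x = ∑ k, g' k t * E k x := by
        intro x
        rw [Finset.mul_sum]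
        refine Finset.sum_congr rfl fun k _ => ?_
        have h0 := (hℓ0 k t htI).ne'
        rw [hρ]
        simp only [hz, hg, hg']
        obtain ⟨j, rfl⟩ : ∃ j, m = j + 1 := ⟨m - 1, by lia⟩
        rw [Nat.add_sub_cancel, pow_succ]
        field_simp
      have e2 : ∀ x, (m : ℝ) * (m - 1) * ∑ k, z k ^ 2 * expTerm (c * m) (u k) (h k) x
          = ∑ k, g'' k t * E k x := by
        intro x
        rw [Finset.mul_sum]
        refine Finset.sum_congr rfl fun k _ => ?_
        have h0 := (hℓ0 k t htI).ne'
        rw [hρ]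
        simp only [hz, hg, hg'']
        obtain ⟨j, rfl⟩ : ∃ j, m = j + 2 := ⟨m - 2, by lia⟩
        rw [show j + 2 - 1 - 1 = j by lia, show j + 2 - 1 = j + 1 by lia, pow_add]
        push_cast
        field_simp
        ring
      have i1 : Integrable (fun x => (∑ k, g' k t * E k x) ^ 2)
          (wMeasure (barrierPot (c * m) u h (D + Real.log (F t)))) := by
        have : MemLp (fun x => (m : ℝ) * ∑ k, z k * expTerm (c * m) (u k) (h k) x) 2
            (wMeasure (barrierPot (c * m) u h (D + Real.log (F t)))) :=
          (memLp_finsetSum _ fun k _ => (memLp_expTerm k).const_mul (z k)).const_mul (m : ℝ)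
        simp only [e1] at this
        exact this.integrable_sq
      have i2 : Integrable (fun x => ∑ k, g'' k t * E k x)
          (wMeasure (barrierPot (c * m) u h (D + Real.log (F t)))) := by
        have : Integrable (fun x => (m : ℝ) * (m - 1) * ∑ k, z k ^ 2 *
            expTerm (c * m) (u k) (h k) x)
            (wMeasure (barrierPot (c * m) u h (D + Real.log (F t)))) :=
          (integrable_finsetSum _ fun k _ =>
            ((memLp_expTerm k).integrable (by norm_num)).const_mul (z k ^ 2)).const_mul _
        simpa only [e2] using this
      simp only [e1, e2] at hsv
      have e3 : F'' t / F t = (∫ x, (∑ k, g' k t * E k x) ^ 2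
            ∂wMeasure (barrierPot (c * m) u h (D + Real.log (F t))))
          - ∫ x, ∑ k, g'' k t * E k x
            ∂wMeasure (barrierPot (c * m) u h (D + Real.log (F t))) := by
        rw [← integral_sub i1 i2, htilt]
      have e4 : F' t / F t = -∫ x, ∑ k, g' k t * E k x
            ∂wMeasure (barrierPot (c * m) u h (D + Real.log (F t))) := by
        rw [← integral_neg, htilt]
      rw [e3, e4, neg_sq]
      linarith
    · intro k
      simp only [hh]
      rw [← neg_div, le_div_iff₀ hc, le_neg]
      refine (Real.log_le_log (hℓ0 k t htI) (hℓu k t htI)).trans ?_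
      simp only [hβ, hδ, add_sub_cancel, Real.log_exp]
      nlinarith [hra k]
    · intro k
      have hZ0 : 0 ≤ Z := by
        by_contra hneg
        nlinarith [hδ0 k, hZ k, hβ0 k]
      rw [div_le_iff₀ (hℓ0 k t htI)]
      exact (hZ k).trans (mul_le_mul_of_nonneg_left (hβℓ k t htI) hZ0)
  refine concaveOn_of_hasDerivWithinAt2_nonpos (convex_Icc 0 1)
    (f' := fun t => F' t / F t - K / 2 * (2 * t))
    (f'' := fun t => (F'' t * F t - F' t * F' t) / F t ^ 2 - K / 2 * 2) ?_ ?_ ?_ ?_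
  · refine ContinuousOn.sub (ContinuousOn.log ?_ fun t ht => (hF0 t ht).ne') (by fun_prop)
    exact continuousOn_softMass m (fun k => fun t _ => (hℓd k t).continuousAt.continuousWithinAt)
      fun k t ht => (hℓ0 k t ht).le
  all_goals
    intro t ht
    rw [interior_Icc] at ht
    have hFt := (hF0 t (Set.Ioo_subset_Icc_self ht)).ne'
  · have h2 : HasDerivAt (fun t : ℝ => t ^ 2) (2 * t) t := by simpa using hasDerivAt_pow 2 t
    exact (((hFd t ht).log hFt).sub (h2.const_mul _)).hasDerivWithinAt
  · have h2 : HasDerivAt (fun t : ℝ => 2 * t) 2 t := by simpa using (hasDerivAt_id t).const_mul 2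
    exact (((hFd' t ht).div (hFd t ht) hFt).sub (h2.const_mul _)).hasDerivWithinAt
  · have := key t ht
    have e : (F'' t * F t - F' t * F' t) / F t ^ 2 = F'' t / F t - (F' t / F t) ^ 2 := by
      field_simp
    simp only [e]; linarith

end BarrierLogConcave

section PolytopeInterp

open Filter Topology

variable {n : ℕ} {ι : Type*} [Fintype ι] {u : ι → Euc n} {a b : ι → ℝ} {c D : ℝ}

lemma tendsto_setIntegral_exp_neg_sum_one {ℓ : ι → ℝ} (hℓ : ∀ k, 0 ≤ ℓ k) {A : Set (Euc n)}
    (hA : MeasurableSet A) (h : ∀ x ∈ A, ∀ k, ℓ k * Real.exp (c * ⟪x, u k⟫) < 1) :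
    Tendsto (fun m : ℕ => ∫ x in A, Real.exp (-∑ k, ℓ k ^ m * Real.exp (c * ⟪x, u k⟫) ^ m)
      ∂wMeasure (gaussPot n D)) atTop (𝓝 ((wMeasure (gaussPot n D)).real A)) := by
  have e : (wMeasure (gaussPot n D)).real A = ∫ _ in A, (1 : ℝ) ∂wMeasure (gaussPot n D) := by simp
  rw [e]
  refine tendsto_integral_of_dominated_convergence (fun _ => 1)
    (fun m => (integrable_exp_neg_sum m hℓ).aestronglyMeasurable.restrict) (integrable_const _)
    (fun m => Eventually.of_forall fun x => ?_) ?_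
  · rw [Real.norm_of_nonneg (Real.exp_pos _).le, Real.exp_le_one_iff, neg_nonpos]
    exact Finset.sum_nonneg fun k _ => mul_nonneg (pow_nonneg (hℓ k) m) (by positivity)
  · refine (ae_restrict_iff' hA).2 (Eventually.of_forall fun x hx => ?_)
    have h1 : Tendsto (fun m : ℕ => ∑ k, ℓ k ^ m * Real.exp (c * ⟪x, u k⟫) ^ m) atTop
        (𝓝 (∑ _k : ι, 0)) := by
      refine tendsto_finsetSum _ fun k _ => ?_
      simp only [← mul_pow]
      exact tendsto_pow_atTop_nhds_zero_of_lt_one (mul_nonneg (hℓ k) (Real.exp_pos _).le) (h x hx k)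
    simpa using h1.neg.rexp

lemma tendsto_setIntegral_exp_neg_sum_zero {ℓ : ι → ℝ} (hℓ : ∀ k, 0 ≤ ℓ k) {A : Set (Euc n)}
    (hA : MeasurableSet A) (h : ∀ x ∈ A, ∃ k, 1 < ℓ k * Real.exp (c * ⟪x, u k⟫)) :
    Tendsto (fun m : ℕ => ∫ x in A, Real.exp (-∑ k, ℓ k ^ m * Real.exp (c * ⟪x, u k⟫) ^ m)
      ∂wMeasure (gaussPot n D)) atTop (𝓝 0) := by
  have e : (0 : ℝ) = ∫ _ in A, (0 : ℝ) ∂wMeasure (gaussPot n D) := by simp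
  rw [e]
  refine tendsto_integral_of_dominated_convergence (fun _ => 1)
    (fun m => (integrable_exp_neg_sum m hℓ).aestronglyMeasurable.restrict) (integrable_const _)
    (fun m => Eventually.of_forall fun x => ?_) ?_
  · rw [Real.norm_of_nonneg (Real.exp_pos _).le, Real.exp_le_one_iff, neg_nonpos]
    exact Finset.sum_nonneg fun k _ => mul_nonneg (pow_nonneg (hℓ k) m) (by positivity)
  · refine (ae_restrict_iff' hA).2 (Eventually.of_forall fun x hx => ?_)
    obtain ⟨k, hk⟩ := h x hx
    refine Real.tendsto_exp_neg_atTop_nhds_zero.comp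
      (tendsto_atTop_mono (fun m => ?_) (tendsto_pow_atTop_atTop_of_one_lt hk))
    rw [mul_pow]
    exact Finset.single_le_sum (f := fun k => ℓ k ^ m * Real.exp (c * ⟪x, u k⟫) ^ m)
      (fun j _ => mul_nonneg (pow_nonneg (hℓ j) m) (by positivity)) (Finset.mem_univ k)

lemma measurableSet_polytope {κ : Type*} {u : κ → Euc n} (ℓ : κ → ℝ) :
    MeasurableSet {x : Euc n | ∀ k, ℓ k * Real.exp (c * ⟪x, u k⟫) ≤ 1} := by
  rw [Set.ofPred_forall]
  exact (isClosed_iInter fun k => isClosed_le (continuous_const.mul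
    ((continuous_const.mul (continuous_id.inner continuous_const)).rexp))
      continuous_const).measurableSet

lemma measurableSet_openPolytope (a : ι → ℝ) : MeasurableSet {x : Euc n | ∀ k, ⟪x, u k⟫ < a k} := by
  rw [Set.ofPred_forall]
  exact (isOpen_iInter_of_finite fun k => isOpen_lt (continuous_id.inner continuous_const)
    continuous_const).measurableSet

/-- A dimensional Gaussian inequality for the exponential interpolation of two nested symmetric
polytopes. -/
theorem gaussian_polytope_interp (σ : Equiv.Perm ι) (husym : ∀ k, u (σ k) = -u k)
    (hasym : ∀ k, a (σ k) = a k) (hbsym : ∀ k, b (σ k) = b k) (hu1 : ∀ k, ‖u k‖ = 1)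
    {r : ℝ} (hr : 0 < r) (hra : ∀ k, r ≤ a k) (hab : ∀ k, a k ≤ b k)
    (hc : 0 < c) (hcs : c * (Real.sqrt n + 1) ≤ 8 / 5) {t : ℝ} (ht : t ∈ Set.Icc (0 : ℝ) 1) :
    (wMeasure (gaussPot n D)).real {x | ∀ k, ⟪x, u k⟫ < a k} ^ t
        * (wMeasure (gaussPot n D)).real {x | ∀ k, ⟪x, u k⟫ < b k} ^ (1 - t)
      ≤ (wMeasure (gaussPot n D)).real
        {x | ∀ k, expInterp c (a k) (b k) t * Real.exp (c * ⟪x, u k⟫) ≤ 1} := by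
  set γ := wMeasure (gaussPot n D) with hγ
  set A := {x : Euc n | ∀ k, ⟪x, u k⟫ < a k}
  set B := {x : Euc n | ∀ k, ⟪x, u k⟫ < b k}
  set C := {x : Euc n | ∀ k, expInterp c (a k) (b k) t * Real.exp (c * ⟪x, u k⟫) ≤ 1} with hC
  have hAm : MeasurableSet A := measurableSet_openPolytope a
  have hBm : MeasurableSet B := measurableSet_openPolytope b
  have hCm : MeasurableSet C := measurableSet_polytope _
  have hδ0 : ∀ k, 0 ≤ Real.exp (-(c * a k)) - Real.exp (-(c * b k)) := fun k => by
    rw [sub_nonneg, Real.exp_le_exp, neg_le_neg_iff]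
    exact mul_le_mul_of_nonneg_left (hab k) hc.le
  have hℓ0 : ∀ s ∈ Set.Icc (0 : ℝ) 1, ∀ k, 0 ≤ expInterp c (a k) (b k) s := fun s hs k =>
    add_nonneg (Real.exp_pos _).le (mul_nonneg hs.1 (hδ0 k))
  have h0 : (0 : ℝ) ∈ Set.Icc (0 : ℝ) 1 := ⟨le_rfl, zero_le_one⟩
  have h1 : (1 : ℝ) ∈ Set.Icc (0 : ℝ) 1 := ⟨zero_le_one, le_rfl⟩
  have hℓ1 : ∀ k, expInterp c (a k) (b k) 1 = Real.exp (-(c * a k)) := fun k => by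
    simp [expInterp]
  have hℓz : ∀ k, expInterp c (a k) (b k) 0 = Real.exp (-(c * b k)) := fun k => by
    simp [expInterp]
  set q : ℝ → ℕ → Euc n → ℝ := fun s m x =>
    Real.exp (-∑ k, expInterp c (a k) (b k) s ^ m * Real.exp (c * ⟪x, u k⟫) ^ m) with hq
  set F : ℝ → ℕ → ℝ := fun s m => softMass m c D u fun k => expInterp c (a k) (b k) s with hF
  have iq : ∀ s ∈ Set.Icc (0 : ℝ) 1, ∀ m, Integrable (q s m) γ := fun s hs m =>
    integrable_exp_neg_sum m (hℓ0 s hs)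
  have hqle : ∀ s ∈ Set.Icc (0 : ℝ) 1, ∀ m x, q s m x ≤ 1 := fun s hs m x => by
    rw [Real.exp_le_one_iff, neg_nonpos]
    exact Finset.sum_nonneg fun k _ => mul_nonneg (pow_nonneg (hℓ0 s hs k) m) (by positivity)
  have hlow : ∀ s ∈ Set.Icc (0 : ℝ) 1, ∀ (S : Set (Euc n)) m, ∫ x in S, q s m x ∂γ ≤ F s m :=
    fun s hs S m => setIntegral_le_integral (iq s hs m)
      (Eventually.of_forall fun x => (Real.exp_pos _).le)
  have hup : ∀ m, F t m ≤ γ.real C + ∫ x in Cᶜ, q t m x ∂γ := fun m => by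
    change ∫ x, q t m x ∂γ ≤ _
    rw [← integral_add_compl hCm (iq t ht m)]
    gcongr
    calc ∫ x in C, q t m x ∂γ ≤ ∫ _ in C, (1 : ℝ) ∂γ :=
          integral_mono (iq t ht m).integrableOn (integrable_const _) fun x => hqle t ht m x
      _ = γ.real C := by simp
  have limA : Tendsto (fun m => ∫ x in A, q 1 m x ∂γ) atTop (𝓝 (γ.real A)) := by
    refine tendsto_setIntegral_exp_neg_sum_one (hℓ0 1 h1) hAm fun x hx k => ?_
    rw [hℓ1, ← Real.exp_add, Real.exp_lt_one_iff]
    nlinarith [hx k]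
  have limB : Tendsto (fun m => ∫ x in B, q 0 m x ∂γ) atTop (𝓝 (γ.real B)) := by
    refine tendsto_setIntegral_exp_neg_sum_one (hℓ0 0 h0) hBm fun x hx k => ?_
    rw [hℓz, ← Real.exp_add, Real.exp_lt_one_iff]
    nlinarith [hx k]
  have limC : Tendsto (fun m => ∫ x in Cᶜ, q t m x ∂γ) atTop (𝓝 0) := by
    refine tendsto_setIntegral_exp_neg_sum_zero (hℓ0 t ht) hCm.compl fun x hx => ?_
    simpa [hC] using hx
  set Z := ∑ k, (Real.exp (-(c * a k)) - Real.exp (-(c * b k))) / Real.exp (-(c * b k)) with hZ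
  have hZle : ∀ k, Real.exp (-(c * a k)) - Real.exp (-(c * b k)) ≤ Z * Real.exp (-(c * b k)) := by
    intro k
    rw [← div_le_iff₀ (Real.exp_pos _)]
    exact Finset.single_le_sum (f := fun k =>
      (Real.exp (-(c * a k)) - Real.exp (-(c * b k))) / Real.exp (-(c * b k)))
      (fun j _ => div_nonneg (hδ0 j) (Real.exp_pos _).le) (Finset.mem_univ k)
  set K := 1 / 2 * Z ^ 2 * ((n + Fintype.card ι) / (c * r)) / 2 with hK
  have hK0 : 0 ≤ K := by positivity
  have limK : Tendsto (fun m : ℕ => Real.exp (K / m)) atTop (𝓝 1) := by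
    simpa using (tendsto_const_div_atTop_nhds_zero_nat K).rexp
  have step : ∀ᶠ m : ℕ in atTop, (∫ x in A, q 1 m x ∂γ) ^ t * (∫ x in B, q 0 m x ∂γ) ^ (1 - t)
      ≤ (γ.real C + ∫ x in Cᶜ, q t m x ∂γ) * Real.exp (K / m) := by
    filter_upwards [eventually_ge_atTop 2,
      eventually_ge_atTop ⌈5 * c ^ 2 * ((n + Fintype.card ι) / (c * r))⌉₊] with m hm2 hmC
    have hcon := concaveOn_log_softMass (D := D) σ husym hasym hbsym hu1 hr hra hab hZle hc hcs
      hm2 (Nat.ceil_le.1 hmC)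
    have := hcon.2 h1 h0 ht.1 (sub_nonneg.2 ht.2) (by ring)
    simp only [smul_eq_mul, mul_one, mul_zero, add_zero] at this
    have eK : 1 / 2 * Z ^ 2 * ((n + Fintype.card ι) / (c * r) / m) / 2 = K / m := by
      rw [hK]; ring
    rw [eK] at this
    have hpos : ∀ s ∈ Set.Icc (0 : ℝ) 1, 0 < F s m := fun s hs => softMass_pos m (hℓ0 s hs)
    have hKm : 0 ≤ K / m := by positivity
    have hlog : t * Real.log (F 1 m) + (1 - t) * Real.log (F 0 m)
        ≤ Real.log (F t m) + K / m := by
      change t * (Real.log (F 1 m) - K / m * 1 ^ 2) + (1 - t) *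
        (Real.log (F 0 m) - K / m * 0 ^ 2) ≤ Real.log (F t m) - K / m * t ^ 2 at this
      have h3 : t * (K / m) ≤ 1 * (K / m) := mul_le_mul_of_nonneg_right ht.2 hKm
      have h4 : 0 ≤ K / m * t ^ 2 := by positivity
      linarith
    calc (∫ x in A, q 1 m x ∂γ) ^ t * (∫ x in B, q 0 m x ∂γ) ^ (1 - t)
        ≤ F 1 m ^ t * F 0 m ^ (1 - t) := by
          have hA0 : 0 ≤ ∫ x in A, q 1 m x ∂γ := integral_nonneg fun x => (Real.exp_pos _).le
          have hB0 : 0 ≤ ∫ x in B, q 0 m x ∂γ := integral_nonneg fun x => (Real.exp_pos _).le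
          exact mul_le_mul (Real.rpow_le_rpow hA0 (hlow 1 h1 A m) ht.1)
            (Real.rpow_le_rpow hB0 (hlow 0 h0 B m) (sub_nonneg.2 ht.2))
            (Real.rpow_nonneg hB0 _) (Real.rpow_nonneg (hpos 1 h1).le _)
      _ = Real.exp (t * Real.log (F 1 m) + (1 - t) * Real.log (F 0 m)) := by
          rw [Real.rpow_def_of_pos (hpos 1 h1), Real.rpow_def_of_pos (hpos 0 h0), ← Real.exp_add]
          congr 1; ring
      _ ≤ Real.exp (Real.log (F t m) + K / m) := Real.exp_le_exp.2 hlog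
      _ = F t m * Real.exp (K / m) := by rw [Real.exp_add, Real.exp_log (hpos t ht)]
      _ ≤ _ := by gcongr; exact hup m
  have lim1 := (limA.rpow_const (p := t) (Or.inr ht.1)).mul
    (limB.rpow_const (p := 1 - t) (Or.inr (sub_nonneg.2 ht.2)))
  have lim2 := (limC.const_add (γ.real C)).mul limK
  rw [add_zero, mul_one] at lim2
  exact le_of_tendsto_of_tendsto lim1 lim2 step

end PolytopeInterp

section PowerMeanComparison

open Filter Topology

lemma convexOn_exp_neg_mul_rpow {p c r : ℝ} (hp : 0 < p) (hr : 0 < r) (hc : 0 < c)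
    (h : 1 - p ≤ c * r) :
    ConvexOn ℝ (Set.Ici (r ^ p)) fun s => Real.exp (-(c * s ^ (1 / p))) := by
  have hrp : 0 < r ^ p := Real.rpow_pos_of_pos hr p
  have hd : ∀ s, 0 < s → HasDerivAt (fun s : ℝ => Real.exp (-(c * s ^ (1 / p))))
      (Real.exp (-(c * s ^ (1 / p))) * -(c * (1 / p * s ^ (1 / p - 1)))) s := fun s hs =>
    ((Real.hasDerivAt_rpow_const (Or.inl hs.ne')).const_mul c).fun_neg.exp
  refine convexOn_of_hasDerivWithinAt2_nonneg (convex_Ici _)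
    (f' := fun s => Real.exp (-(c * s ^ (1 / p))) * -(c * (1 / p * s ^ (1 / p - 1))))
    (f'' := fun s => Real.exp (-(c * s ^ (1 / p))) * -(c * (1 / p * s ^ (1 / p - 1))) *
        -(c * (1 / p * s ^ (1 / p - 1)))
      + Real.exp (-(c * s ^ (1 / p))) *
        -(c * (1 / p * ((1 / p - 1) * s ^ (1 / p - 1 - 1)))))
    (fun s hs => (hd s (hrp.trans_le hs)).continuousAt.continuousWithinAt) ?_ ?_ ?_
  all_goals
    intro s hs
    rw [interior_Ici] at hs
    have hs0 : 0 < s := hrp.trans hs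
  · exact (hd s hs0).hasDerivWithinAt
  · exact ((hd s hs0).fun_mul ((((Real.hasDerivAt_rpow_const (Or.inl hs0.ne')).const_mul
      (1 / p)).const_mul c).fun_neg)).hasDerivWithinAt
  · have hy : r ≤ s ^ (1 / p) := by
      calc r = (r ^ p) ^ (1 / p) := by
            rw [← Real.rpow_mul hr.le, mul_one_div_cancel hp.ne', Real.rpow_one]
        _ ≤ _ := Real.rpow_le_rpow hrp.le (le_of_lt hs) (by positivity)
    have e1 : s ^ (1 / p - 1) = s ^ (1 / p) / s := Real.rpow_sub_one hs0.ne' _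
    have e2 : s ^ (1 / p - 1 - 1) = s ^ (1 / p) / s / s := by
      rw [Real.rpow_sub_one hs0.ne', e1]
    simp only [e1, e2]
    set y := s ^ (1 / p)
    have e : Real.exp (-(c * y)) * -(c * (1 / p * (y / s))) * -(c * (1 / p * (y / s)))
        + Real.exp (-(c * y)) * -(c * (1 / p * ((1 / p - 1) * (y / s / s))))
        = Real.exp (-(c * y)) * (c * y / (p ^ 2 * s ^ 2)) * (c * y - (1 - p)) := by
      field_simp; ring
    rw [e]
    have hy0 : 0 < y := hr.trans_le hy
    have : 0 ≤ c * y - (1 - p) := by nlinarith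
    positivity

lemma convexOn_exp_neg_mul_exp {c r : ℝ} (hr : 0 < r) (hc : 0 < c) (h : 1 ≤ c * r) :
    ConvexOn ℝ (Set.Ici (Real.log r)) fun s => Real.exp (-(c * Real.exp s)) := by
  have hd : ∀ s, HasDerivAt (fun s : ℝ => Real.exp (-(c * Real.exp s)))
      (Real.exp (-(c * Real.exp s)) * -(c * Real.exp s)) s := fun s =>
    ((Real.hasDerivAt_exp s).const_mul c).fun_neg.exp
  refine convexOn_of_hasDerivWithinAt2_nonneg (convex_Ici _)
    (f' := fun s => Real.exp (-(c * Real.exp s)) * -(c * Real.exp s))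
    (f'' := fun s => Real.exp (-(c * Real.exp s)) * -(c * Real.exp s) * -(c * Real.exp s)
      + Real.exp (-(c * Real.exp s)) * -(c * Real.exp s))
    (fun s hs => (hd s).continuousAt.continuousWithinAt) (fun s _ => (hd s).hasDerivWithinAt)
    (fun s _ => ((hd s).fun_mul
      ((Real.hasDerivAt_exp s).const_mul c).fun_neg).hasDerivWithinAt) fun s hs => ?_
  rw [interior_Ici] at hs
  have hy : r ≤ Real.exp s := by
    rw [← Real.exp_log hr]; exact Real.exp_le_exp.2 (le_of_lt hs)
  have e : Real.exp (-(c * Real.exp s)) * -(c * Real.exp s) * -(c * Real.exp s)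
      + Real.exp (-(c * Real.exp s)) * -(c * Real.exp s)
      = Real.exp (-(c * Real.exp s)) * (c * Real.exp s) * (c * Real.exp s - 1) := by ring
  rw [e]
  have : 0 ≤ c * Real.exp s - 1 := by nlinarith
  positivity

/-- The exponential interpolation dominates the one through the `p`-mean. -/
lemma exp_neg_powerMean_le_expInterp {p c r a b t : ℝ} (hp : 0 < p) (hr : 0 < r) (hc : 0 < c)
    (h : 1 - p ≤ c * r) (ha : r ≤ a) (hb : r ≤ b) (ht : t ∈ Set.Icc (0 : ℝ) 1) :
    Real.exp (-(c * (t * a ^ p + (1 - t) * b ^ p) ^ (1 / p))) ≤ expInterp c a b t := by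
  have ha' : r ^ p ≤ a ^ p := Real.rpow_le_rpow hr.le ha hp.le
  have hb' : r ^ p ≤ b ^ p := Real.rpow_le_rpow hr.le hb hp.le
  have hc := (convexOn_exp_neg_mul_rpow hp hr hc h).2 ha' hb' ht.1 (sub_nonneg.2 ht.2) (by ring)
  simp only [smul_eq_mul, ← Real.rpow_mul (hr.le.trans ha), ← Real.rpow_mul (hr.le.trans hb),
    mul_one_div_cancel hp.ne', Real.rpow_one] at hc
  refine hc.trans (le_of_eq ?_)
  rw [expInterp]; ring

lemma exp_neg_geomMean_le_expInterp {c r a b t : ℝ} (hr : 0 < r) (hc : 0 < c)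
    (h : 1 ≤ c * r) (ha : r ≤ a) (hb : r ≤ b) (ht : t ∈ Set.Icc (0 : ℝ) 1) :
    Real.exp (-(c * (a ^ t * b ^ (1 - t)))) ≤ expInterp c a b t := by
  have ha0 : 0 < a := hr.trans_le ha
  have hb0 : 0 < b := hr.trans_le hb
  have hc := (convexOn_exp_neg_mul_exp hr hc h).2 (Real.log_le_log hr ha) (Real.log_le_log hr hb)
    ht.1 (sub_nonneg.2 ht.2) (by ring)
  simp only [smul_eq_mul, Real.exp_add, Real.exp_log ha0, Real.exp_log hb0,
    mul_comm _ (Real.log a), mul_comm _ (Real.log b), ← Real.rpow_def_of_pos ha0,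
    ← Real.rpow_def_of_pos hb0] at hc
  refine hc.trans (le_of_eq ?_)
  rw [expInterp]; ring

end PowerMeanComparison

section SupportFunction

variable {n : ℕ} {K L : Set (Euc n)} {u : Euc n} {r : ℝ}

lemma bddAbove_inner_image (hK : IsCompact K) (u : Euc n) :
    BddAbove ((fun y => ⟪u, y⟫) '' K) :=
  (hK.image (continuous_const.inner continuous_id)).bddAbove

lemma inner_le_suppFn (hK : IsCompact K) {x : Euc n} (hx : x ∈ K) : ⟪x, u⟫ ≤ suppFn K u := by
  rw [real_inner_comm]
  exact le_csSup (bddAbove_inner_image hK u) ⟨x, hx, rfl⟩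

lemma inner_lt_suppFn (hK : IsCompact K) (hu : ‖u‖ = 1) {x : Euc n} (hx : x ∈ interior K) :
    ⟪x, u⟫ < suppFn K u := by
  obtain ⟨ε, hε, hb⟩ := Metric.isOpen_iff.1 isOpen_interior x hx
  have hmem : x + (ε / 2) • u ∈ K := interior_subset (hb (by
    rw [Metric.mem_ball, dist_eq_norm, add_sub_cancel_left, norm_smul, hu, mul_one,
      Real.norm_of_nonneg (by positivity)]
    linarith))
  have h := inner_le_suppFn hK (u := u) hmem
  rw [inner_add_left, real_inner_smul_left, real_inner_self_eq_norm_sq, hu] at h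
  linarith

lemma le_suppFn (hK : IsCompact K) (hr : 0 ≤ r) (hKr : Metric.closedBall (0 : Euc n) r ⊆ K)
    (hu : ‖u‖ = 1) : r ≤ suppFn K u := by
  have hmem : r • u ∈ K := hKr (by simp [norm_smul, hu, abs_of_nonneg hr])
  have h := inner_le_suppFn hK (u := u) hmem
  rwa [real_inner_smul_left, real_inner_self_eq_norm_sq, hu, one_pow, mul_one] at h

lemma suppFn_mono (hK : K.Nonempty) (hL : IsCompact L) (hKL : K ⊆ L) :
    suppFn K u ≤ suppFn L u :=
  csSup_le_csSup (bddAbove_inner_image hL u) (hK.image _) (Set.image_mono hKL)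

lemma suppFn_neg (hK : K = -K) (u : Euc n) : suppFn K (-u) = suppFn K u := by
  unfold suppFn
  congr 1
  ext y
  constructor
  · rintro ⟨x, hx, rfl⟩
    rw [hK] at hx
    exact ⟨-x, hx, by simp⟩
  · rintro ⟨x, hx, rfl⟩
    rw [hK] at hx
    exact ⟨-x, hx, by simp⟩

end SupportFunction

section GaussianMass

variable {n : ℕ}

lemma gaussianMeasure_eq_wMeasure :
    gaussianMeasure n = wMeasure (gaussPot n (n / 2 * Real.log (2 * Real.pi))) := by
  unfold gaussianMeasure wMeasure gaussPot
  congr 1; ext x; congr 1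
  rw [Real.rpow_def_of_pos (by positivity), ← Real.exp_add]
  congr 1; ring

lemma wMeasure_interior {W : Euc n → ℝ} {K : Set (Euc n)} (hK : Convex ℝ K) :
    wMeasure W (interior K) = wMeasure W K := by
  refine le_antisymm (measure_mono interior_subset) ?_
  have h0 : wMeasure W (frontier K) = 0 :=
    withDensity_absolutelyContinuous _ _ (hK.addHaar_frontier volume)
  calc wMeasure W K ≤ wMeasure W (interior K ∪ frontier K) :=
        measure_mono (subset_closure.trans (closure_eq_interior_union_frontier K).subset)
    _ ≤ wMeasure W (interior K) + wMeasure W (frontier K) := measure_union_le _ _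
    _ = _ := by rw [h0, add_zero]

/-- The mass inequality for the intersection of finitely many half-spaces. -/
lemma wMeasure_rpow_le_finite {D r : ℝ} (hr : 0 < r)
    {K L : Set (Euc n)} (hK : IsConvexBody K) (hL : IsConvexBody L)
    (hKsym : K = -K) (hLsym : L = -L) (hKL : K ⊆ L)
    (hKr : Metric.closedBall (0 : Euc n) r ⊆ K) {c : ℝ} (hc : 0 < c)
    (hcs : c * (Real.sqrt n + 1) ≤ 8 / 5) {t : ℝ} (ht : t ∈ Set.Icc (0 : ℝ) 1)
    {M : Euc n → ℝ}
    (hM : ∀ u : Euc n, ‖u‖ = 1 →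
      Real.exp (-(c * M u)) ≤ expInterp c (suppFn K u) (suppFn L u) t)
    (T : Finset {u : Euc n // ‖u‖ = 1}) :
    wMeasure (gaussPot n D) K ^ t * wMeasure (gaussPot n D) L ^ (1 - t)
      ≤ wMeasure (gaussPot n D) {x | ∀ u ∈ T, ⟪x, (u : Euc n)⟫ ≤ M u} := by
  let v : T × Bool → Euc n := fun k => if k.2 then k.1 else -k.1
  have hv1 : ∀ k, ‖v k‖ = 1 := by
    rintro ⟨k, _ | _⟩ <;> simp [v, k.1.2]
  let σ : Equiv.Perm (T × Bool) := Equiv.prodCongr (Equiv.refl _) Equiv.boolNot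
  have hvσ : ∀ k, v (σ k) = -v k := by
    rintro ⟨k, _ | _⟩ <;> simp [v, σ]
  have hne : K.Nonempty := hK.2.2.mono interior_subset
  have key := gaussian_polytope_interp (D := D) (u := v) (a := fun k => suppFn K (v k))
    (b := fun k => suppFn L (v k)) σ hvσ (fun k => by rw [hvσ, suppFn_neg hKsym])
    (fun k => by rw [hvσ, suppFn_neg hLsym]) hv1 hr (fun k => le_suppFn hK.1 hr.le hKr (hv1 k))
    (fun k => suppFn_mono hne hL.1 hKL) hc hcs ht
  set γ := wMeasure (gaussPot n D)
  have hKle : γ.real K ≤ γ.real {x | ∀ k, ⟪x, v k⟫ < suppFn K (v k)} := by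
    rw [measureReal_def, ← wMeasure_interior hK.2.1]
    exact measureReal_mono fun x hx k => inner_lt_suppFn hK.1 (hv1 k) hx
  have hLle : γ.real L ≤ γ.real {x | ∀ k, ⟪x, v k⟫ < suppFn L (v k)} := by
    rw [measureReal_def, ← wMeasure_interior hL.2.1]
    exact measureReal_mono fun x hx k => inner_lt_suppFn hL.1 (hv1 k) hx
  have hsub : γ.real {x | ∀ k, expInterp c (suppFn K (v k)) (suppFn L (v k)) t *
      Real.exp (c * ⟪x, v k⟫) ≤ 1} ≤ γ.real {x | ∀ u ∈ T, ⟪x, (u : Euc n)⟫ ≤ M u} := by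
    refine measureReal_mono fun x hx u hu => ?_
    have h1 : expInterp c (suppFn K u) (suppFn L u) t * Real.exp (c * ⟪x, (u : Euc n)⟫) ≤ 1 :=
      hx (⟨u, hu⟩, true)
    have h2 := (mul_le_mul_of_nonneg_right (hM u u.2) (Real.exp_pos (c * ⟪x, (u : Euc n)⟫)).le).trans h1
    rw [← Real.exp_add, Real.exp_le_one_iff] at h2
    nlinarith
  have hreal : γ.real K ^ t * γ.real L ^ (1 - t)
      ≤ γ.real {x | ∀ u ∈ T, ⟪x, (u : Euc n)⟫ ≤ M u} := by
    refine le_trans ?_ (key.trans hsub)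
    have := ht.1
    have := sub_nonneg.2 ht.2
    gcongr
  rw [← ofReal_measureReal (measure_ne_top γ K), ← ofReal_measureReal (measure_ne_top γ L),
    ← ofReal_measureReal (measure_ne_top γ {x | ∀ u ∈ T, ⟪x, (u : Euc n)⟫ ≤ M u}),
    ENNReal.ofReal_rpow_of_nonneg measureReal_nonneg ht.1,
    ENNReal.ofReal_rpow_of_nonneg measureReal_nonneg (sub_nonneg.2 ht.2),
    ← ENNReal.ofReal_mul (Real.rpow_nonneg measureReal_nonneg _)]
  exact ENNReal.ofReal_le_ofReal hreal

/-- A bound on the mass of all finite intersections of half-spaces passes to arbitrary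
intersections. -/
lemma le_measure_of_le_finite {μ : Measure (Euc n)} [IsFiniteMeasure μ] {s : ℝ≥0∞}
    {M : Euc n → ℝ}
    (h : ∀ T : Finset {u : Euc n // ‖u‖ = 1}, s ≤ μ {x | ∀ u ∈ T, ⟪x, (u : Euc n)⟫ ≤ M u}) :
    s ≤ μ {x | ∀ u : Euc n, ‖u‖ = 1 → ⟪x, u⟫ ≤ M u} := by
  have hopen : ∀ u : {u : Euc n // ‖u‖ = 1}, IsOpen {x : Euc n | M u < ⟪x, (u : Euc n)⟫} :=
    fun u => isOpen_lt continuous_const (continuous_id.inner continuous_const)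
  obtain ⟨S, hS, hSeq⟩ := TopologicalSpace.isOpen_iUnion_countable _ hopen
  have : Countable S := hS.to_subtype
  have hset : {x : Euc n | ∀ u : Euc n, ‖u‖ = 1 → ⟪x, u⟫ ≤ M u}
      = ⋂ T : Finset S, {x | ∀ u ∈ T, ⟪x, ((u : {u : Euc n // ‖u‖ = 1}) : Euc n)⟫ ≤ M u} := by
    ext x
    simp only [Set.mem_iInter, Set.mem_ofPred_eq]
    constructor
    · exact fun hx T u _ => hx _ u.1.2
    · intro hx u hu
      by_contra! hlt
      have hmem : x ∈ ⋃ u : {u : Euc n // ‖u‖ = 1}, {x : Euc n | M u < ⟪x, (u : Euc n)⟫} :=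
        Set.mem_iUnion.2 ⟨⟨u, hu⟩, hlt⟩
      rw [← hSeq] at hmem
      simp only [Set.mem_iUnion, Set.mem_ofPred_eq] at hmem
      obtain ⟨w, hw, hlt'⟩ := hmem
      exact (hx {⟨w, hw⟩} ⟨w, hw⟩ (Finset.mem_singleton_self _)).not_gt hlt'
  have hmeas : ∀ T : Finset S, MeasurableSet
      {x : Euc n | ∀ u ∈ T, ⟪x, ((u : {u : Euc n // ‖u‖ = 1}) : Euc n)⟫ ≤ M u} := fun T => by
    have e : {x : Euc n | ∀ u ∈ T, ⟪x, ((u : {u : Euc n // ‖u‖ = 1}) : Euc n)⟫ ≤ M u}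
        = ⋂ u ∈ T, {x : Euc n | ⟪x, ((u : {u : Euc n // ‖u‖ = 1}) : Euc n)⟫ ≤ M u} := by
      ext x; simp
    rw [e]
    exact T.measurableSet_biInter fun u _ => (isClosed_le (continuous_id.inner continuous_const)
      continuous_const).measurableSet
  classical
  rw [hset, Directed.measure_iInter (fun T => (hmeas T).nullMeasurableSet) ?_
    ⟨∅, measure_ne_top _ _⟩]
  · refine le_iInf fun T => (h (T.image Subtype.val)).trans (measure_mono fun x hx u hu => ?_)
    exact hx u (Finset.mem_image_of_mem _ hu)
  · intro T T'
    exact ⟨T ∪ T', fun x hx u hu => hx u (Finset.mem_union_left _ hu),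
      fun x hx u hu => hx u (Finset.mem_union_right _ hu)⟩

end GaussianMass

/-- Corollary 1.7(4): for the Gaussian measure and origin-symmetric convex bodies
`K ⊆ L` both containing `rB₂ⁿ`, if `p ∈ [0,1]` and `p ≥ 1 - r/(√n + 1/4)`, then
`γ(λK +_p (1-λ)L) ≥ γ(K)^λ γ(L)^{1-λ}`. -/
theorem gaussian_lp_BM_contained (n : ℕ) (hn : 1 ≤ n) (r : ℝ) (hr : 0 < r)
    (K L : Set (Euc n)) (hK : IsConvexBody K) (hL : IsConvexBody L)
    (hKsym : K = -K) (hLsym : L = -L) (hKL : K ⊆ L)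
    (hKr : Metric.closedBall (0 : Euc n) r ⊆ K)
    (hLr : Metric.closedBall (0 : Euc n) r ⊆ L)
    (p : ℝ) (hp : p ∈ Set.Icc (0:ℝ) 1)
    (hpr : 1 - r / (Real.sqrt n + 1 / 4) ≤ p) :
    ∀ lam ∈ Set.Icc (0:ℝ) 1,
      gaussianMeasure n K ^ lam * gaussianMeasure n L ^ (1 - lam)
        ≤ gaussianMeasure n (lpComb p lam K L) := by
  intro t ht
  have hs1 : 1 ≤ Real.sqrt n := Real.one_le_sqrt.2 (by exact_mod_cast hn)
  have hs : 0 < Real.sqrt n + 1 / 4 := by linarith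
  set c := 1 / (Real.sqrt n + 1 / 4) with hcdef
  have hc : 0 < c := by positivity
  have hcs : c * (Real.sqrt n + 1) ≤ 8 / 5 := by
    rw [hcdef, one_div_mul_eq_div, div_le_iff₀ hs]; linarith
  have hcr : 1 - p ≤ c * r := by
    rw [hcdef, one_div_mul_eq_div]; linarith
  have ha : ∀ u : Euc n, ‖u‖ = 1 → r ≤ suppFn K u := fun u hu => le_suppFn hK.1 hr.le hKr hu
  have hb : ∀ u : Euc n, ‖u‖ = 1 → r ≤ suppFn L u := fun u hu => le_suppFn hL.1 hr.le hLr hu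
  rw [gaussianMeasure_eq_wMeasure]
  by_cases hp0 : p = 0
  · rw [lpComb, if_pos hp0]
    exact le_measure_of_le_finite (M := fun u => suppFn K u ^ t * suppFn L u ^ (1 - t)) fun T =>
      wMeasure_rpow_le_finite hr hK hL hKsym hLsym hKL hKr hc hcs ht (fun u hu =>
        exp_neg_geomMean_le_expInterp hr hc (by linarith) (ha u hu) (hb u hu) ht) T
  · rw [lpComb, if_neg hp0]
    exact le_measure_of_le_finite
      (M := fun u => (t * suppFn K u ^ p + (1 - t) * suppFn L u ^ p) ^ (1 / p)) fun T =>
      wMeasure_rpow_le_finite hr hK hL hKsym hLsym hKL hKr hc hcs ht (fun u hu =>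
        exp_neg_powerMean_le_expInterp (hp.1.lt_of_ne' hp0) hr hc hcr (ha u hu) (hb u hu) ht) T

end
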